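/- Every C₄-free 2-planar finite simple graph on n ≥ 2 vertices and m edges satisfies m ≤ (190125/3136)^{1/3}·n; in particular m < 3.929·n. -/

import Mathlib

open unitInterval

/-- A (good) drawing of a simple graph in the plane: vertices map to distinct
points, each edge is drawn as a simple continuous arc between its endpoints,
arcs avoid vertex points other than their endpoints, two arcs meet in finitely
many points, and no three arcs pass through a common interior point. -/
structure PlaneDrawing {V : Type*} (G : SimpleGraph V) where
  pos : V → ℝ × ℝ
  pos_inj : Function.Injective pos
  arc : ∀ ⦃u v : V⦄, G.Adj u v → Path (pos u) (pos v)
  arc_symm : ∀ ⦃u v : V⦄ (h : G.Adj u v), arc h.symm = (arc h).symm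
  arc_inj : ∀ ⦃u v : V⦄ (h : G.Adj u v), Function.Injective (arc h)
  no_vertex_mem : ∀ ⦃u v : V⦄ (h : G.Adj u v) (w : V) (t : I),
      arc h t = pos w → w = u ∨ w = v
  finite_inter : ∀ ⦃u v x y : V⦄ (h₁ : G.Adj u v) (h₂ : G.Adj x y),
      s(u, v) ≠ s(x, y) →
      (Set.range (arc h₁) ∩ Set.range (arc h₂)).Finite
  no_triple_point : ∀ ⦃u₁ v₁ u₂ v₂ u₃ v₃ : V⦄
      (h₁ : G.Adj u₁ v₁) (h₂ : G.Adj u₂ v₂) (h₃ : G.Adj u₃ v₃),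
      s(u₁, v₁) ≠ s(u₂, v₂) → s(u₁, v₁) ≠ s(u₃, v₃) → s(u₂, v₂) ≠ s(u₃, v₃) →
      ∀ t₁ t₂ t₃ : I, t₁ ≠ 0 → t₁ ≠ 1 → t₂ ≠ 0 → t₂ ≠ 1 → t₃ ≠ 0 → t₃ ≠ 1 →
      arc h₁ t₁ = arc h₂ t₂ → arc h₂ t₂ = arc h₃ t₃ → False

namespace PlaneDrawing

variable {V : Type*} {G : SimpleGraph V} (D : PlaneDrawing G)

/-- `p` is an interior point of the arc of the edge `uv`. -/
def IsInteriorPoint {u v : V} (h : G.Adj u v) (p : ℝ × ℝ) : Prop :=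
  ∃ t : I, t ≠ 0 ∧ t ≠ 1 ∧ D.arc h t = p

/-- The set of crossing points of the drawing: points where the interiors of
the arcs of two distinct edges meet. -/
def crossings : Set (ℝ × ℝ) :=
  {p | ∃ (u v x y : V) (h₁ : G.Adj u v) (h₂ : G.Adj x y),
    s(u, v) ≠ s(x, y) ∧ D.IsInteriorPoint h₁ p ∧ D.IsInteriorPoint h₂ p}

/-- The number of crossings of the drawing. -/
noncomputable def crossingCount : ℕ := D.crossings.ncard

/-- The set of crossing points lying on the edge `uv`. -/
def edgeCrossings {u v : V} (h : G.Adj u v) : Set (ℝ × ℝ) :=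
  {p | D.IsInteriorPoint h p ∧
    ∃ (x y : V) (h₂ : G.Adj x y), s(u, v) ≠ s(x, y) ∧ D.IsInteriorPoint h₂ p}

/-- A drawing is `k`-plane if every edge is involved in at most `k` crossings. -/
def IsKPlane (k : ℕ) : Prop :=
  ∀ ⦃u v : V⦄ (h : G.Adj u v), (D.edgeCrossings h).ncard ≤ k

end PlaneDrawing

/-- The crossing number of a graph: the minimum number of crossings over all
drawings. -/
noncomputable def crossingNumber {V : Type*} (G : SimpleGraph V) : ℕ :=
  sInf {c : ℕ | ∃ D : PlaneDrawing G, D.crossingCount = c}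

/-- A graph is `k`-planar if it admits a drawing in which every edge is
involved in at most `k` crossings. -/
def KPlanar {V : Type*} (G : SimpleGraph V) (k : ℕ) : Prop :=
  ∃ D : PlaneDrawing G, D.IsKPlane k

/-- `G` has no cycle of length `ℓ`. -/
def HasNoCycleOfLength {V : Type*} (G : SimpleGraph V) (ℓ : ℕ) : Prop :=
  ∀ (v : V) (c : G.Walk v v), c.IsCycle → c.length ≠ ℓ

section

open Finset

/-- A rotation system: darts with source points, a real key which orders the darts around
each source cyclically, and a fixed-point free involution reversing darts. -/
structure RotMap (P D : Type*) where
  src : D → P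
  key : D → ℝ
  inv : D → D
  inv_inv : ∀ d, inv (inv d) = d
  inv_ne : ∀ d, inv d ≠ d
  key_inj : ∀ d d', src d = src d' → key d = key d' → d = d'

namespace RotMap

variable {P D : Type*} (M : RotMap P D)

/-- Reversal of darts as a permutation. -/
def invPerm : Equiv.Perm D := ⟨M.inv, M.inv, M.inv_inv, M.inv_inv⟩

@[simp] lemma invPerm_apply (d : D) : M.invPerm d = M.inv d := rfl

lemma inv_injective : Function.Injective M.inv := M.invPerm.injective

section
variable [Fintype D]

open Classical in
/-- Sum of `z` over the darts around the source of `d` with key at most that of `d`. -/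
noncomputable def sumLE (z : D → ℚ) (d : D) : ℚ :=
  ∑ d' with M.src d' = M.src d ∧ M.key d' ≤ M.key d, z d'

open Classical in
/-- Sum of `z` over the darts around the source of `d` with key less than that of `d`. -/
noncomputable def sumLT (z : D → ℚ) (d : D) : ℚ :=
  ∑ d' with M.src d' = M.src d ∧ M.key d' < M.key d, z d'

open Classical in
/-- Antisymmetric functions on darts satisfying Kirchhoff's law. -/
def IsCirculation (z : D → ℚ) : Prop :=
  (∀ d, z (M.inv d) = -z d) ∧ ∀ p, ∑ d with M.src d = p, z d = 0

/-- Homological planarity: each circulation is the boundary of a function on corners which is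
constant along the sides of the edges. -/
def IsPlanar : Prop :=
  ∀ z, M.IsCirculation z → ∃ b : P → ℚ, ∀ d,
    b (M.src d) + M.sumLE z d = b (M.src (M.inv d)) + M.sumLT z (M.inv d)

end

/-- `ρ` maps each dart to the cyclically next one around its source. -/
def IsRotation (ρ : Equiv.Perm D) : Prop :=
  (∀ d, M.src (ρ d) = M.src d) ∧ ∀ d,
    (M.key d < M.key (ρ d) ∧
      ∀ d', M.src d' = M.src d → ¬ (M.key d < M.key d' ∧ M.key d' < M.key (ρ d))) ∨
    (∀ d', M.src d' = M.src d → M.key (ρ d) ≤ M.key d' ∧ M.key d' ≤ M.key d)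

/-- The permutation tracing the faces of the map with rotation `ρ`. -/
def face (ρ : Equiv.Perm D) : Equiv.Perm D := ρ⁻¹ * M.invPerm

lemma face_apply (ρ : Equiv.Perm D) (d : D) : M.face ρ d = ρ.symm (M.inv d) := rfl

open Classical in
lemma exists_rotation [Fintype D] : ∃ ρ : Equiv.Perm D, M.IsRotation ρ := by
  -- the cyclic successor
  have key : ∀ d : D, ∃ e : D, M.src e = M.src d ∧
      ((M.key d < M.key e ∧
        ∀ d', M.src d' = M.src d → ¬ (M.key d < M.key d' ∧ M.key d' < M.key e)) ∨
      (∀ d', M.src d' = M.src d → M.key e ≤ M.key d' ∧ M.key d' ≤ M.key d)) := by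
    intro d
    by_cases h : (univ.filter fun e => M.src e = M.src d ∧ M.key d < M.key e).Nonempty
    · obtain ⟨e, he, hmin⟩ := exists_min_image _ M.key h
      simp only [mem_filter, mem_univ, true_and] at he hmin
      exact ⟨e, he.1, Or.inl ⟨he.2, fun d' h1 h2 => (hmin d' ⟨h1, h2.1⟩).not_gt h2.2⟩⟩
    · obtain ⟨e, he, hmin⟩ := exists_min_image (univ.filter fun e => M.src e = M.src d) M.key
        ⟨d, by simp⟩
      simp only [mem_filter, mem_univ, true_and] at he hmin
      refine ⟨e, he, Or.inr fun d' h1 => ⟨hmin d' h1, ?_⟩⟩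
      by_contra hc
      exact h ⟨d', by simp [h1, not_le.mp hc]⟩
  choose f hf1 hf2 using key
  have hinj : Function.Injective f := by
    intro a b hab
    have hs : M.src a = M.src b := by rw [← hf1 a, ← hf1 b, hab]
    apply M.key_inj a b hs
    rcases hf2 a with ⟨h1, h2⟩ | h1 <;> rcases hf2 b with ⟨h3, h4⟩ | h3
    · rw [hab] at h1 h2
      rcases lt_trichotomy (M.key a) (M.key b) with h | h | h
      · exact absurd ⟨h, h3⟩ (h2 b hs.symm)
      · exact h
      · exact absurd ⟨h, h1⟩ (h4 a hs)
    · have := (h3 a hs).1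
      rw [← hab] at this
      exact absurd h1 this.not_gt
    · have := (h1 b hs.symm).1
      rw [hab] at this
      exact absurd h3 this.not_gt
    · exact le_antisymm (h3 a hs).2 (h1 b hs.symm).2
  refine ⟨Equiv.ofBijective f (Finite.injective_iff_bijective.mp hinj), ?_, ?_⟩
  · intro d; exact hf1 d
  · intro d; exact hf2 d

variable {M}

lemma IsRotation.eq_of_apply_eq {ρ : Equiv.Perm D} (h : M.IsRotation ρ) {d d' : D}
    (hd : ρ d = d) (hs : M.src d' = M.src d) : d' = d := by
  rcases h.2 d with h1 | h1
  · rw [hd] at h1; exact absurd h1.1 (lt_irrefl _)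
  · have := h1 d' hs
    rw [hd] at this
    exact M.key_inj _ _ hs (le_antisymm this.2 this.1)

lemma IsRotation.eq_or_eq_of_apply_apply_eq {ρ : Equiv.Perm D} (h : M.IsRotation ρ) {d d' : D}
    (hd : ρ (ρ d) = d) (hs : M.src d' = M.src d) : d' = d ∨ d' = ρ d := by
  have hs' : M.src d' = M.src (ρ d) := by rw [h.1, hs]
  have e1 : M.key d' = M.key d → d' = d := M.key_inj _ _ hs
  have e2 : M.key d' = M.key (ρ d) → d' = ρ d := M.key_inj _ _ hs'
  by_contra hne
  push Not at hne
  have n1 : M.key d' ≠ M.key d := fun hh => hne.1 (e1 hh)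
  have n2 : M.key d' ≠ M.key (ρ d) := fun hh => hne.2 (e2 hh)
  rcases h.2 d with ⟨h1, h2⟩ | h1 <;> rcases h.2 (ρ d) with ⟨h3, h4⟩ | h3
  · rw [hd] at h3; exact absurd h1 h3.not_gt
  · have a1 := h2 d' hs
    have a2 := h3 d' hs'
    rw [hd] at a2
    exact a1 ⟨lt_of_le_of_ne a2.1 n1.symm, lt_of_le_of_ne a2.2 n2⟩
  · have a1 := h4 d' hs'
    have a2 := h1 d' hs
    rw [hd] at a1
    exact a1 ⟨lt_of_le_of_ne a2.1 n2.symm, lt_of_le_of_ne a2.2 n1⟩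
  · have a1 := h1 d' hs
    have a2 := h3 d' hs'
    rw [hd] at a2
    exact n1 (le_antisymm a1.2 a2.1)

section
variable [Fintype D]

open Classical in
lemma sumLE_eq_sumLT_add (z : D → ℚ) (d : D) : M.sumLE z d = M.sumLT z d + z d := by
  unfold sumLE sumLT
  have : (univ.filter fun d' => M.src d' = M.src d ∧ M.key d' ≤ M.key d) =
      insert d (univ.filter fun d' => M.src d' = M.src d ∧ M.key d' < M.key d) := by
    ext e
    simp only [mem_filter, mem_univ, true_and, mem_insert]
    constructor
    · rintro ⟨h1, h2⟩
      rcases h2.lt_or_eq with h | h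
      · exact Or.inr ⟨h1, h⟩
      · exact Or.inl (M.key_inj _ _ h1 h)
    · rintro (rfl | ⟨h1, h2⟩)
      · exact ⟨rfl, le_rfl⟩
      · exact ⟨h1, h2.le⟩
  rw [this, sum_insert (by simp), add_comm]

open Classical in
lemma IsRotation.sumLT_apply {ρ : Equiv.Perm D} (h : M.IsRotation ρ) {z : D → ℚ}
    (hz : M.IsCirculation z) (d : D) : M.sumLT z (ρ d) = M.sumLE z d := by
  unfold sumLE sumLT
  rcases h.2 d with ⟨h1, h2⟩ | h1
  · congr 1
    ext e
    simp only [mem_filter, mem_univ, true_and, h.1]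
    refine and_congr_right fun hs => ⟨fun hl => ?_, fun hl => hl.trans_lt h1⟩
    by_contra hc
    exact h2 e hs ⟨not_le.mp hc, hl⟩
  · have e1 : (univ.filter fun d' => M.src d' = M.src (ρ d) ∧ M.key d' < M.key (ρ d)) = ∅ := by
      ext e
      simp only [mem_filter, mem_univ, true_and, h.1, notMem_empty, iff_false, not_and, not_lt]
      exact fun hs => (h1 e hs).1
    have e2 : (univ.filter fun d' => M.src d' = M.src d ∧ M.key d' ≤ M.key d) =
        univ.filter fun d' => M.src d' = M.src d := by
      ext e
      simp only [mem_filter, mem_univ, true_and, and_iff_left_iff_imp]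
      exact fun hs => (h1 e hs).2
    rw [e1, e2, sum_empty, hz.2]

open Classical in
/-- Euler's inequality for planar rotation systems. -/
theorem IsPlanar.euler [Nonempty D] (hM : M.IsPlanar) {ρ : Equiv.Perm D} (h : M.IsRotation ρ) :
    Fintype.card D + 2 ≤ 2 * (univ.image M.src).card +
      2 * Nat.card (Quotient (Equiv.Perm.SameCycle.setoid (M.face ρ))) := by
  set F := Quotient (Equiv.Perm.SameCycle.setoid (M.face ρ)) with hF
  let e := Fintype.equivFin D
  let Pos := {d : D // e d < e (M.inv d)}
  have hpos : ∀ d, ¬ e d < e (M.inv d) → e (M.inv d) < e (M.inv (M.inv d)) := by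
    intro d hd
    rw [M.inv_inv]
    exact lt_of_le_of_ne (not_lt.mp hd) fun hc => M.inv_ne d (e.injective hc)
  have hcard : Fintype.card D = 2 * Fintype.card Pos := by
    have h1 : Fintype.card {d : D // ¬ e d < e (M.inv d)} = Fintype.card Pos := by
      refine Fintype.card_congr ⟨fun d => ⟨M.inv d.1, hpos _ d.2⟩, fun d => ⟨M.inv d.1, ?_⟩,
        ?_, ?_⟩
      · rw [M.inv_inv]; exact d.2.le.not_gt
      · intro d; simp [M.inv_inv]
      · intro d; simp [M.inv_inv]
    have h2 := Fintype.card_subtype_compl (fun d : D => e d < e (M.inv d))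
    have h3 := Fintype.card_subtype_le (fun d : D => e d < e (M.inv d))
    change Fintype.card _ = Fintype.card D - Fintype.card Pos at h2
    change Fintype.card Pos ≤ _ at h3
    omega
  -- the antisymmetric extension
  let ext : (Pos → ℚ) →ₗ[ℚ] (D → ℚ) :=
    { toFun := fun f d => if hd : e d < e (M.inv d) then f ⟨d, hd⟩ else -f ⟨M.inv d, hpos d hd⟩
      map_add' := by
        intro f g; funext d
        simp only [Pi.add_apply]; split_ifs <;> ring
      map_smul' := by
        intro c f; funext d
        simp only [Pi.smul_apply, smul_eq_mul, RingHom.id_apply]; split_ifs <;> ring }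
  have ext_pos : ∀ f d (hd : e d < e (M.inv d)), ext f d = f ⟨d, hd⟩ := fun f d hd => dif_pos hd
  have ext_neg : ∀ f d (hd : ¬ e d < e (M.inv d)), ext f d = -f ⟨M.inv d, hpos d hd⟩ :=
    fun f d hd => dif_neg hd
  have ext_inv : ∀ f d, ext f (M.inv d) = -ext f d := by
    intro f d
    by_cases hd : e d < e (M.inv d)
    · have : ¬ e (M.inv d) < e (M.inv (M.inv d)) := by rw [M.inv_inv]; exact hd.le.not_gt
      rw [ext_pos f d hd, ext_neg f _ this]
      congr 2
      exact Subtype.ext (M.inv_inv d)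
    · rw [ext_neg f d hd, ext_pos f _ (hpos d hd), neg_neg]
  let A : Type _ := (univ.image M.src : Finset P)
  have : Fintype A := inferInstanceAs (Fintype (univ.image M.src : Finset P))
  let T : (Pos → ℚ) →ₗ[ℚ] (A → ℚ) :=
    { toFun := fun f p => ∑ d with M.src d = p.1, ext f d
      map_add' := by
        intro f g; funext p
        simp [sum_add_distrib]
      map_smul' := by
        intro c f; funext p
        simp [mul_sum] }
  let Φ : (F → ℚ) →ₗ[ℚ] (Pos → ℚ) :=
    { toFun := fun W d => W ⟦d.1⟧ - W ⟦ρ.symm d.1⟧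
      map_add' := by intro f g; funext d; simp only [Pi.add_apply]; ring
      map_smul' := by
        intro c f; funext d
        simp only [Pi.smul_apply, smul_eq_mul, RingHom.id_apply]; ring }
  have hle : LinearMap.ker T ≤ LinearMap.range Φ := by
    intro f hf
    have hz : M.IsCirculation (ext f) := by
      refine ⟨ext_inv f, fun p => ?_⟩
      by_cases hp : p ∈ univ.image M.src
      · exact congrFun (LinearMap.mem_ker.mp hf) ⟨p, hp⟩
      · rw [filter_false_of_mem, sum_empty]
        intro d _ hd
        exact hp (mem_image.mpr ⟨d, mem_univ _, hd⟩)
    obtain ⟨b, hb⟩ := hM _ hz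
    let W : D → ℚ := fun d => b (M.src d) + M.sumLE (ext f) d
    have hpred : ∀ d, W (ρ.symm d) = b (M.src d) + M.sumLT (ext f) d := by
      intro d
      have h1 := h.sumLT_apply hz (ρ.symm d)
      have h2 := h.1 (ρ.symm d)
      rw [Equiv.apply_symm_apply] at h1 h2
      simp only [W]
      rw [← h1, ← h2]
    have hinv : ∀ d, W (M.face ρ d) = W d := by
      intro d
      rw [face_apply, hpred, ← hb]
    have hsame : ∀ a c, (Equiv.Perm.SameCycle.setoid (M.face ρ)) a c → W a = W c := by
      have hz : ∀ (n : ℤ) d, W (((M.face ρ) ^ n) d) = W d := by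
        intro n
        induction n with
        | zero => intro d; rfl
        | succ n ih => intro d; rw [zpow_add_one, Equiv.Perm.mul_apply, ih, hinv]
        | pred n ih =>
          intro d
          rw [zpow_sub_one, Equiv.Perm.mul_apply, ih, ← hinv, ← Equiv.Perm.mul_apply,
            mul_inv_cancel, Equiv.Perm.one_apply]
      rintro a c ⟨n, rfl⟩
      exact (hz n a).symm
    refine ⟨Quotient.lift W hsame, ?_⟩
    funext d
    change W d.1 - W (ρ.symm d.1) = f d
    rw [hpred]
    simp only [W]
    rw [sumLE_eq_sumLT_add]
    have : ext f d.1 = f d := ext_pos f d.1 d.2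
    rw [this]; ring
  have r1 := LinearMap.finrank_range_add_finrank_ker T
  have r2 := LinearMap.finrank_range_add_finrank_ker Φ
  have r3 := Submodule.finrank_mono hle
  have r4 : Module.finrank ℚ (LinearMap.range T) ≤ Fintype.card A := by
    simpa using Submodule.finrank_le (LinearMap.range T)
  have r5 : 1 ≤ Module.finrank ℚ (LinearMap.ker Φ) := by
    have : Nontrivial (LinearMap.ker Φ) := by
      refine ⟨⟨0, ⟨⟨fun _ => 1, ?_⟩, ?_⟩⟩⟩
      · rw [LinearMap.mem_ker]; funext d; simp [Φ]
      · intro hc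
        have := congrFun (congrArg Subtype.val hc) ⟦Classical.arbitrary D⟧
        simp at this
    exact Module.finrank_pos
  simp only [Module.finrank_fintype_fun_eq_card] at r1 r2
  have r6 : Fintype.card A = (univ.image M.src).card := by
    convert Fintype.card_coe (univ.image M.src)
  rw [Nat.card_eq_fintype_card (α := F)]
  omega

end

end RotMap

namespace List

lemma sum_map_tail_eq_sum_map_dropLast {α : Type*} {f g : α → ℚ} :
    ∀ {l : List α}, (∀ a b, [a, b] <:+: l → f b = g a) →
      (l.tail.map f).sum = (l.dropLast.map g).sum
  | [], _ => rfl
  | [_], _ => rfl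
  | a :: b :: l, h => by
    have ih := sum_map_tail_eq_sum_map_dropLast (f := f) (g := g) (l := b :: l)
      fun c d hcd => h c d (hcd.trans (List.infix_cons (List.infix_refl _)))
    have h0 := h a b ⟨[], l, rfl⟩
    simp only [List.tail_cons, List.dropLast_cons_cons, List.map_cons, List.sum_cons] at ih ⊢
    rw [h0, ih]

lemma sum_count_mul {α : Type*} [Fintype α] [DecidableEq α] (w : α → ℚ) (l : List α) :
    ∑ d, (l.count d : ℚ) * w d = (l.map w).sum := by
  induction l with
  | nil => simp
  | cons a l ih =>
    simp only [List.count_cons, List.map_cons, List.sum_cons, Nat.cast_add, add_mul,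
      sum_add_distrib, ih]
    simp [add_comm]

lemma sum_map_sub_map {α : Type*} (f g : α → ℚ) (l : List α) :
    (l.map fun a => f a - g a).sum = (l.map f).sum - (l.map g).sum := by
  induction l with
  | nil => simp
  | cons a l ih => simp only [List.map_cons, List.sum_cons, ih]; ring

lemma infix_reverse_map {α : Type*} {f : α → α} (hf : ∀ a, f (f a) = a) {a b : α}
    {l : List α} (h : [a, b] <:+: (l.map f).reverse) : [f b, f a] <:+: l := by
  have h1 := List.reverse_infix.mpr h
  rw [List.reverse_reverse] at h1
  have h2 := h1.map f
  simpa [Function.comp_def, hf] using h2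

end List

namespace RotMap

variable {P D D' : Type*}

/-- `r` lies strictly between `a` and `b` in the order of keys. -/
def Btw (M : RotMap P D) (a b r : D) : Prop :=
  (M.key a < M.key r ∧ M.key r < M.key b) ∨ (M.key b < M.key r ∧ M.key r < M.key a)

/-- The passages `d₁ → d₂` and `d₃ → d₄` through a common point do not cross. -/
def Parallel (M : RotMap P D) (d₁ d₂ d₃ d₄ : D) : Prop :=
  (d₃ = d₁ ∧ d₄ = d₂) ∨ (d₃ = M.inv d₂ ∧ d₄ = M.inv d₁) ∨
    (d₄ ≠ d₂ ∧ d₄ ≠ M.inv d₁ ∧ M.inv d₃ ≠ d₂ ∧ M.inv d₃ ≠ M.inv d₁ ∧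
      (M.Btw (M.inv d₁) d₂ d₄ ↔ M.Btw (M.inv d₁) d₂ (M.inv d₃)))

/-- The darts of `M'` are realised by paths of darts of `M` which do not cross each other. -/
structure PathSystem (M : RotMap P D) (M' : RotMap P D') where
  path : D' → List D
  path_ne : ∀ d, path d ≠ []
  src_eq : ∀ d, M'.src d = M.src ((path d).head (path_ne d))
  key_eq : ∀ d, M'.key d = M.key ((path d).head (path_ne d))
  path_inv : ∀ d, path (M'.inv d) = ((path d).map M.inv).reverse
  chain : ∀ d d₁ d₂, [d₁, d₂] <:+: path d → M.src (M.inv d₁) = M.src d₂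
  src_ne : ∀ d d₁ d₂, [d₁, d₂] <:+: path d → ∀ e, M'.src e ≠ M.src d₂
  parallel : ∀ d d₁ d₂ e d₃ d₄, [d₁, d₂] <:+: path d → [d₃, d₄] <:+: path e →
    M.src d₄ = M.src d₂ → M.Parallel d₁ d₂ d₃ d₄

open Classical in
lemma Parallel.diff_eq {M : RotMap P D} {d₁ d₂ d₃ d₄ : D} (h : M.Parallel d₁ d₂ d₃ d₄)
    (h12 : M.src (M.inv d₁) = M.src d₂) (h34 : M.src (M.inv d₃) = M.src d₄)
    (hs : M.src d₄ = M.src d₂) :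
    ((if M.key d₄ < M.key (M.inv d₁) then 1 else 0 : ℚ) - if M.key d₄ ≤ M.key d₂ then 1 else 0) =
      (if M.key (M.inv d₃) < M.key (M.inv d₁) then 1 else 0) -
        if M.key (M.inv d₃) ≤ M.key d₂ then 1 else 0 := by
  rcases h with ⟨rfl, rfl⟩ | ⟨rfl, rfl⟩ | ⟨n1, n2, n3, n4, hb⟩
  · rcases lt_trichotomy (M.key d₄) (M.key (M.inv d₃)) with h | h | h
    · simp [h, h.not_ge]
    · simp [h]
    · simp [h.not_gt, h.le]
  · rw [M.inv_inv]
    rcases lt_trichotomy (M.key d₂) (M.key (M.inv d₁)) with h | h | h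
    · simp [h, h.not_ge]
    · simp [h]
    · simp [h.not_gt, h.le]
  · have k1 : M.key d₄ ≠ M.key d₂ := fun hh => n1 (M.key_inj _ _ hs hh)
    have k2 : M.key d₄ ≠ M.key (M.inv d₁) := fun hh => n2 (M.key_inj _ _ (by rw [hs, h12]) hh)
    have k3 : M.key (M.inv d₃) ≠ M.key d₂ := fun hh => n3 (M.key_inj _ _ (by rw [h34, hs]) hh)
    have k4 : M.key (M.inv d₃) ≠ M.key (M.inv d₁) :=
      fun hh => n4 (M.key_inj _ _ (by rw [h34, hs, h12]) hh)
    unfold Btw at hb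
    split_ifs <;> grind

variable [Fintype D] [Fintype D'] {M : RotMap P D} {M' : RotMap P D'}

open Classical in
theorem PathSystem.isPlanar (S : PathSystem M M') (hM : M.IsPlanar) : M'.IsPlanar := by
  intro z' hz'
  set z : D → ℚ := fun d => ∑ e, z' e * (S.path e).count d with hzdef
  -- summation against a weight
  have hsum : ∀ w : D → ℚ, ∑ d, z d * w d = ∑ e, z' e * ((S.path e).map w).sum := by
    intro w
    simp only [hzdef, sum_mul]
    rw [sum_comm]
    refine sum_congr rfl fun e _ => ?_
    rw [← List.sum_count_mul, mul_sum]
    exact sum_congr rfl fun d _ => by ring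
  have hfilter : ∀ (q : D → Prop) [DecidablePred q], ∑ d with q d, z d =
      ∑ e, z' e * ((S.path e).map fun d => if q d then (1 : ℚ) else 0).sum := by
    intro q _
    rw [← hsum, sum_filter]
    exact sum_congr rfl fun d _ => by split_ifs <;> simp
  have hsplit : ∀ (w : D → ℚ) e, ((S.path e).map w).sum =
      w ((S.path e).head (S.path_ne e)) + ((S.path e).tail.map w).sum := by
    intro w e
    conv_lhs => rw [← List.cons_head_tail (S.path_ne e), List.map_cons, List.sum_cons]
  have htail : ∀ (w : D → ℚ), ∑ e, z' e * ((S.path e).tail.map w).sum =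
      -∑ e, z' e * ((S.path e).dropLast.map fun d => w (M.inv d)).sum := by
    intro w
    rw [← Equiv.sum_comp M'.invPerm, ← sum_neg_distrib]
    refine sum_congr rfl fun e _ => ?_
    rw [invPerm_apply, hz'.1, S.path_inv, List.tail_reverse, List.map_reverse, List.sum_reverse,
      ← List.map_dropLast, List.map_map]
    simp [Function.comp_def]
  have htail0 : ∀ (w : D → ℚ), (∀ e d₁ d₂, [d₁, d₂] <:+: S.path e → w d₂ = w (M.inv d₁)) →
      ∑ e, z' e * ((S.path e).tail.map w).sum = 0 := by
    intro w hw
    have h1 := htail w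
    have h2 : ∑ e, z' e * ((S.path e).tail.map w).sum =
        ∑ e, z' e * ((S.path e).dropLast.map fun d => w (M.inv d)).sum :=
      sum_congr rfl fun e _ => by
        rw [List.sum_map_tail_eq_sum_map_dropLast (f := w) (g := fun d => w (M.inv d)) (hw e)]
    linarith
  have hmem : ∀ e d, d ∈ (S.path e).tail → ∃ d₁, [d₁, d] <:+: S.path e := by
    intro e d hd
    generalize S.path e = l at hd
    induction l with
    | nil => simp at hd
    | cons a l ih =>
      rcases l with _ | ⟨b, l⟩
      · simp at hd
      · rw [List.tail_cons, List.mem_cons] at hd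
        rcases hd with rfl | hd
        · exact ⟨a, [], l, rfl⟩
        · obtain ⟨d₁, h⟩ := ih hd
          exact ⟨d₁, h.trans (List.infix_cons (List.infix_refl _))⟩
  have hz : M.IsCirculation z := by
    constructor
    · intro d
      simp only [hzdef]
      rw [← Equiv.sum_comp M'.invPerm, ← sum_neg_distrib]
      refine sum_congr rfl fun e _ => ?_
      rw [invPerm_apply, hz'.1, S.path_inv, List.count_reverse,
        List.count_map_of_injective _ _ M.inv_injective]
      ring
    · intro p
      rw [hfilter]
      simp only [hsplit, mul_add, sum_add_distrib]
      rw [htail0, add_zero]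
      · refine Eq.trans ?_ (hz'.2 p)
        rw [sum_filter]
        refine sum_congr rfl fun e _ => ?_
        rw [S.src_eq, mul_ite, mul_one, mul_zero]
      · intro e d₁ d₂ h
        simp only [S.chain e d₁ d₂ h]
  obtain ⟨b, hb⟩ := hM z hz
  refine ⟨b, ?_⟩
  -- values at the ends of paths
  have hends : ∀ (e : D') (q : D → Prop) (q' : D' → Prop) [DecidablePred q] [DecidablePred q'],
      (∀ f, q' f ↔ q ((S.path f).head (S.path_ne f))) →
      (∀ d, q d → M.src d = M'.src e) → ∑ d with q d, z d = ∑ f with q' f, z' f := by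
    intro e q q' _ _ hq hq2
    rw [hfilter, sum_filter]
    refine sum_congr rfl fun f _ => ?_
    rw [hsplit]
    have h0 : ((S.path f).tail.map fun d => if q d then (1 : ℚ) else 0) =
        (S.path f).tail.map fun _ => (0 : ℚ) := by
      refine List.map_congr_left fun d hd => if_neg fun hqd => ?_
      obtain ⟨d₁, h⟩ := hmem f d hd
      exact S.src_ne f d₁ d h e (hq2 d hqd).symm
    rw [h0]
    simp only [hq f]
    split_ifs <;> simp
  have hLE : ∀ e, M'.sumLE z' e = M.sumLE z ((S.path e).head (S.path_ne e)) := by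
    intro e
    refine (hends e _ _ (fun f => ?_) fun d hd => ?_).symm
    · rw [S.src_eq, S.src_eq, S.key_eq, S.key_eq]
    · rw [S.src_eq e]; exact hd.1
  have hLT : ∀ e, M'.sumLT z' e = M.sumLT z ((S.path e).head (S.path_ne e)) := by
    intro e
    refine (hends e _ _ (fun f => ?_) fun d hd => ?_).symm
    · rw [S.src_eq, S.src_eq, S.key_eq, S.key_eq]
    · rw [S.src_eq e]; exact hd.1
  -- passing through an intermediate point
  have hpass : ∀ e d₁ d₂, [d₁, d₂] <:+: S.path e → M.sumLT z (M.inv d₁) = M.sumLE z d₂ := by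
    intro e d₁ d₂ h
    unfold sumLT sumLE
    rw [hfilter, hfilter, ← sub_eq_zero, ← sum_sub_distrib]
    have hc := S.chain e d₁ d₂ h
    set w : D → ℚ := fun d => if M.src d = M.src d₂ then
      ((if M.key d < M.key (M.inv d₁) then 1 else 0 : ℚ) - if M.key d ≤ M.key d₂ then 1 else 0)
      else 0 with hw
    refine Eq.trans ?_ (htail0 w ?_)
    · refine sum_congr rfl fun f _ => ?_
      have hhead : w ((S.path f).head (S.path_ne f)) = 0 := by
        simp only [hw]
        rw [if_neg]
        rw [← S.src_eq]
        exact S.src_ne e d₁ d₂ h f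
      have hs := hsplit w f
      rw [hhead, zero_add] at hs
      rw [← mul_sub, ← hs, ← List.sum_map_sub_map]
      congr 3
      funext d
      simp only [hw, hc]
      by_cases hd : M.src d = M.src d₂ <;> simp [hd]
    · intro f d₃ d₄ h'
      have hc' := S.chain f d₃ d₄ h'
      simp only [hw, hc']
      by_cases hs : M.src d₄ = M.src d₂
      · simp only [hs, if_true]
        exact (S.parallel e d₁ d₂ f d₃ d₄ h h' hs).diff_eq hc hc' hs
      · simp [hs]
  have htel : ∀ (l : List D) (hl : l ≠ []), (∀ d₁ d₂, [d₁, d₂] <:+: l →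
      M.src (M.inv d₁) = M.src d₂ ∧ M.sumLT z (M.inv d₁) = M.sumLE z d₂) →
      b (M.src (l.head hl)) + M.sumLE z (l.head hl) =
        b (M.src (M.inv (l.getLast hl))) + M.sumLT z (M.inv (l.getLast hl)) := by
    intro l
    induction l with
    | nil => intro hl; exact absurd rfl hl
    | cons a l ih =>
      intro hl h
      rcases l with _ | ⟨c, l⟩
      · exact hb a
      · have h1 := ih (by simp) fun d₁ d₂ h' => h d₁ d₂
          (h'.trans (List.infix_cons (List.infix_refl _)))
        have h2 := h a c ⟨[], l, rfl⟩
        rw [List.getLast_cons (by simp), ← h1]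
        simp only [List.head_cons]
        rw [hb a, h2.1, h2.2]
  intro e
  have h := htel (S.path e) (S.path_ne e) fun d₁ d₂ h => ⟨S.chain e d₁ d₂ h, hpass e d₁ d₂ h⟩
  have hlast : (S.path (M'.inv e)).head (S.path_ne _) = M.inv ((S.path e).getLast (S.path_ne e)) :=
    by
    simp only [S.path_inv]
    rw [List.head_reverse, List.getLast_map]
  rw [hLE, hLT, S.src_eq, S.src_eq (M'.inv e), h, hlast]

end RotMap

/-- A finite family of directed segments, closed under reversal, none of them vertical, which
meet only in common endpoints. -/
structure SegmentFamily (D : Type*) where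
  pt : D → ℝ × ℝ
  inv : D → D
  inv_inv : ∀ d, inv (inv d) = d
  fst_ne : ∀ d, (pt d).1 ≠ (pt (inv d)).1
  pt_eq : ∀ d d', (pt d).1 = (pt d').1 → pt d = pt d'
  eq_or : ∀ d d', d ≠ d' → d ≠ inv d' → ∀ q ∈ segment ℝ (pt d) (pt (inv d)),
    q ∈ segment ℝ (pt d') (pt (inv d')) → (q = pt d ∨ q = pt (inv d)) ∧
      (q = pt d' ∨ q = pt (inv d'))

namespace SegmentFamily

variable {D : Type*} (S : SegmentFamily D)

/-- The first coordinate of the source. -/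
def x (d : D) : ℝ := (S.pt d).1

/-- The second coordinate of the source. -/
def y (d : D) : ℝ := (S.pt d).2

/-- The slope of a segment. -/
noncomputable def slope (d : D) : ℝ := (S.y (S.inv d) - S.y d) / (S.x (S.inv d) - S.x d)

/-- The affine function whose graph contains the segment. -/
noncomputable def line (d : D) (t : ℝ) : ℝ := S.y d + S.slope d * (t - S.x d)

/-- The segment is directed to the right. -/
def IsRight (d : D) : Prop := S.x d < S.x (S.inv d)

lemma x_ne (d : D) : S.x d ≠ S.x (S.inv d) := S.fst_ne d

lemma slope_inv (d : D) : S.slope (S.inv d) = S.slope d := by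
  unfold slope
  rw [S.inv_inv, ← neg_sub (S.y (S.inv d)), ← neg_sub (S.x (S.inv d)), neg_div_neg_eq]

lemma line_x (d : D) : S.line d (S.x d) = S.y d := by simp [line]

lemma line_inv (d : D) (t : ℝ) : S.line (S.inv d) t = S.line d t := by
  have h : S.x (S.inv d) - S.x d ≠ 0 := sub_ne_zero.mpr (S.x_ne d).symm
  unfold line
  rw [slope_inv]
  unfold slope
  field_simp
  ring

lemma line_x_inv (d : D) : S.line d (S.x (S.inv d)) = S.y (S.inv d) := by
  rw [← line_inv, line_x]

lemma isRight_inv {d : D} : S.IsRight (S.inv d) ↔ ¬ S.IsRight d := by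
  unfold IsRight
  rw [S.inv_inv, not_lt]
  exact ⟨le_of_lt, fun h => lt_of_le_of_ne h (S.x_ne d).symm⟩

lemma inv_ne (d : D) : S.inv d ≠ d := fun h => S.x_ne d (by rw [h])

lemma line_mem_segment {d : D} (hd : S.IsRight d) {t : ℝ} (h1 : S.x d ≤ t)
    (h2 : t ≤ S.x (S.inv d)) : (t, S.line d t) ∈ segment ℝ (S.pt d) (S.pt (S.inv d)) := by
  have hpos : 0 < S.x (S.inv d) - S.x d := sub_pos.mpr hd
  rw [segment_eq_image_lineMap]
  refine ⟨(t - S.x d) / (S.x (S.inv d) - S.x d), ⟨by apply div_nonneg <;> linarith, ?_⟩, ?_⟩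
  · rw [div_le_one hpos]; linarith
  · have hne := hpos.ne'
    have e1 : (S.pt d).1 = S.x d := rfl
    have e2 : (S.pt (S.inv d)).1 = S.x (S.inv d) := rfl
    have e3 : (S.pt d).2 = S.y d := rfl
    have e4 : (S.pt (S.inv d)).2 = S.y (S.inv d) := rfl
    ext
    · simp [AffineMap.lineMap_apply, e1, e2]
      field_simp; ring
    · simp [AffineMap.lineMap_apply, e3, e4, line, slope]
      field_simp; ring

lemma endpoint_of_line_eq {d e : D} (hd : S.IsRight d) (he : S.IsRight e) (hne : d ≠ e) {t : ℝ}
    (h1 : S.x d ≤ t) (h2 : t ≤ S.x (S.inv d)) (h3 : S.x e ≤ t) (h4 : t ≤ S.x (S.inv e))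
    (h : S.line d t = S.line e t) :
    (t = S.x d ∨ t = S.x (S.inv d)) ∧ (t = S.x e ∨ t = S.x (S.inv e)) := by
  have hne' : d ≠ S.inv e := by
    rintro rfl
    exact S.isRight_inv.mp hd he
  have h5 := S.line_mem_segment hd h1 h2
  have h6 := S.line_mem_segment he h3 h4
  rw [← h] at h6
  have h7 := S.eq_or d e hne hne' _ h5 h6
  exact ⟨h7.1.imp (congrArg Prod.fst) (congrArg Prod.fst),
    h7.2.imp (congrArg Prod.fst) (congrArg Prod.fst)⟩

lemma eq_of_slope_eq_right {d e : D} (hd : S.IsRight d) (he : S.IsRight e) (hp : S.pt d = S.pt e)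
    (h : S.slope d = S.slope e) : d = e := by
  by_contra hne
  have hx : S.x d = S.x e := congrArg Prod.fst hp
  have hy : S.y d = S.y e := congrArg Prod.snd hp
  have hl : ∀ t, S.line d t = S.line e t := fun t => by simp only [line, hx, hy, h]
  unfold IsRight at hd he
  obtain ⟨t, ht1, ht2⟩ := exists_between (lt_min hd (hx ▸ he))
  have h1 := ht2.trans_le (min_le_left _ _)
  have h2 := ht2.trans_le (min_le_right _ _)
  rcases (S.endpoint_of_line_eq hd he hne ht1.le h1.le (hx ▸ ht1.le) h2.le (hl t)).1 with h3 | h3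
  · exact ht1.ne' h3
  · exact h1.ne h3

lemma eq_of_slope_eq_left {d e : D} (hd : ¬ S.IsRight d) (he : ¬ S.IsRight e)
    (hp : S.pt d = S.pt e) (h : S.slope d = S.slope e) : d = e := by
  have hd' := S.isRight_inv.mpr hd
  have he' := S.isRight_inv.mpr he
  have hx : S.x d = S.x e := congrArg Prod.fst hp
  have hy : S.y d = S.y e := congrArg Prod.snd hp
  by_contra hne
  have hl : ∀ t, S.line (S.inv d) t = S.line (S.inv e) t := fun t => by
    rw [line_inv, line_inv]
    simp only [line, hx, hy, h]
  have hne' : S.inv d ≠ S.inv e := fun hh => hne (by rw [← S.inv_inv d, hh, S.inv_inv])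
  have hd2 := hd'
  have he2 := he'
  unfold IsRight at hd2 he2
  rw [S.inv_inv] at hd2 he2
  obtain ⟨t, ht1, ht2⟩ := exists_between (max_lt hd2 (hx ▸ he2))
  have h1 := (le_max_left _ _).trans_lt ht1
  have h2 := (le_max_right _ _).trans_lt ht1
  rcases (S.endpoint_of_line_eq hd' he' hne' h1.le (by rw [S.inv_inv]; exact ht2.le) h2.le
    (by rw [S.inv_inv, ← hx]; exact ht2.le) (hl t)).1 with h3 | h3
  · exact h1.ne' h3
  · rw [S.inv_inv] at h3
    exact ht2.ne h3

open Classical in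
/-- The rotation system of a segment family, ordering the darts by slope, those directed to the
right first. -/
noncomputable def rotMap : RotMap (ℝ × ℝ) D where
  src := S.pt
  key d := Real.arctan (S.slope d) + if S.IsRight d then 0 else Real.pi
  inv := S.inv
  inv_inv := S.inv_inv
  inv_ne := S.inv_ne
  key_inj d e hp hk := by
    have b1 := Real.arctan_lt_pi_div_two (S.slope d)
    have b2 := Real.neg_pi_div_two_lt_arctan (S.slope d)
    have b3 := Real.arctan_lt_pi_div_two (S.slope e)
    have b4 := Real.neg_pi_div_two_lt_arctan (S.slope e)
    split_ifs at hk with hd he he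
    · exact S.eq_of_slope_eq_right hd he hp (Real.arctan_injective (by linarith))
    · linarith
    · linarith
    · exact S.eq_of_slope_eq_left hd he hp (Real.arctan_injective (by linarith))

lemma rotMap_key_of_right {d : D} (h : S.IsRight d) :
    S.rotMap.key d = Real.arctan (S.slope d) := by simp [rotMap, h]

lemma rotMap_key_of_left {d : D} (h : ¬ S.IsRight d) :
    S.rotMap.key d = Real.arctan (S.slope d) + Real.pi := by simp [rotMap, h]

/-- The segment `f` passes above the segment `e`. -/
def Above (e f : D) : Prop :=
  ∃ t, S.x e < t ∧ t < S.x (S.inv e) ∧ S.x f < t ∧ t < S.x (S.inv f) ∧ S.line e t < S.line f t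

lemma exists_line_eq (e f : D) {s t : ℝ} (hs : S.line e s < S.line f s)
    (ht : S.line f t ≤ S.line e t) :
    ∃ r, r ≠ s ∧ min s t ≤ r ∧ r ≤ max s t ∧ S.line f r = S.line e r := by
  have hc : Continuous fun r => S.line f r - S.line e r := by
    unfold line; fun_prop
  have := intermediate_value_uIcc (a := t) (b := s) (f := fun r => S.line f r - S.line e r)
    hc.continuousOn
  have h0 : (0 : ℝ) ∈ Set.uIcc (S.line f t - S.line e t) (S.line f s - S.line e s) :=
    Set.mem_uIcc_of_le (by linarith) (by linarith)
  obtain ⟨r, hr, hr0⟩ := this h0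
  rw [Set.uIcc_comm, Set.uIcc, Set.mem_Icc] at hr
  refine ⟨r, ?_, hr.1, hr.2, by simpa [sub_eq_zero] using hr0⟩
  rintro rfl
  simp only [sub_eq_zero] at hr0
  linarith

lemma above_of_line_lt {e f : D} (he : S.IsRight e) (hf : S.IsRight f) (h1 : S.x e < S.x (S.inv f))
    (h2 : S.x f < S.x (S.inv e)) {s : ℝ} (hs1 : S.x e ≤ s) (hs2 : s ≤ S.x (S.inv e))
    (hs3 : S.x f ≤ s) (hs4 : s ≤ S.x (S.inv f)) (h : S.line e s < S.line f s) : S.Above e f := by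
  obtain ⟨t, ht1, ht2⟩ := exists_between (max_lt (lt_min he h1) (lt_min h2 hf))
  rw [max_lt_iff] at ht1
  rw [lt_min_iff] at ht2
  refine ⟨t, ht1.1, ht2.1, ht1.2, ht2.2, ?_⟩
  by_contra hc
  obtain ⟨r, hr1, hr2, hr3, hr4⟩ := S.exists_line_eq e f h (not_lt.mp hc)
  have hne : f ≠ e := by rintro rfl; exact lt_irrefl _ h
  rcases le_total s t with hst | hst
  · rw [min_eq_left hst] at hr2; rw [max_eq_right hst] at hr3
    have hr5 : s < r := lt_of_le_of_ne hr2 hr1.symm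
    rcases (S.endpoint_of_line_eq hf he hne (by linarith) (by linarith) (by linarith) (by linarith)
      hr4).1 with h3 | h3 <;> linarith
  · rw [min_eq_right hst] at hr2; rw [max_eq_left hst] at hr3
    have hr5 : r < s := lt_of_le_of_ne hr3 hr1
    rcases (S.endpoint_of_line_eq hf he hne (by linarith) (by linarith) (by linarith) (by linarith)
      hr4).1 with h3 | h3 <;> linarith

lemma Above.line_lt {e f : D} (h : S.Above e f) (he : S.IsRight e) (hf : S.IsRight f) {s : ℝ}
    (hs1 : S.x e ≤ s) (hs2 : s ≤ S.x (S.inv e)) (hs3 : S.x f ≤ s) (hs4 : s ≤ S.x (S.inv f))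
    (hs : (S.x e < s ∧ s < S.x (S.inv e)) ∨ (S.x f < s ∧ s < S.x (S.inv f))) :
    S.line e s < S.line f s := by
  obtain ⟨t, ht1, ht2, ht3, ht4, ht5⟩ := h
  by_contra hc
  have hne : f ≠ e := by rintro rfl; exact lt_irrefl _ ht5
  obtain ⟨r, hr1, hr2, hr3, hr4⟩ := S.exists_line_eq e f ht5 (not_lt.mp hc)
  rcases le_total t s with hst | hst
  · rw [min_eq_left hst] at hr2; rw [max_eq_right hst] at hr3
    have hr5 : t < r := lt_of_le_of_ne hr2 hr1.symm
    have h3 := S.endpoint_of_line_eq hf he hne (by linarith) (by linarith) (by linarith)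
      (by linarith) hr4
    rcases hs with hs | hs
    · rcases h3.2 with h3 | h3 <;> linarith
    · rcases h3.1 with h3 | h3 <;> linarith
  · rw [min_eq_right hst] at hr2; rw [max_eq_left hst] at hr3
    have hr5 : r < t := lt_of_le_of_ne hr3 hr1
    have h3 := S.endpoint_of_line_eq hf he hne (by linarith) (by linarith) (by linarith)
      (by linarith) hr4
    rcases hs with hs | hs
    · rcases h3.2 with h3 | h3 <;> linarith
    · rcases h3.1 with h3 | h3 <;> linarith

variable [Fintype D]

open Classical in
/-- Sum over the segments directed to the right which pass strictly above the point `p`. -/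
noncomputable def sumAbove (z : D → ℚ) (p : ℝ × ℝ) : ℚ :=
  ∑ f with S.IsRight f ∧ S.x f < p.1 ∧ p.1 < S.x (S.inv f) ∧ p.2 < S.line f p.1, z f

open Classical in
lemma sum_right_src_eq {z : D → ℚ} (hz : S.rotMap.IsCirculation z) (p : ℝ × ℝ) :
    ∑ f with S.IsRight f ∧ S.pt f = p, z f = ∑ f with S.IsRight f ∧ S.pt (S.inv f) = p, z f := by
  have h : ∑ f with S.pt f = p, z f = 0 := by convert hz.2 p; rfl
  have h1 : ∑ f with S.pt f = p, z f = ∑ f with S.IsRight f ∧ S.pt f = p, z f +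
      ∑ f with ¬ S.IsRight f ∧ S.pt f = p, z f := by
    rw [← sum_filter_add_sum_filter_not _ S.IsRight, filter_filter, filter_filter]
    simp only [and_comm]
  have h2 : ∑ f with ¬ S.IsRight f ∧ S.pt f = p, z f =
      -∑ f with S.IsRight f ∧ S.pt (S.inv f) = p, z f := by
    rw [sum_filter, sum_filter, ← Equiv.sum_comp S.rotMap.invPerm, ← sum_neg_distrib]
    refine sum_congr rfl fun f _ => ?_
    have h3 : S.rotMap.invPerm f = S.inv f := rfl
    have h4 : z (S.inv f) = - z f := hz.1 f
    simp only [h3, isRight_inv, not_not, h4]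
    split_ifs <;> simp
  linarith

open Classical in
lemma sum_above_eq_left {z : D → ℚ} {e : D} (he : S.IsRight e) :
    ∑ f with S.IsRight f ∧ S.Above e f, z f =
      ∑ f with S.IsRight f ∧ S.x e < S.x f ∧ S.x f < S.x (S.inv e) ∧ S.line e (S.x f) < S.y f, z f +
      (S.sumAbove z (S.pt e) +
        ∑ f with S.IsRight f ∧ S.pt f = S.pt e ∧ S.slope e < S.slope f, z f) := by
  rw [← sum_filter_add_sum_filter_not _ (fun f => S.x e < S.x f),
    ← sum_filter_add_sum_filter_not (filter (fun f => ¬ S.x e < S.x f) _) (fun f => S.x f < S.x e)]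
  simp only [filter_filter, sumAbove]
  refine congrArg₂ (· + ·) ?_ (congrArg₂ (· + ·) ?_ ?_)
  · congr 1; ext f
    simp only [mem_filter, mem_univ, true_and]
    constructor
    · rintro ⟨⟨hf, ha⟩, h1⟩
      have h2 : S.x f < S.x (S.inv e) := by
        obtain ⟨t, _, _, _, _, _⟩ := ha; linarith
      refine ⟨hf, h1, h2, ?_⟩
      rw [← S.line_x f]
      exact ha.line_lt S he hf h1.le h2.le le_rfl (le_of_lt hf) (Or.inl ⟨h1, h2⟩)
    · rintro ⟨hf, h1, h2, h3⟩
      refine ⟨⟨hf, ?_⟩, h1⟩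
      rw [← S.line_x f] at h3
      exact S.above_of_line_lt he hf (h1.trans hf) h2 h1.le h2.le le_rfl (le_of_lt hf) h3
  · congr 1; ext f
    simp only [mem_filter, mem_univ, true_and]
    constructor
    · rintro ⟨⟨⟨hf, ha⟩, h1⟩, h2⟩
      have h3 : S.x e < S.x (S.inv f) := by
        obtain ⟨t, _, _, _, _, _⟩ := ha; linarith
      refine ⟨hf, h2, h3, ?_⟩
      have := ha.line_lt S he hf le_rfl (le_of_lt he) h2.le h3.le (Or.inr ⟨h2, h3⟩)
      rwa [line_x] at this
    · rintro ⟨hf, h1, h2, h3⟩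
      change S.x f < S.x e at h1
      change S.x e < _ at h2
      change S.y e < S.line f (S.x e) at h3
      rw [← S.line_x e] at h3
      exact ⟨⟨⟨hf, S.above_of_line_lt he hf h2 (h1.trans he) le_rfl (le_of_lt he) h1.le h2.le h3⟩,
        h1.not_gt⟩, h1⟩
  · congr 1; ext f
    simp only [mem_filter, mem_univ, true_and]
    constructor
    · rintro ⟨⟨⟨hf, t, ht1, ht2, ht3, ht4, ht5⟩, h1⟩, h2⟩
      have hx : S.x f = S.x e := le_antisymm (not_lt.mp h1) (not_lt.mp h2)
      have hp := S.pt_eq f e hx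
      refine ⟨hf, hp, ?_⟩
      have hy : S.y f = S.y e := congrArg Prod.snd hp
      unfold line at ht5
      rw [hx, hy] at ht5
      exact lt_of_mul_lt_mul_right (by linarith) (sub_nonneg.mpr ht1.le)
    · rintro ⟨hf, hp, hs⟩
      have hx : S.x f = S.x e := congrArg Prod.fst hp
      have hy : S.y f = S.y e := congrArg Prod.snd hp
      refine ⟨⟨⟨hf, ?_⟩, hx.le.not_gt⟩, hx.ge.not_gt⟩
      obtain ⟨t, ht1, ht2⟩ := exists_between (lt_min he (hx.symm.trans_lt hf))
      rw [lt_min_iff] at ht2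
      refine ⟨t, ht1, ht2.1, hx ▸ ht1, ht2.2, ?_⟩
      unfold line
      rw [hx, hy]
      have := mul_lt_mul_of_pos_right hs (sub_pos.mpr ht1)
      linarith

open Classical in
lemma sum_above_eq_right {z : D → ℚ} {e : D} (he : S.IsRight e) :
    ∑ f with S.IsRight f ∧ S.Above e f, z f =
      ∑ f with S.IsRight f ∧ S.x e < S.x (S.inv f) ∧ S.x (S.inv f) < S.x (S.inv e) ∧
        S.line e (S.x (S.inv f)) < S.y (S.inv f), z f +
      (S.sumAbove z (S.pt (S.inv e)) +
        ∑ f with S.IsRight f ∧ S.pt (S.inv f) = S.pt (S.inv e) ∧ S.slope f < S.slope e, z f) := by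
  rw [← sum_filter_add_sum_filter_not _ (fun f => S.x (S.inv f) < S.x (S.inv e)),
    ← sum_filter_add_sum_filter_not (filter (fun f => ¬ S.x (S.inv f) < S.x (S.inv e)) _)
      (fun f => S.x (S.inv e) < S.x (S.inv f))]
  simp only [filter_filter, sumAbove]
  refine congrArg₂ (· + ·) ?_ (congrArg₂ (· + ·) ?_ ?_)
  · congr 1; ext f
    simp only [mem_filter, mem_univ, true_and]
    constructor
    · rintro ⟨⟨hf, ha⟩, h1⟩
      have h2 : S.x e < S.x (S.inv f) := by
        obtain ⟨t, _, _, _, _, _⟩ := ha; linarith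
      refine ⟨hf, h2, h1, ?_⟩
      rw [← S.line_x_inv f]
      exact ha.line_lt S he hf h2.le h1.le (le_of_lt hf) le_rfl (Or.inl ⟨h2, h1⟩)
    · rintro ⟨hf, h1, h2, h3⟩
      refine ⟨⟨hf, ?_⟩, h2⟩
      rw [← S.line_x_inv f] at h3
      exact S.above_of_line_lt he hf h1 (lt_trans hf h2) h1.le h2.le (le_of_lt hf) le_rfl h3
  · congr 1; ext f
    simp only [mem_filter, mem_univ, true_and]
    constructor
    · rintro ⟨⟨⟨hf, ha⟩, h1⟩, h2⟩
      have h3 : S.x f < S.x (S.inv e) := by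
        obtain ⟨t, _, _, _, _, _⟩ := ha; linarith
      refine ⟨hf, h3, h2, ?_⟩
      have := ha.line_lt S he hf (le_of_lt he) le_rfl h3.le h2.le (Or.inr ⟨h3, h2⟩)
      rwa [line_x_inv] at this
    · rintro ⟨hf, h1, h2, h3⟩
      change S.x f < S.x (S.inv e) at h1
      change S.x (S.inv e) < _ at h2
      change S.y (S.inv e) < S.line f (S.x (S.inv e)) at h3
      rw [← S.line_x_inv e] at h3
      exact ⟨⟨⟨hf, S.above_of_line_lt he hf (lt_trans he h2) h1
        (le_of_lt he) le_rfl h1.le h2.le h3⟩,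
        h2.not_gt⟩, h2⟩
  · congr 1; ext f
    simp only [mem_filter, mem_univ, true_and]
    constructor
    · rintro ⟨⟨⟨hf, t, ht1, ht2, ht3, ht4, ht5⟩, h1⟩, h2⟩
      have hx : S.x (S.inv f) = S.x (S.inv e) := le_antisymm (not_lt.mp h2) (not_lt.mp h1)
      have hp := S.pt_eq (S.inv f) (S.inv e) hx
      refine ⟨hf, hp, ?_⟩
      have hy : S.y (S.inv f) = S.y (S.inv e) := congrArg Prod.snd hp
      rw [← line_inv, ← S.line_inv f] at ht5
      unfold line at ht5
      rw [hx, hy, slope_inv, slope_inv] at ht5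
      nlinarith
    · rintro ⟨hf, hp, hs⟩
      have hx : S.x (S.inv f) = S.x (S.inv e) := congrArg Prod.fst hp
      have hy : S.y (S.inv f) = S.y (S.inv e) := congrArg Prod.snd hp
      refine ⟨⟨⟨hf, ?_⟩, hx.ge.not_gt⟩, hx.le.not_gt⟩
      obtain ⟨t, ht1, ht2⟩ := exists_between (max_lt he (lt_of_lt_of_eq hf hx))
      rw [max_lt_iff] at ht1
      refine ⟨t, ht1.1, ht2, ht1.2, hx ▸ ht2, ?_⟩
      rw [← line_inv, ← S.line_inv f]
      unfold line
      rw [hx, hy, slope_inv, slope_inv]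
      nlinarith

open Classical in
lemma sumAbove_add_eq {z : D → ℚ} (hz : S.rotMap.IsCirculation z) {e : D} (he : S.IsRight e) :
    S.sumAbove z (S.pt e) + ∑ f with S.IsRight f ∧ S.pt f = S.pt e ∧ S.slope e < S.slope f, z f =
      S.sumAbove z (S.pt (S.inv e)) +
        ∑ f with S.IsRight f ∧ S.pt (S.inv f) = S.pt (S.inv e) ∧ S.slope f < S.slope e, z f := by
  have h1 := S.sum_above_eq_left (z := z) he
  have h2 := S.sum_above_eq_right (z := z) he
  rw [h1] at h2
  refine add_left_cancel (h2.trans (congrArg (· + _) ?_))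
  let R : ℝ × ℝ → Prop := fun p => S.x e < p.1 ∧ p.1 < S.x (S.inv e) ∧ S.line e p.1 < p.2
  let V : Finset (ℝ × ℝ) := (univ.image S.pt).filter R
  have hV : ∀ f, S.pt f ∈ V ↔ R (S.pt f) := fun f => by simp [V]
  have h3 : ∀ g : D → ℝ × ℝ, (∀ f, g f ∈ V ↔ R (g f)) →
      ∑ f with S.IsRight f ∧ R (g f), z f = ∑ p ∈ V, ∑ f with S.IsRight f ∧ g f = p, z f := by
    intro g hg
    rw [sum_comm' (t' := univ.filter fun f => S.IsRight f ∧ R (g f)) (s' := fun f => {g f})]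
    · simp
    · intro p f
      simp only [mem_filter, mem_univ, true_and, mem_singleton]
      constructor
      · rintro ⟨h4, h5, rfl⟩; exact ⟨rfl, h5, (hg f).mp h4⟩
      · rintro ⟨rfl, h5, h6⟩; exact ⟨(hg f).mpr h6, h5, rfl⟩
  have h4 := h3 (fun f => S.pt f) hV
  have h5 := h3 (fun f => S.pt (S.inv f)) (fun f => hV (S.inv f))
  have h6 : ∑ p ∈ V, ∑ f with S.IsRight f ∧ S.pt f = p, z f =
      ∑ p ∈ V, ∑ f with S.IsRight f ∧ S.pt (S.inv f) = p, z f :=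
    sum_congr rfl fun p _ => S.sum_right_src_eq hz p
  exact (h5.trans (h6.symm.trans h4.symm))

open Classical in
lemma sumLE_of_right {z : D → ℚ} {e : D} (he : S.IsRight e) :
    S.rotMap.sumLE z e + ∑ f with S.IsRight f ∧ S.pt f = S.pt e ∧ S.slope e < S.slope f, z f =
      ∑ f with S.IsRight f ∧ S.pt f = S.pt e, z f := by
  rw [← sum_filter_add_sum_filter_not (filter (fun f => S.IsRight f ∧ S.pt f = S.pt e) _)
    (fun f => S.slope f ≤ S.slope e)]
  simp only [filter_filter, not_le, and_assoc]
  congr 1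
  unfold RotMap.sumLE
  congr 1
  ext f
  simp only [mem_filter, mem_univ, true_and, S.rotMap_key_of_right he]
  by_cases hf : S.IsRight f
  · rw [S.rotMap_key_of_right hf, Real.arctan_strictMono.le_iff_le]
    exact ⟨fun h => ⟨hf, h⟩, fun h => h.2⟩
  · have b1 := Real.arctan_lt_pi_div_two (S.slope e)
    have b2 := Real.neg_pi_div_two_lt_arctan (S.slope f)
    rw [S.rotMap_key_of_left hf]
    exact ⟨fun h => absurd h.2 (by linarith), fun h => absurd h.1 hf⟩

open Classical in
lemma sumLT_inv_of_right {z : D → ℚ} (hz : S.rotMap.IsCirculation z) {e : D} (he : S.IsRight e) :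
    S.rotMap.sumLT z (S.inv e) = ∑ f with S.IsRight f ∧ S.pt f = S.pt (S.inv e), z f -
      ∑ f with S.IsRight f ∧ S.pt (S.inv f) = S.pt (S.inv e) ∧ S.slope f < S.slope e, z f := by
  have hl : ¬ S.IsRight (S.inv e) := fun h => S.isRight_inv.mp h he
  unfold RotMap.sumLT
  rw [← sum_filter_add_sum_filter_not _ S.IsRight, sub_eq_add_neg]
  simp only [filter_filter, S.rotMap_key_of_left hl, slope_inv]
  congr 1
  · congr 1
    ext f
    simp only [mem_filter, mem_univ, true_and]
    constructor
    · exact fun h => ⟨h.2, h.1.1⟩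
    · rintro ⟨hf, hp⟩
      refine ⟨⟨hp, ?_⟩, hf⟩
      have b1 := Real.arctan_lt_pi_div_two (S.slope f)
      have b2 := Real.neg_pi_div_two_lt_arctan (S.slope e)
      rw [S.rotMap_key_of_right hf]
      linarith
  · rw [sum_filter, sum_filter, ← Equiv.sum_comp S.rotMap.invPerm, ← sum_neg_distrib]
    refine sum_congr rfl fun f _ => ?_
    have h3 : S.rotMap.invPerm f = S.inv f := rfl
    have h4 : z (S.inv f) = - z f := hz.1 f
    simp only [h3, isRight_inv, not_not, h4]
    have h5 : (((S.rotMap.src (S.inv f) = S.rotMap.src (S.inv e)) ∧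
        S.rotMap.key (S.inv f) < Real.arctan (S.slope e) + Real.pi) ∧ S.IsRight f) ↔
        (S.IsRight f ∧ S.pt (S.inv f) = S.pt (S.inv e) ∧ S.slope f < S.slope e) := by
      rw [and_comm]
      refine and_congr_right fun hf => and_congr_right fun _ => ?_
      rw [S.rotMap_key_of_left (fun h => S.isRight_inv.mp h hf), slope_inv, add_lt_add_iff_right,
        Real.arctan_strictMono.lt_iff_lt]
    simp only [h5]
    split_ifs <;> simp

open Classical in
theorem isPlanar_rotMap : S.rotMap.IsPlanar := by
  intro z hz
  refine ⟨fun p => -(S.sumAbove z p + ∑ f with S.IsRight f ∧ S.pt f = p, z f), ?_⟩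
  have hr : ∀ e, S.IsRight e →
      -(S.sumAbove z (S.pt e) + ∑ f with S.IsRight f ∧ S.pt f = S.pt e, z f) +
        S.rotMap.sumLE z e =
      -(S.sumAbove z (S.pt (S.inv e)) + ∑ f with S.IsRight f ∧ S.pt f = S.pt (S.inv e), z f) +
        S.rotMap.sumLT z (S.inv e) := by
    intro e he
    have h1 := S.sumLE_of_right (z := z) he
    have h2 := S.sumLT_inv_of_right hz he
    have h3 := S.sumAbove_add_eq hz he
    linarith
  intro d
  by_cases hd : S.IsRight d
  · exact hr d hd
  · have h1 := hr (S.inv d) (S.isRight_inv.mpr hd)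
    have h2 := RotMap.sumLE_eq_sumLT_add (M := S.rotMap) z d
    have h3 := RotMap.sumLE_eq_sumLT_add (M := S.rotMap) z (S.inv d)
    have h4 : z (S.inv d) = - z d := hz.1 d
    rw [S.inv_inv] at h1
    change -(S.sumAbove z (S.pt d) + ∑ f with S.IsRight f ∧ S.pt f = S.pt d, z f) +
        S.rotMap.sumLE z d = -(S.sumAbove z (S.pt (S.inv d)) +
          ∑ f with S.IsRight f ∧ S.pt f = S.pt (S.inv d), z f) + S.rotMap.sumLT z (S.inv d)
    linarith

end SegmentFamily

lemma RotMap.IsPlanar.of_injective {P P' D : Type*} [Fintype D] {M : RotMap P D}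
    {M' : RotMap P' D} {j : P' → P} (hj : Function.Injective j) (hs : ∀ d, M.src d = j (M'.src d))
    (hk : ∀ d, M.key d = M'.key d) (hi : ∀ d, M.inv d = M'.inv d) (hM : M.IsPlanar) :
    M'.IsPlanar := by
  intro z hz
  have hLE : ∀ d, M.sumLE z d = M'.sumLE z d := fun d => by
    unfold RotMap.sumLE
    refine sum_congr (Finset.ext fun e => ?_) fun _ _ => rfl
    simp only [mem_filter, mem_univ, true_and, hs, hj.eq_iff, hk]
  have hLT : ∀ d, M.sumLT z d = M'.sumLT z d := fun d => by
    unfold RotMap.sumLT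
    refine sum_congr (Finset.ext fun e => ?_) fun _ _ => rfl
    simp only [mem_filter, mem_univ, true_and, hs, hj.eq_iff, hk]
  have hz' : M.IsCirculation z := by
    refine ⟨fun d => by rw [hi]; exact hz.1 d, fun p => ?_⟩
    classical
    by_cases hp : ∃ d, M.src d = p
    · obtain ⟨d, rfl⟩ := hp
      refine Eq.trans ?_ (hz.2 (M'.src d))
      refine sum_congr (filter_congr fun e _ => ?_) fun _ _ => rfl
      rw [hs, hs, hj.eq_iff]
    · rw [filter_false_of_mem, sum_empty]
      exact fun d _ hd => hp ⟨d, hd⟩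
  obtain ⟨b, hb⟩ := hM z hz'
  refine ⟨b ∘ j, fun d => ?_⟩
  have := hb d
  rwa [hLE, hLT, hs, hs, hi] at this

/-- The shear of the plane with parameter `ε`. -/
def shear (ε : ℝ) : (ℝ × ℝ) ≃ₗ[ℝ] (ℝ × ℝ) where
  toFun p := (p.1 + ε * p.2, p.2)
  invFun p := (p.1 - ε * p.2, p.2)
  map_add' p q := by ext <;> simp; ring
  map_smul' c p := by ext <;> simp; ring
  left_inv p := by simp
  right_inv p := by simp

lemma exists_shear_injOn (V : Finset (ℝ × ℝ)) :
    ∃ ε : ℝ, ∀ p ∈ V, ∀ q ∈ V, (shear ε p).1 = (shear ε q).1 → p = q := by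
  obtain ⟨ε, hε⟩ := Infinite.exists_notMem_finset
    ((V ×ˢ V).image fun r => (r.2.1 - r.1.1) / (r.1.2 - r.2.2))
  refine ⟨ε, fun p hp q hq h => ?_⟩
  change p.1 + ε * p.2 = q.1 + ε * q.2 at h
  by_cases h2 : p.2 = q.2
  · refine Prod.ext ?_ h2
    rw [h2] at h; linarith
  · refine absurd (mem_image.mpr ⟨(p, q), mem_product.mpr ⟨hp, hq⟩, ?_⟩) hε
    rw [div_eq_iff (sub_ne_zero.mpr h2)]
    linarith

theorem exists_planar_rotMap (Γ : Finset ((ℝ × ℝ) × (ℝ × ℝ))) (hswap : ∀ e ∈ Γ, e.swap ∈ Γ)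
    (hne : ∀ e ∈ Γ, e.1 ≠ e.2)
    (hdisj : ∀ e ∈ Γ, ∀ f ∈ Γ, e ≠ f → e ≠ f.swap → ∀ q ∈ segment ℝ e.1 e.2,
      q ∈ segment ℝ f.1 f.2 → (q = e.1 ∨ q = e.2) ∧ (q = f.1 ∨ q = f.2)) :
    ∃ M : RotMap (ℝ × ℝ) Γ, (∀ d, M.src d = d.1.1) ∧ (∀ d, (M.inv d).1 = d.1.swap) ∧
      M.IsPlanar := by
  classical
  obtain ⟨ε, hε⟩ := exists_shear_injOn (Γ.image Prod.fst)
  have hmem : ∀ e ∈ Γ, e.1 ∈ Γ.image Prod.fst := fun e he => mem_image_of_mem _ he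
  have hmem' : ∀ e ∈ Γ, e.2 ∈ Γ.image Prod.fst := fun e he => hmem _ (hswap e he)
  have hseg : ∀ a b q, q ∈ segment ℝ (shear ε a) (shear ε b) →
      ∃ q' ∈ segment ℝ a b, shear ε q' = q := by
    intro a b q hq
    have := image_segment ℝ (shear ε).toLinearMap.toAffineMap a b
    have h2 : q ∈ (shear ε).toLinearMap.toAffineMap '' segment ℝ a b := by rw [this]; exact hq
    obtain ⟨q', h, h'⟩ := h2
    exact ⟨q', h, h'⟩
  let S : SegmentFamily Γ :=
    { pt := fun d => shear ε d.1.1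
      inv := fun d => ⟨d.1.swap, hswap _ d.2⟩
      inv_inv := fun d => rfl
      fst_ne := fun d h => hne _ d.2 (hε _ (hmem _ d.2) _ (hmem' _ d.2) h)
      pt_eq := fun d d' h => congrArg _ (hε _ (hmem _ d.2) _ (hmem _ d'.2) h)
      eq_or := by
        intro d d' h1 h2 q hq hq'
        obtain ⟨q₁, h3, rfl⟩ := hseg _ _ _ hq
        obtain ⟨q₂, h4, h5⟩ := hseg _ _ _ hq'
        obtain rfl := (shear ε).injective h5
        have := hdisj _ d.2 _ d'.2 (fun h => h1 (Subtype.ext h))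
          (fun h => h2 (Subtype.ext h)) _ h3 h4
        exact ⟨this.1.imp (congrArg _) (congrArg _), this.2.imp (congrArg _) (congrArg _)⟩ }
  let M : RotMap (ℝ × ℝ) Γ :=
    { src := fun d => d.1.1
      key := S.rotMap.key
      inv := S.inv
      inv_inv := S.inv_inv
      inv_ne := S.inv_ne
      key_inj := fun d d' hs hk => S.rotMap.key_inj d d' (congrArg (shear ε) hs) hk }
  exact ⟨M, fun _ => rfl, fun _ => rfl,
    RotMap.IsPlanar.of_injective (M := S.rotMap) (M' := M) (j := shear ε) (shear ε).injective
      (fun _ => rfl)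
      (fun _ => rfl) (fun _ => rfl) S.isPlanar_rotMap⟩

section Orbits

variable {D : Type*} [Fintype D]

open Classical in
lemma sum_sameCycle_eq (φ : Equiv.Perm D) (w : D → ℚ) (d : D) :
    ∑ e with φ.SameCycle d e, w e = ∑ i ∈ range (Function.minimalPeriod φ d), w (φ^[i] d) := by
  have hpos : 0 < Function.minimalPeriod φ d :=
    Function.minimalPeriod_pos_of_mem_periodicPts
      (Function.Injective.mem_periodicPts φ.injective d)
  symm
  refine sum_nbij (fun i => φ^[i] d) ?_ ?_ ?_ fun _ _ => rfl
  · intro i _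
    simp only [mem_filter, mem_univ, true_and]
    exact ⟨i, by rw [zpow_natCast, Equiv.Perm.iterate_eq_pow]⟩
  · intro i hi j hj h
    simp only [coe_range, Set.mem_Iio] at hi hj
    exact Function.iterate_injOn_Iio_minimalPeriod hi hj h
  · intro e he
    simp only [coe_filter, mem_univ, true_and, Set.mem_ofPred_eq] at he
    obtain ⟨n, hn⟩ := he.exists_nat_pow_eq
    refine ⟨n % Function.minimalPeriod φ d, by simpa using Nat.mod_lt _ hpos, ?_⟩
    simp only [Function.iterate_mod_minimalPeriod_eq]
    rw [Equiv.Perm.iterate_eq_pow, hn]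

open Classical in
lemma mul_card_cycles_le (φ : Equiv.Perm D) (w : D → ℚ) (c : ℚ)
    (h : ∀ d, c ≤ ∑ i ∈ range (Function.minimalPeriod φ d), w (φ^[i] d)) :
    c * Nat.card (Quotient (Equiv.Perm.SameCycle.setoid φ)) ≤ ∑ d, w d := by
  rw [Nat.card_eq_fintype_card, ← sum_fiberwise univ
    (fun d => (Quotient.mk (Equiv.Perm.SameCycle.setoid φ) d)) w]
  have : ∀ q ∈ (univ : Finset (Quotient (Equiv.Perm.SameCycle.setoid φ))),
      c ≤ ∑ d with Quotient.mk (Equiv.Perm.SameCycle.setoid φ) d = q, w d := by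
    intro q _
    induction q using Quotient.inductionOn with
    | h d =>
      refine (h d).trans_eq ?_
      rw [← sum_sameCycle_eq]
      refine sum_congr (Finset.ext fun e => ?_) fun _ _ => rfl
      simp only [mem_filter, mem_univ, true_and]
      rw [Quotient.eq]
      exact Equiv.Perm.sameCycle_comm
  have h2 := card_nsmul_le_sum _ _ _ this
  rw [nsmul_eq_mul, mul_comm] at h2
  exact h2

end Orbits

namespace RotMap

variable {P D : Type*}

/-- Restriction of a rotation system to a set of darts. -/
def restrict (M : RotMap P D) (q : D → Prop) (hq : ∀ d, q d → q (M.inv d)) :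
    RotMap P {d // q d} where
  src d := M.src d.1
  key d := M.key d.1
  inv d := ⟨M.inv d.1, hq _ d.2⟩
  inv_inv _ := Subtype.ext (M.inv_inv _)
  inv_ne d h := M.inv_ne d.1 (congrArg Subtype.val h)
  key_inj _ _ h h' := Subtype.ext (M.key_inj _ _ h h')

lemma not_infix_singleton {α : Type*} {a b c : α} : ¬ [a, b] <:+: [c] := fun h => by
  simpa using h.length_le

lemma IsPlanar.restrict [Fintype D] {M : RotMap P D} (hM : M.IsPlanar) (q : D → Prop)
    [DecidablePred q] (hq : ∀ d, q d → q (M.inv d)) : (M.restrict q hq).IsPlanar :=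
  PathSystem.isPlanar (M := M)
    { path := fun d => [d.1]
      path_ne := fun _ => List.cons_ne_nil _ _
      src_eq := fun _ => rfl
      key_eq := fun _ => rfl
      path_inv := fun _ => rfl
      chain := fun _ _ _ h => absurd h not_infix_singleton
      src_ne := fun _ _ _ h => absurd h not_infix_singleton
      parallel := fun _ _ _ _ _ _ h => absurd h not_infix_singleton } hM

/-- The darts form a simple graph on their sources. -/
structure IsSimple (M : RotMap P D) : Prop where
  src_ne : ∀ d, M.src d ≠ M.src (M.inv d)
  eq_of_src_eq : ∀ d e, M.src d = M.src e → M.src (M.inv d) = M.src (M.inv e) → d = e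

/-- There is no closed walk of length four on four distinct points. -/
def NoFourCycle (M : RotMap P D) : Prop :=
  ∀ d₀ d₁ d₂ d₃, M.src (M.inv d₀) = M.src d₁ → M.src (M.inv d₁) = M.src d₂ →
    M.src (M.inv d₂) = M.src d₃ → M.src (M.inv d₃) = M.src d₀ →
      M.src d₀ = M.src d₂ ∨ M.src d₁ = M.src d₃

lemma IsRotation.src_face {M : RotMap P D} {ρ : Equiv.Perm D} (h : M.IsRotation ρ) (d : D) :
    M.src (M.face ρ d) = M.src (M.inv d) := by
  have := h.1 (ρ.symm (M.inv d))
  rw [Equiv.apply_symm_apply] at this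
  rw [face_apply, this]

lemma apply_face (M : RotMap P D) (ρ : Equiv.Perm D) (d : D) : ρ (M.face ρ d) = M.inv d := by
  rw [face_apply, Equiv.apply_symm_apply]

/-- The face to the left of a dart is a triangle. -/
def IsTri (M : RotMap P D) (ρ : Equiv.Perm D) (d : D) : Prop :=
  M.face ρ (M.face ρ (M.face ρ d)) = d

section

variable {M : RotMap P D} {ρ : Equiv.Perm D}

lemma IsTri.face {d : D} (h : M.IsTri ρ d) : M.IsTri ρ (M.face ρ d) := by
  unfold IsTri at *; rw [h]

lemma face_ne_inv (hdeg : ∀ d, ρ (ρ d) ≠ d) (d : D) : M.face ρ d ≠ M.inv d := by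
  intro h
  have h1 := M.apply_face ρ d
  rw [h] at h1
  exact hdeg (M.inv d) (by rw [h1, h1])

lemma IsTri.not_inv (hρ : M.IsRotation ρ) (hs : M.IsSimple) (h4 : M.NoFourCycle)
    (hdeg : ∀ d, ρ (ρ d) ≠ d) {d : D} (h : M.IsTri ρ d) : ¬ M.IsTri ρ (M.inv d) := by
  intro h'
  unfold IsTri at h h'
  have s1 := hρ.src_face d
  have s2 := hρ.src_face (M.face ρ d)
  have s3 := hρ.src_face (M.face ρ (M.face ρ d))
  have t1 := hρ.src_face (M.inv d)
  have t2 := hρ.src_face (M.face ρ (M.inv d))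
  have t3 := hρ.src_face (M.face ρ (M.face ρ (M.inv d)))
  rw [h] at s3
  rw [h'] at t3
  rw [M.inv_inv] at t1
  have hc : M.src (M.face ρ (M.face ρ d)) = M.src (M.face ρ (M.face ρ (M.inv d))) := by
    have := h4 (M.face ρ d) (M.face ρ (M.face ρ d)) (M.face ρ (M.inv d))
      (M.face ρ (M.face ρ (M.inv d))) s2.symm (by rw [← s3, t1]) t2.symm (by rw [s1, t3])
    rcases this with h5 | h5
    · rw [s1, t1] at h5
      exact absurd h5.symm (hs.src_ne d)
    · exact h5
  have he : M.face ρ (M.inv d) = M.inv (M.face ρ (M.face ρ d)) :=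
    hs.eq_of_src_eq _ _ (by rw [t1, s3]) (by rw [M.inv_inv, ← t2, hc])
  have h5 := M.apply_face ρ (M.inv d)
  have h6 := M.apply_face ρ (M.face ρ (M.face ρ d))
  rw [h] at h6
  rw [he, M.inv_inv, ← h6] at h5
  exact hdeg d h5

end

open Classical in
/-- In a planar graph without four-cycles, the number of edges is at most `15 / 7` times the
number of non-isolated vertices. -/
theorem IsPlanar.card_le : ∀ (n : ℕ) {D : Type*} [Fintype D] {M : RotMap P D},
    Fintype.card D = n → M.IsPlanar → M.IsSimple → M.NoFourCycle →
      7 * Fintype.card D ≤ 30 * (univ.image M.src).card := by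
  intro n
  induction n using Nat.strong_induction_on with
  | _ n ih =>
  intro D _ M hn hM hs h4
  obtain ⟨ρ, hρ⟩ := M.exists_rotation
  by_cases hdeg : ∀ d, ρ (ρ d) ≠ d
  · rcases isEmpty_or_nonempty D with hD | hD
    · simp
    have heuler := hM.euler hρ
    let φ := M.face ρ
    let w : D → ℚ := fun d => 1 + (if M.IsTri ρ d then 1 / 4 else 0) -
      if M.IsTri ρ (M.inv d) then 1 / 4 else 0
    have hw : ∀ d, 3 / 4 ≤ w d := by
      intro d; simp only [w]; split_ifs <;> norm_num
    have horbit : ∀ d, (15 / 4 : ℚ) ≤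
        ∑ i ∈ range (Function.minimalPeriod φ d), w (φ^[i] d) := by
      intro d
      have hper := Function.iterate_minimalPeriod (f := φ) (x := d)
      have hpos : 0 < Function.minimalPeriod φ d :=
        Function.minimalPeriod_pos_of_mem_periodicPts
          (Function.Injective.mem_periodicPts φ.injective d)
      by_cases h5 : 5 ≤ Function.minimalPeriod φ d
      · have := card_nsmul_le_sum (range (Function.minimalPeriod φ d)) (fun i => w (φ^[i] d))
          (3 / 4) fun i _ => hw _
        rw [card_range, nsmul_eq_mul] at this
        have h6 : (5 : ℚ) ≤ Function.minimalPeriod φ d := by exact_mod_cast h5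
        linarith
      · generalize Function.minimalPeriod φ d = p at *
        have s := fun d => hρ.src_face d
        interval_cases p
        · change M.face ρ d = d at hper
          have := s d
          rw [hper] at this
          exact absurd this (hs.src_ne d)
        · change M.face ρ (M.face ρ d) = d at hper
          have h6 := s (M.face ρ d)
          rw [hper] at h6
          exact absurd (hs.eq_of_src_eq _ _ (s d) (by rw [M.inv_inv, h6]))
            (face_ne_inv hdeg d)
        · have h0 : M.IsTri ρ d := hper
          have hw3 : ∀ e, M.IsTri ρ e → w e = 5 / 4 := by
            intro e he
            simp only [w, if_pos he, if_neg (he.not_inv hρ hs h4 hdeg)]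
            norm_num
          have e0 := hw3 _ h0
          have e1 := hw3 _ h0.face
          have e2 := hw3 _ h0.face.face
          simp only [sum_range_succ, sum_range_zero]
          change _ ≤ 0 + w d + w (M.face ρ d) + w (M.face ρ (M.face ρ d))
          rw [e0, e1, e2]; norm_num
        · change M.face ρ (M.face ρ (M.face ρ (M.face ρ d))) = d at hper
          have s3 := s (M.face ρ (M.face ρ (M.face ρ d)))
          rw [hper] at s3
          rcases h4 d (M.face ρ d) (M.face ρ (M.face ρ d)) (M.face ρ (M.face ρ (M.face ρ d)))
            (s _).symm (s _).symm (s _).symm s3.symm with h6 | h6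
          · exact absurd (hs.eq_of_src_eq _ _ (s d) (by rw [M.inv_inv, ← s, h6]))
              (face_ne_inv hdeg d)
          · exact absurd (hs.eq_of_src_eq _ _ (s (M.face ρ d)) (by rw [M.inv_inv, ← s, h6]))
              (face_ne_inv hdeg (M.face ρ d))
    have hsum := mul_card_cycles_le φ w _ horbit
    have hw2 : ∑ d, w d = Fintype.card D := by
      simp only [w, sum_sub_distrib, sum_add_distrib]
      have h : ∑ d, (if M.IsTri ρ (M.inv d) then (1 / 4 : ℚ) else 0) =
          ∑ d, if M.IsTri ρ d then (1 / 4 : ℚ) else 0 :=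
        Equiv.sum_comp M.invPerm fun d => if M.IsTri ρ d then (1 / 4 : ℚ) else 0
      have h1 : ∑ _d : D, (1 : ℚ) = Fintype.card D := by simp
      linarith
    rw [hw2] at hsum
    have hq : (Fintype.card D : ℚ) + 2 ≤ 2 * (univ.image M.src).card +
      2 * Nat.card (Quotient (Equiv.Perm.SameCycle.setoid φ)) := by exact_mod_cast heuler
    have : (7 * Fintype.card D : ℚ) ≤ 30 * (univ.image M.src).card := by linarith
    exact_mod_cast this
  · push Not at hdeg
    obtain ⟨d, hd⟩ := hdeg
    have hfib : ∀ e, M.src e = M.src d → e = d ∨ e = ρ d :=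
      fun e he => hρ.eq_or_eq_of_apply_apply_eq hd he
    let q : D → Prop := fun e => M.src e ≠ M.src d ∧ M.src (M.inv e) ≠ M.src d
    have hq : ∀ e, q e → q (M.inv e) := fun e he => ⟨he.2, by rw [M.inv_inv]; exact he.1⟩
    have hcard : Fintype.card D ≤ Fintype.card {e // q e} + 4 := by
      have h0 : Fintype.card {e // q e} = (univ.filter q).card := by
        convert Fintype.card_subtype q
      have h1 : (univ : Finset D) ⊆ univ.filter q ∪ {d, ρ d, M.inv d, M.inv (ρ d)} := by
        intro e _
        by_cases he : q e
        · simp [he]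
        · have : M.src e = M.src d ∨ M.src (M.inv e) = M.src d := by
            by_contra hc
            push Not at hc
            exact he hc
          rcases this with h | h
          · rcases hfib e h with rfl | rfl <;> simp
          · have he2 : e = M.inv (M.inv e) := (M.inv_inv e).symm
            rcases hfib _ h with h | h <;> rw [h] at he2 <;> simp [← he2]
      have h2 := (card_le_card h1).trans (card_union_le _ _)
      have h3 : ({d, ρ d, M.inv d, M.inv (ρ d)} : Finset D).card ≤ 4 := card_le_four
      rw [card_univ] at h2
      omega
    have hlt : Fintype.card {e // q e} < n := by
      rw [← hn]
      exact Fintype.card_subtype_lt (x := d) fun h => h.1 rfl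
    have hrec := ih _ hlt (M := M.restrict q hq) rfl (hM.restrict q hq)
      ⟨fun e => hs.src_ne e.1, fun e f h h' => Subtype.ext (hs.eq_of_src_eq _ _ h h')⟩
      fun a b c e h1 h2 h3 h5 => h4 a.1 b.1 c.1 e.1 h1 h2 h3 h5
    have himg : (univ.image (M.restrict q hq).src).card + 1 ≤ (univ.image M.src).card := by
      have h1 : insert (M.src d) (univ.image (M.restrict q hq).src) ⊆ univ.image M.src := by
        intro p hp
        simp only [mem_insert, mem_image, mem_univ, true_and] at hp ⊢
        rcases hp with rfl | ⟨e, rfl⟩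
        · exact ⟨d, rfl⟩
        · exact ⟨e.1, rfl⟩
      have h2 := card_le_card h1
      rw [card_insert_of_notMem] at h2
      · exact h2
      · simp only [mem_image, mem_univ, true_and, not_exists]
        exact fun e => e.2.1
    omega

end RotMap

end

section

open Set

section Chains

variable {E : Type*} [AddCommGroup E] [Module ℝ E]

lemma segment_subset_union_of_mem {a b c y : E} (h1 : y ∈ segment ℝ a b) (h2 : y ∈ segment ℝ b c)
    (hy : y ≠ b) : segment ℝ a c ⊆ segment ℝ a b ∪ segment ℝ b c := by
  obtain ⟨α, β, hα, hβ, hs, rfl⟩ := h1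
  obtain ⟨μ, ν, hμ, hν, hs', he⟩ := h2
  have hα0 : 0 < α := by
    refine lt_of_le_of_ne hα fun h => hy ?_
    subst h
    simp only [zero_add] at hs
    simp [hs]
  have hν0 : 0 < ν := by
    refine lt_of_le_of_ne hν fun h => hy ?_
    subst h
    simp only [add_zero] at hs'
    rw [← he]
    simp [hs']
  have hc : c - b = (α / ν) • (a - b) := by
    have e1 : ν • (c - b) = α • (a - b) := by
      have hμ' : μ = 1 - ν := by linarith
      have hβ' : β = 1 - α := by linarith
      subst hμ' hβ'
      have : (1 - ν) • b + ν • c - b = α • a + (1 - α) • b - b := by rw [he]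
      calc ν • (c - b) = (1 - ν) • b + ν • c - b := by module
        _ = α • a + (1 - α) • b - b := this
        _ = α • (a - b) := by module
    rw [div_eq_inv_mul, mul_smul, ← e1, smul_smul, inv_mul_cancel₀ hν0.ne', one_smul]
  have hκ : 0 < α / ν := by positivity
  set κ := α / ν
  rintro z ⟨s, t, hs0, ht0, hst, rfl⟩
  have hc' : c = b + κ • (a - b) := by rw [← hc]; abel
  have hs1 : s = 1 - t := by linarith
  by_cases hm : s + t * κ ≤ 1
  · left
    refine ⟨s + t * κ, 1 - (s + t * κ), by positivity, by linarith, by ring, ?_⟩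
    rw [hc', hs1]
    module
  · right
    push Not at hm
    have hκ1 : s + t * κ ≤ κ := by
      have : 1 ≤ κ := by
        by_contra hlt
        push Not at hlt
        nlinarith
      nlinarith
    refine ⟨1 - (s + t * κ) / κ, (s + t * κ) / κ, ?_, by positivity, by ring, ?_⟩
    · rw [sub_nonneg, div_le_one hκ]
      exact hκ1
    · have : ((s + t * κ) / κ) • (κ • (a - b)) = (s + t * κ) • (a - b) := by
        rw [smul_smul, div_mul_cancel₀ _ hκ.ne']
      calc (1 - (s + t * κ) / κ) • b + ((s + t * κ) / κ) • c
          = b + ((s + t * κ) / κ) • (κ • (a - b)) := by rw [hc']; module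
        _ = b + (s + t * κ) • (a - b) := by rw [this]
        _ = s • a + t • c := by rw [hc', hs1]; module

lemma exists_simple_chain (S : Set E) {p q : E}
    (h : Relation.ReflTransGen (fun a b => segment ℝ a b ⊆ S) p q) :
    ∃ (n : ℕ) (f : ℕ → E), f 0 = p ∧ f n = q ∧ (∀ i < n, segment ℝ (f i) (f (i + 1)) ⊆ S) ∧
      (∀ i j, i ≤ n → j ≤ n → f i = f j → i = j) ∧
      ∀ i j, i < j → j < n → ∀ y ∈ segment ℝ (f i) (f (i + 1)), y ∈ segment ℝ (f j) (f (j + 1)) →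
        j = i + 1 ∧ y = f j := by
  classical
  let P : ℕ → Prop := fun n => ∃ f : ℕ → E, f 0 = p ∧ f n = q ∧
    ∀ i < n, segment ℝ (f i) (f (i + 1)) ⊆ S
  have hex : ∃ n, P n := by
    induction h with
    | refl => exact ⟨0, fun _ => p, rfl, rfl, by simp⟩
    | @tail b c _ hbc ih =>
      obtain ⟨n, f, h0, hn, hf⟩ := ih
      refine ⟨n + 1, fun k => if k ≤ n then f k else c, by simp [h0], by simp, fun i hi => ?_⟩
      rcases Nat.lt_succ_iff_lt_or_eq.1 hi with hi | rfl
      · simpa [hi.le, Nat.succ_le_of_lt hi] using hf i hi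
      · simpa [hn] using hbc
  obtain ⟨n, hPn, hmin⟩ : ∃ n, P n ∧ ∀ m < n, ¬ P m :=
    ⟨Nat.find hex, Nat.find_spec hex, fun m hm => Nat.find_min hex hm⟩
  obtain ⟨f, h0, hn, hf⟩ := hPn
  have key : ∀ i j, i < j → j ≤ n → f i = f j → False := fun i j hij hj he => by
    refine hmin (n - (j - i)) (by omega)
      ⟨fun k => if k ≤ i then f k else f (k + (j - i)), by simp [h0],
      ?_, fun k hk => ?_⟩
    · dsimp only
      split_ifs with hle
      · have : n = j := by omega
        rw [← hn, this, ← he]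
        congr 1
        omega
      · rw [← hn]; congr 1; omega
    · dsimp only
      rcases lt_trichotomy k i with h | rfl | h
      · rw [if_pos h.le, if_pos (by omega)]
        exact hf k (by omega)
      · rw [if_pos le_rfl, if_neg (by omega), he]
        have := hf j (by omega)
        convert this using 3
        omega
      · rw [if_neg (by omega), if_neg (by omega)]
        have := hf (k + (j - i)) (by omega)
        convert this using 3
        omega
  refine ⟨n, f, h0, hn, hf, fun i j hi hj he => ?_, fun i j hij hj y hy1 hy2 => ?_⟩
  · rcases lt_trichotomy i j with h | h | h
    · exact (key i j h hj he).elim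
    · exact h
    · exact (key j i h hi he.symm).elim
  have sub1 : segment ℝ (f i) y ⊆ S := fun z hz =>
    hf i (by omega) ((convex_segment (f i) (f (i + 1))).segment_subset (left_mem_segment ..) hy1 hz)
  have sub2 : segment ℝ y (f (j + 1)) ⊆ S := fun z hz =>
    hf j (by omega) ((convex_segment (f j) (f (j + 1))).segment_subset hy2
      (right_mem_segment ..) hz)
  by_cases hji : j = i + 1
  · subst hji
    refine ⟨rfl, ?_⟩
    by_contra hne
    have hsub := segment_subset_union_of_mem hy1 hy2 hne
    refine hmin (n - 1) (by omega) ⟨fun k => if k ≤ i then f k else f (k + 1), by simp [h0], ?_,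
      fun k hk => ?_⟩
    · dsimp only
      rw [if_neg (by omega), ← hn]; congr 1; omega
    · dsimp only
      rcases lt_trichotomy k i with h | rfl | h
      · rw [if_pos h.le, if_pos (by omega)]
        exact hf k (by omega)
      · rw [if_pos le_rfl, if_neg (by omega)]
        exact hsub.trans (union_subset (hf k (by omega)) (hf (k + 1) (by omega)))
      · rw [if_neg (by omega), if_neg (by omega)]
        exact hf (k + 1) (by omega)
  · exfalso
    refine hmin (n + 1 - (j - i)) (by omega) ⟨fun k => if k ≤ i then f k else if k = i + 1 then y
      else f (k + (j - i) - 1), by simp [h0], ?_, fun k hk => ?_⟩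
    · dsimp only
      rw [if_neg (by omega), if_neg (by omega), ← hn]; congr 1; omega
    · dsimp only
      rcases lt_trichotomy k i with h | rfl | h
      · rw [if_pos h.le, if_pos (by omega)]
        exact hf k (by omega)
      · rw [if_pos le_rfl, if_neg (by omega), if_pos rfl]
        exact sub1
      · rw [if_neg (by omega), if_neg (by omega : ¬ k + 1 ≤ i), if_neg (by omega : ¬ k + 1 = i + 1)]
        by_cases hk1 : k = i + 1
        · rw [if_pos hk1]
          convert sub2 using 3
          omega
        · rw [if_neg hk1]
          have := hf (k + (j - i) - 1) (by omega)
          convert this using 3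
          omega

end Chains

section Polygonalization

open Topology Filter Metric

variable {E : Type*} [NormedAddCommGroup E]

lemma exists_exit_times {f : ℝ → E} (hf : Continuous f) {ε : ℝ} (hε : 0 < ε)
    (h : 2 * ε < dist (f 0) (f 1)) :
    ∃ s t, 0 < s ∧ s ≤ t ∧ t < 1 ∧ dist (f s) (f 0) = ε ∧ dist (f t) (f 1) = ε ∧
      ∀ u ∈ Icc s t, (dist (f u) (f 0) ≤ ε → u = s) ∧ (dist (f u) (f 1) ≤ ε → u = t) := by
  have c0 : Continuous fun u => dist (f u) (f 0) := hf.dist continuous_const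
  have c1 : Continuous fun u => dist (f u) (f 1) := hf.dist continuous_const
  obtain ⟨s, ⟨⟨hs0, hs1⟩, hsε⟩, hsmax⟩ :=
    (IsCompact.inter_right (isCompact_Icc (a := (0 : ℝ)) (b := 1))
    (isClosed_le c0 (continuous_const (y := ε)))).exists_isGreatest
    ⟨0, ⟨le_rfl, zero_le_one⟩, by simpa using hε.le⟩
  simp only [mem_ofPred_eq] at hsε
  have e0 : dist (f s) (f 0) = ε := by
    obtain ⟨u, hu, he⟩ := intermediate_value_Icc hs1 c0.continuousOn
      (show ε ∈ Icc (dist (f s) (f 0)) (dist (f 1) (f 0)) from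
        ⟨hsε, by rw [dist_comm (f 1)]; linarith⟩)
    have : u ≤ s := hsmax ⟨⟨hs0.trans hu.1, hu.2⟩, le_of_eq he⟩
    have hus : u = s := le_antisymm this hu.1
    rwa [hus] at he
  have hs1ε : ε ≤ dist (f s) (f 1) := by
    have := dist_triangle (f 0) (f s) (f 1)
    rw [dist_comm (f 0) (f s), e0] at this
    linarith
  obtain ⟨t, ⟨⟨ht0, ht1⟩, htε⟩, htmin⟩ := (IsCompact.inter_right (isCompact_Icc (a := s) (b := 1))
    (isClosed_le c1 (continuous_const (y := ε)))).exists_isLeast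
    ⟨1, ⟨hs1, le_rfl⟩, by simpa using hε.le⟩
  simp only [mem_ofPred_eq] at htε
  have e1 : dist (f t) (f 1) = ε := by
    obtain ⟨u, hu, he⟩ := intermediate_value_Icc' ht0 c1.continuousOn
      (show ε ∈ Icc (dist (f t) (f 1)) (dist (f s) (f 1)) from ⟨htε, hs1ε⟩)
    have : t ≤ u := htmin ⟨⟨hu.1, hu.2.trans ht1⟩, le_of_eq he⟩
    have hus : u = t := le_antisymm hu.2 this
    rwa [hus] at he
  refine ⟨s, t, lt_of_le_of_ne hs0 ?_, ht0, lt_of_le_of_ne ht1 ?_, e0, e1, fun u hu => ⟨fun h => ?_,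
    fun h => ?_⟩⟩
  · rintro rfl
    simp at e0
    exact hε.ne e0
  · rintro rfl
    simp at e1
    exact hε.ne e1
  · exact le_antisymm (hsmax ⟨⟨hs0.trans hu.1, hu.2.trans ht1⟩, h⟩) hu.1
  · exact le_antisymm hu.2 (htmin ⟨⟨hu.1, hu.2.trans ht1⟩, h⟩)

variable [NormedSpace ℝ E]

lemma eq_of_mem_segment_of_dist_eq {p u v x : E} {ε : ℝ} (hu : dist u p = ε)
    (hv : dist v p = ε) (h1 : x ∈ segment ℝ p u) (h2 : x ∈ segment ℝ p v) (hx : x ≠ p) : u = v := by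
  rw [segment_eq_image'] at h1 h2
  obtain ⟨α, ⟨hα, -⟩, rfl⟩ := h1
  obtain ⟨β, ⟨hβ, -⟩, he⟩ := h2
  simp only [add_right_inj] at he
  have hα0 : α ≠ 0 := fun h => hx (by simp [h])
  have hn : β * ε = α * ε := by
    have := congrArg norm he
    rwa [norm_smul, norm_smul, ← dist_eq_norm, ← dist_eq_norm, hu, hv, Real.norm_of_nonneg hα,
      Real.norm_of_nonneg hβ] at this
  by_cases hε : ε = 0
  · subst hε
    rw [dist_eq_zero] at hu hv
    rw [hu, hv]
  · have hαβ := mul_right_cancel₀ hε hn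
    subst hαβ
    have := smul_right_injective E hα0 he
    exact (sub_left_injective this).symm

lemma reflTransGen_thickening {f : ℝ → E} (hf : Continuous f) {s t δ : ℝ} (hst : s ≤ t)
    (hδ : 0 < δ) :
    Relation.ReflTransGen (fun a b => segment ℝ a b ⊆ thickening δ (f '' Icc s t)) (f s) (f t) := by
  have hu := (isCompact_Icc (a := s) (b := t)).uniformContinuousOn_of_continuous hf.continuousOn
  rw [Metric.uniformContinuousOn_iff] at hu
  obtain ⟨η, hη, hu⟩ := hu δ hδ
  obtain ⟨N, hN⟩ := exists_nat_gt ((t - s) / η)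
  have hN0 : (0 : ℝ) < N := lt_of_le_of_lt (div_nonneg (by linarith) hη.le) hN
  have hmem : ∀ k : ℕ, k ≤ N → s + k * ((t - s) / N) ∈ Icc s t := fun k hk => by
    have h0 : 0 ≤ (t - s) / N := div_nonneg (by linarith) hN0.le
    have hk' : (k : ℝ) ≤ N := by exact_mod_cast hk
    refine ⟨by nlinarith [mul_nonneg (Nat.cast_nonneg (α := ℝ) k) h0], ?_⟩
    have : (k : ℝ) * ((t - s) / N) ≤ N * ((t - s) / N) := by gcongr
    rw [mul_div_cancel₀ _ hN0.ne'] at this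
    linarith
  have key : ∀ k : ℕ, k ≤ N → Relation.ReflTransGen
      (fun a b => segment ℝ a b ⊆ thickening δ (f '' Icc s t)) (f s)
        (f (s + k * ((t - s) / N))) := by
    intro k
    induction k with
    | zero => intro _; simp only [Nat.cast_zero, zero_mul, add_zero]; exact .refl
    | succ k ih =>
      intro hk
      refine (ih (by omega)).tail fun z hz => ?_
      rw [mem_thickening_iff]
      refine ⟨_, mem_image_of_mem f (hmem k (by omega)), ?_⟩
      have hd : dist (f (s + (k + 1 : ℕ) * ((t - s) / N))) (f (s + k * ((t - s) / N))) < δ := by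
        refine hu _ (hmem _ hk) _ (hmem k (by omega)) ?_
        rw [Real.dist_eq]
        have : s + (k + 1 : ℕ) * ((t - s) / N) - (s + k * ((t - s) / N)) = (t - s) / N := by
          push_cast; ring
        rw [this, abs_of_nonneg (div_nonneg (by linarith) hN0.le), div_lt_iff₀ hN0]
        rwa [div_lt_iff₀ hη, mul_comm] at hN
      exact (convex_ball (f (s + k * ((t - s) / N))) δ).segment_subset (mem_ball_self hδ) hd hz
  have := key N le_rfl
  rwa [mul_div_cancel₀ _ hN0.ne', add_sub_cancel] at this

theorem exists_polygonal_sets {J : Type*} [Finite J] (γ : J → ℝ → E) (hγ : ∀ j, Continuous (γ j))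
    (hne : ∀ j, γ j 0 ≠ γ j 1)
    (hdisj : ∀ j k, ∀ s ∈ Ioo (0 : ℝ) 1, ∀ t ∈ Icc (0 : ℝ) 1, γ j s = γ k t → k = j ∧ t = s) :
    ∃ S : J → Set E,
      (∀ j, Relation.ReflTransGen (fun a b => segment ℝ a b ⊆ S j) (γ j 0) (γ j 1)) ∧
      ∀ j k, j ≠ k → ∀ x ∈ S j, x ∈ S k → (x = γ j 0 ∨ x = γ j 1) ∧ (x = γ k 0 ∨ x = γ k 1) := by
  classical
  let e : J × Bool → E := fun a => γ a.1 (if a.2 then 1 else 0)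
  have he : ∀ a : J × Bool, e a = γ a.1 0 ∨ e a = γ a.1 1 := by
    rintro ⟨j, (_ | _)⟩ <;> simp [e]
  have hev : ∀ c : ℝ, 0 < c → ∀ᶠ ε in 𝓝[>] (0 : ℝ), ε < c := fun c hc =>
    mem_nhdsWithin_of_mem_nhds (Iio_mem_nhds hc)
  obtain ⟨ε, ⟨c1, c2⟩, hε⟩ : ∃ ε : ℝ, ((∀ a b : J × Bool, e a ≠ e b → 2 * ε < dist (e a) (e b)) ∧
      ∀ (a : J × Bool) (j : J), e a ≠ γ j 0 → e a ≠ γ j 1 → ∀ t ∈ Icc (0 : ℝ) 1,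
        ε < dist (γ j t) (e a)) ∧ 0 < ε := by
    refine Eventually.exists (f := 𝓝[>] (0 : ℝ))
      (((eventually_all.2 fun a => eventually_all.2 fun b =>
      eventually_imp_distrib_left.2 fun hab => ?_).and
        (eventually_all.2 fun a => eventually_all.2 fun j =>
      eventually_imp_distrib_left.2 fun h0 => eventually_imp_distrib_left.2 fun h1 => ?_)).and
      self_mem_nhdsWithin)
    · filter_upwards [hev (dist (e a) (e b) / 2) (by have := dist_pos.2 hab; positivity)] with ε h
      linarith
    · obtain ⟨u, hu, hmin⟩ := (isCompact_Icc (a := (0 : ℝ)) (b := 1)).exists_isMinOn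
        ⟨0, ⟨le_rfl, zero_le_one⟩⟩ ((hγ j).dist (continuous_const (y := e a))).continuousOn
      have hpos : 0 < dist (γ j u) (e a) := by
        rw [dist_pos]
        intro heq
        rcases eq_or_lt_of_le hu.1 with h | hu0
        · exact h0 (by rw [← heq, ← h])
        rcases eq_or_lt_of_le hu.2 with h | hu1
        · exact h1 (by rw [← heq, h])
        obtain ⟨-, h⟩ := hdisj j a.1 u ⟨hu0, hu1⟩ _ (by split_ifs <;> simp) heq
        split_ifs at h <;> linarith
      filter_upwards [hev _ hpos] with ε h t ht
      exact h.trans_le (hmin ht)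
  choose s t hs0 hst ht1 hs ht hmid using fun j => exists_exit_times (hγ j) hε
    (c1 (j, false) (j, true) (by simpa [e] using hne j))
  let y : J × Bool → E := fun a => γ a.1 (if a.2 then t a.1 else s a.1)
  have hyI : ∀ a : J × Bool, (if a.2 then t a.1 else s a.1) ∈ Ioo (0 : ℝ) 1 := fun a => by
    have := hs0 a.1; have := hst a.1; have := ht1 a.1
    constructor <;> split_ifs <;> linarith
  have hy : ∀ a, dist (y a) (e a) = ε := by
    rintro ⟨j, (_ | _)⟩
    · simpa [y, e] using hs j
    · simpa [y, e] using ht j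
  let K : J → Set E := fun j => γ j '' Icc (s j) (t j)
  have hK : ∀ j, IsCompact (K j) := fun j => isCompact_Icc.image (hγ j)
  let L : J × Bool → Set E := fun a => segment ℝ (e a) (y a)
  have hLball : ∀ a, ∀ x ∈ L a, dist x (e a) ≤ ε := fun a x hx =>
    (convex_closedBall (e a) ε).segment_subset (mem_closedBall_self hε.le) (hy a).le hx
  have hmid' : ∀ (a : J × Bool) (j : J), ∀ u ∈ Icc (s j) (t j), dist (γ j u) (e a) ≤ ε →
      dist (γ j u) (e a) = ε := fun a j u hu hle => by
    by_cases h0 : e a = γ j 0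
    · rw [h0] at hle ⊢
      rw [(hmid j u hu).1 hle, hs j]
    by_cases h1 : e a = γ j 1
    · rw [h1] at hle ⊢
      rw [(hmid j u hu).2 hle, ht j]
    exact absurd hle (c2 a j h0 h1 u ⟨(hs0 j).le.trans hu.1, hu.2.trans (ht1 j).le⟩).not_ge
  have hLL : ∀ a b : J × Bool, a.1 ≠ b.1 → ∀ x ∈ L a, x ∈ L b → x = e a ∧ x = e b := by
    intro a b hab x hxa hxb
    have heq : e a = e b := by
      by_contra hne'
      have := c1 a b hne'
      have := dist_triangle_left (e a) (e b) x
      have := hLball a x hxa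
      have := hLball b x hxb
      linarith
    have : x = e a := by
      by_contra hxe
      have hya := hy a
      simp only [L] at hxa hxb
      rw [heq] at hxa hxe hya
      have := eq_of_mem_segment_of_dist_eq hya (hy b) hxa hxb hxe
      exact hab (hdisj a.1 b.1 _ (hyI a) _ (Ioo_subset_Icc_self (hyI b)) this).1.symm
    exact ⟨this, heq ▸ this⟩
  have hKL : ∀ (a : J × Bool) (k : J), a.1 ≠ k → Disjoint (K k) (L a) := by
    intro a k hak
    rw [Set.disjoint_left]
    rintro _ ⟨u, hu, rfl⟩ hxL
    have hd := hmid' a k u hu (hLball a _ hxL)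
    have := eq_of_mem_segment_of_dist_eq (hy a) hd hxL (right_mem_segment ..) (fun h => by
      rw [h, dist_self] at hd
      exact hε.ne hd)
    exact hak (hdisj a.1 k _ (hyI a) u ⟨(hs0 k).le.trans hu.1, hu.2.trans (ht1 k).le⟩ this).1.symm
  have hKK : ∀ j k, j ≠ k → Disjoint (K j) (K k) := by
    intro j k hjk
    rw [Set.disjoint_left]
    rintro _ ⟨u, hu, rfl⟩ ⟨v, hv, h⟩
    exact hjk (hdisj j k u ⟨(hs0 j).trans_le hu.1, hu.2.trans_lt (ht1 j)⟩ v
      ⟨(hs0 k).le.trans hv.1, hv.2.trans (ht1 k).le⟩ h.symm).1.symm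
  have hthick : ∀ A B : Set E, IsCompact A → IsClosed B → Disjoint A B →
      ∀ᶠ δ in 𝓝[>] (0 : ℝ), Disjoint (thickening δ A) (thickening δ B) := fun A B hA hB hAB => by
    obtain ⟨δ, hδ, hd⟩ := hAB.exists_thickenings hA hB
    filter_upwards [hev δ hδ] with δ' h
    exact hd.mono (thickening_mono h.le _) (thickening_mono h.le _)
  have hLc : ∀ a, IsClosed (L a) := fun a => by
    have : L a = AffineMap.lineMap (e a) (y a) '' Icc (0 : ℝ) 1 := segment_eq_image_lineMap ..
    rw [this]
    exact (isCompact_Icc.image AffineMap.lineMap_continuous).isClosed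
  obtain ⟨δ, ⟨d1, d2⟩, hδ⟩ : ∃ δ : ℝ, ((∀ j k, j ≠ k → Disjoint (thickening δ (K j))
      (thickening δ (K k))) ∧ ∀ (a : J × Bool) (k : J), a.1 ≠ k →
      Disjoint (thickening δ (K k)) (thickening δ (L a))) ∧ 0 < δ :=
    Eventually.exists (f := 𝓝[>] (0 : ℝ)) (((eventually_all.2 fun j => eventually_all.2 fun k =>
      eventually_imp_distrib_left.2 fun hjk => hthick _ _ (hK j) (hK k).isClosed (hKK j k hjk)).and
      (eventually_all.2 fun a => eventually_all.2 fun k => eventually_imp_distrib_left.2 fun hak =>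
        hthick _ _ (hK k) (hLc a) (hKL a k hak))).and self_mem_nhdsWithin)
  have hsub : ∀ a, L a ⊆ thickening δ (L a) := fun a => self_subset_thickening hδ _
  refine ⟨fun j => L (j, false) ∪ L (j, true) ∪ thickening δ (K j), fun j => ?_, ?_⟩
  · have h1 : Relation.ReflTransGen (fun a b => segment ℝ a b ⊆ L (j, false) ∪ L (j, true) ∪
        thickening δ (K j)) (γ j 0) (γ j (s j)) := .single (by
      simp [L, e, y, union_assoc])
    have h3 : Relation.ReflTransGen (fun a b => segment ℝ a b ⊆ L (j, false) ∪ L (j, true) ∪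
        thickening δ (K j)) (γ j (t j)) (γ j 1) := .single (by
      rw [segment_symm]
      refine (subset_union_right (s := L (j, false))).trans subset_union_left |>.trans' ?_
      simp [L, e, y])
    have h2 := Relation.ReflTransGen.mono
      (p := fun a b => segment ℝ a b ⊆ L (j, false) ∪ L (j, true) ∪ thickening δ (K j))
      (fun a b h => h.trans subset_union_right) _ _ (reflTransGen_thickening (hγ j) (hst j) hδ)
    exact (h1.trans h2).trans h3
  · have hcase : ∀ j k, j ≠ k → ∀ x ∈ L (j, false) ∪ L (j, true) ∪ thickening δ (K j),
        x ∈ L (k, false) ∪ L (k, true) ∪ thickening δ (K k) → x = γ j 0 ∨ x = γ j 1 := by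
      intro j k hjk x hxj hxk
      have hj : (∃ b, x ∈ L (j, b)) ∨ x ∈ thickening δ (K j) := by
        rcases hxj with (h | h) | h
        exacts [.inl ⟨_, h⟩, .inl ⟨_, h⟩, .inr h]
      have hk : (∃ b, x ∈ L (k, b)) ∨ x ∈ thickening δ (K k) := by
        rcases hxk with (h | h) | h
        exacts [.inl ⟨_, h⟩, .inl ⟨_, h⟩, .inr h]
      rcases hj with ⟨b, hb⟩ | hj <;> rcases hk with ⟨c, hc⟩ | hk
      · have := (hLL (j, b) (k, c) hjk x hb hc).1
        rw [this]
        exact he (j, b)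
      · exact (Set.disjoint_left.1 (d2 (j, b) k hjk) hk (hsub _ hb)).elim
      · exact (Set.disjoint_left.1 (d2 (k, c) j hjk.symm) hj (hsub _ hc)).elim
      · exact (Set.disjoint_left.1 (d1 j k hjk) hj hk).elim
    exact fun j k hjk x hxj hxk => ⟨hcase j k hjk x hxj hxk, hcase k j hjk.symm x hxk hxj⟩

end Polygonalization

end

section

open Finset

namespace List

lemma pair_infix_append {α : Type*} {a b : α} {l₁ l₂ : List α} (h : [a, b] <:+: l₁ ++ l₂) :
    [a, b] <:+: l₁ ∨ [a, b] <:+: l₂ ∨ (a ∈ l₁.getLast? ∧ b ∈ l₂.head?) := by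
  induction l₁ with
  | nil => exact .inr (.inl h)
  | cons c l ih =>
    rw [cons_append, infix_cons_iff] at h
    rcases h with h | h
    · cases l with
      | nil =>
        cases l₂ with
        | nil => simp at h
        | cons e l₂ =>
          simp only [nil_append, cons_prefix_cons, nil_prefix, and_true] at h
          right; right
          simp [h.1, h.2]
      | cons e l =>
        left
        simp only [cons_append, cons_prefix_cons, nil_prefix, and_true] at h
        rw [h.1, h.2]
        exact ⟨[], l, rfl⟩
    · rcases ih h with h | h | ⟨h1, h2⟩
      · exact .inl (h.trans (suffix_cons _ _).isInfix)
      · exact .inr (.inl h)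
      · refine .inr (.inr ⟨?_, h2⟩)
        cases l with
        | nil => simp at h1
        | cons e l => simpa using h1

lemma exists_append_of_pair_infix {α : Type*} {a b : α} {l : List α} (h : [a, b] <:+: l) :
    ∃ l₁ l₂, l = l₁ ++ l₂ ∧ a ∈ l₁.getLast? ∧ b ∈ l₂.head? := by
  obtain ⟨s, t, rfl⟩ := h
  exact ⟨s ++ [a], b :: t, by simp, by simp, by simp⟩

lemma pair_infix_of_append {α : Type*} {a b : α} {l₁ l₂ : List α} (ha : a ∈ l₁.getLast?)
    (hb : b ∈ l₂.head?) : [a, b] <:+: l₁ ++ l₂ := by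
  obtain ⟨hne, rfl⟩ := mem_getLast?_eq_getLast ha
  cases l₂ with
  | nil => simp at hb
  | cons c l₂ =>
    simp only [head?_cons, Option.mem_def, Option.some.injEq] at hb
    subst hb
    exact ⟨l₁.dropLast, l₂, by
      conv_rhs => rw [← dropLast_append_getLast hne]
      simp⟩

end List

namespace RotMap

variable {V P D : Type*} {M : RotMap P D}

/-- The passages `d₁ → d₂` and `d₃ → d₄` cross each other at their common point. -/
structure Sep (M : RotMap P D) (d₁ d₂ d₃ d₄ : D) : Prop where
  src₁ : M.src (M.inv d₁) = M.src d₂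
  src₃ : M.src (M.inv d₃) = M.src d₄
  src_eq : M.src d₄ = M.src d₂
  btw : M.Btw (M.inv d₁) d₂ d₄ ↔ ¬ M.Btw (M.inv d₁) d₂ (M.inv d₃)
  ne₁ : M.inv d₁ ≠ d₂
  ne₂ : M.inv d₁ ≠ M.inv d₃
  ne₃ : M.inv d₁ ≠ d₄
  ne₄ : d₂ ≠ M.inv d₃
  ne₅ : d₂ ≠ d₄
  ne₆ : M.inv d₃ ≠ d₄

/-- Some dart lies on either side of the passage `d → d'`. -/
def Cross (M : RotMap P D) (d d' : D) : Prop :=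
  ∃ r r', M.src r = M.src d' ∧ M.src r' = M.src d' ∧ r' ≠ M.inv d ∧ r' ≠ d' ∧
    M.Btw (M.inv d) d' r ∧ ¬ M.Btw (M.inv d) d' r'

lemma key_ne_of_ne {a b : D} (h : M.src a = M.src b) (hn : a ≠ b) : M.key a ≠ M.key b :=
  fun he => hn (M.key_inj _ _ h he)

lemma Sep.keys {d₁ d₂ d₃ d₄ : D} (h : M.Sep d₁ d₂ d₃ d₄) :
    M.key (M.inv d₁) ≠ M.key d₂ ∧ M.key (M.inv d₁) ≠ M.key (M.inv d₃) ∧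
    M.key (M.inv d₁) ≠ M.key d₄ ∧ M.key d₂ ≠ M.key (M.inv d₃) ∧ M.key d₂ ≠ M.key d₄ ∧
    M.key (M.inv d₃) ≠ M.key d₄ := by
  have h1 := h.src₁; have h2 := h.src₃; have h3 := h.src_eq
  exact ⟨key_ne_of_ne h1 h.ne₁, key_ne_of_ne (by rw [h1, h2, h3]) h.ne₂,
    key_ne_of_ne (by rw [h1, h3]) h.ne₃, key_ne_of_ne (by rw [h2, h3]) h.ne₄,
    key_ne_of_ne h3.symm h.ne₅, key_ne_of_ne h2 h.ne₆⟩

lemma Sep.symm {d₁ d₂ d₃ d₄ : D} (h : M.Sep d₁ d₂ d₃ d₄) : M.Sep d₃ d₄ d₁ d₂ := by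
  obtain ⟨k1, k2, k3, k4, k5, k6⟩ := h.keys
  refine ⟨h.src₃, h.src₁, h.src_eq.symm, ?_, h.ne₆, h.ne₂.symm, h.ne₄.symm, h.ne₃.symm, h.ne₅.symm,
    h.ne₁⟩
  have := h.btw
  unfold Btw at *
  grind

lemma Sep.rev {d₁ d₂ d₃ d₄ : D} (h : M.Sep d₁ d₂ d₃ d₄) : M.Sep d₁ d₂ (M.inv d₄) (M.inv d₃) := by
  refine ⟨h.src₁, by rw [M.inv_inv, h.src₃], by rw [h.src₃, h.src_eq], ?_, h.ne₁, ?_, h.ne₂, ?_,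
    h.ne₄, ?_⟩
  · rw [M.inv_inv]
    have := h.btw
    grind
  · rw [M.inv_inv]; exact h.ne₃
  · rw [M.inv_inv]; exact h.ne₅
  · rw [M.inv_inv]; exact h.ne₆.symm

lemma Sep.cross {d₁ d₂ d₃ d₄ : D} (h : M.Sep d₁ d₂ d₃ d₄) : M.Cross d₁ d₂ := by
  by_cases hb : M.Btw (M.inv d₁) d₂ d₄
  · exact ⟨d₄, M.inv d₃, h.src_eq, h.src₃.trans h.src_eq, h.ne₂.symm, h.ne₄.symm, hb, h.btw.1 hb⟩
  · refine ⟨M.inv d₃, d₄, h.src₃.trans h.src_eq, h.src_eq, h.ne₃.symm, h.ne₅.symm, ?_, hb⟩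
    have := h.btw
    grind

lemma cross_inv {d d' : D} (h : M.src (M.inv d) = M.src d') :
    M.Cross (M.inv d') (M.inv d) ↔ M.Cross d d' := by
  unfold Cross Btw
  simp only [M.inv_inv, h]
  constructor <;> rintro ⟨r, r', h1, h2, h3, h4, h5, h6⟩ <;>
    exact ⟨r, r', h1, h2, h4, h3, h5.symm, fun h => h6 h.symm⟩

section

variable [Fintype D]

open Classical in
lemma eq_of_card_le_four {p : P} (hp : (univ.filter fun d => M.src d = p).card ≤ 4) {a b c d e : D}
    (ha : M.src a = p) (hb : M.src b = p) (hc : M.src c = p) (hd : M.src d = p) (he : M.src e = p)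
    (hab : a ≠ b) (hac : a ≠ c) (had : a ≠ d) (hbc : b ≠ c) (hbd : b ≠ d) (hcd : c ≠ d) :
    e = a ∨ e = b ∨ e = c ∨ e = d := by
  by_contra hne
  push Not at hne
  have : ({e, a, b, c, d} : Finset D) ⊆ univ.filter fun d => M.src d = p := by
    intro x hx
    simp only [mem_insert, mem_singleton] at hx
    simp only [mem_filter, mem_univ, true_and]
    rcases hx with rfl | rfl | rfl | rfl | rfl <;> assumption
  have hcard : ({e, a, b, c, d} : Finset D).card = 5 := by
    rw [card_insert_of_notMem (by simp [hne]), card_insert_of_notMem (by simp [hab, hac, had]),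
      card_insert_of_notMem (by simp [hbc, hbd]), card_insert_of_notMem (by simp [hcd]),
        card_singleton]
  have := card_le_card this
  omega

open Classical in
lemma Sep.fiber {d₁ d₂ d₃ d₄ r : D} (h : M.Sep d₁ d₂ d₃ d₄)
    (hp : (univ.filter fun d => M.src d = M.src d₂).card ≤ 4) (hr : M.src r = M.src d₂) :
    r = M.inv d₁ ∨ r = d₂ ∨ r = M.inv d₃ ∨ r = d₄ :=
  eq_of_card_le_four hp h.src₁ rfl (h.src₃.trans h.src_eq) h.src_eq hr h.ne₁ h.ne₂ h.ne₃ h.ne₄ h.ne₅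
    h.ne₆

open Classical in
lemma Sep.not_cross {d₁ d₂ d₃ d₄ : D} (h : M.Sep d₁ d₂ d₃ d₄)
    (hp : (univ.filter fun d => M.src d = M.src d₂).card ≤ 4) : ¬ M.Cross d₁ d₄ := by
  rintro ⟨r, r', h1, h2, h3, h4, h5, h6⟩
  rw [h.src_eq] at h1 h2
  obtain ⟨k1, k2, k3, k4, k5, k6⟩ := h.keys
  have hb := h.btw
  unfold Btw at *
  rcases h.fiber hp h1 with rfl | rfl | rfl | rfl <;>
    rcases h.fiber hp h2 with rfl | rfl | rfl | rfl <;>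
    grind

open Classical in
/-- The number of crossing passages of a list of darts. -/
noncomputable def crossNum (M : RotMap P D) : List D → ℕ
  | a :: b :: l => (if M.Cross a b then 1 else 0) + crossNum M (b :: l)
  | _ => 0

open Classical in
/-- `1` if the passage from the end of the first list to the beginning of the second is crossing. -/
noncomputable def joint (M : RotMap P D) (l₁ l₂ : List D) : ℕ :=
  match l₁.getLast?, l₂.head? with
  | some a, some b => if M.Cross a b then 1 else 0
  | _, _ => 0

end

lemma crossNum_append (l₁ l₂ : List D) :
    M.crossNum (l₁ ++ l₂) = M.crossNum l₁ + M.joint l₁ l₂ + M.crossNum l₂ := by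
  induction l₁ with
  | nil => simp [crossNum, joint]
  | cons a l ih =>
    cases l with
    | nil => cases l₂ <;> simp [crossNum, joint]
    | cons b l =>
      simp only [List.cons_append, crossNum] at ih ⊢
      rw [ih]
      simp only [joint, List.getLast?_cons_cons]
      ring

lemma joint_append_left {l₁ l₂ l₃ : List D} (h : l₂ ≠ []) :
    M.joint (l₁ ++ l₂) l₃ = M.joint l₂ l₃ := by
  simp [joint, List.getLast?_append, List.getLast?_eq_getLast_of_ne_nil h]

lemma joint_nil_left (l : List D) : M.joint [] l = 0 := by simp [joint]

lemma joint_eq_one {l₁ l₂ : List D} {a b : D} (ha : a ∈ l₁.getLast?) (hb : b ∈ l₂.head?)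
    (h : M.Cross a b) : M.joint l₁ l₂ = 1 := by
  rw [Option.mem_def] at ha hb
  simp [joint, ha, hb, h]

lemma joint_eq_zero {l₁ l₂ : List D} {a b : D} (ha : a ∈ l₁.getLast?) (hb : b ∈ l₂.head?)
    (h : ¬ M.Cross a b) : M.joint l₁ l₂ = 0 := by
  rw [Option.mem_def] at ha hb
  simp [joint, ha, hb, h]

lemma crossNum_map_inv_reverse {l : List D}
    (h : l.IsChain fun d d' => M.src (M.inv d) = M.src d') :
    M.crossNum ((l.map M.inv).reverse) = M.crossNum l := by
  induction l with
  | nil => rfl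
  | cons a l ih =>
    cases l with
    | nil => rfl
    | cons b l =>
      rw [List.isChain_cons_cons] at h
      rw [List.map_cons, List.reverse_cons, crossNum_append, ih h.2]
      have hc := cross_inv h.1
      simp only [crossNum, joint]
      simp only [List.map_cons, List.reverse_cons, List.getLast?_append, List.getLast?_singleton,
        Option.some_or, List.head?_cons, add_zero]
      split_ifs <;> first | omega | exact absurd (hc.1 ‹_›) ‹_› | exact absurd (hc.2 ‹_›) ‹_›

end RotMap

namespace RotMap

variable {V P D : Type*} {M : RotMap P D}

/-- The list obtained by traversing a list of darts backwards. -/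
def rev (M : RotMap P D) (l : List D) : List D := (l.map M.inv).reverse

lemma rev_rev (l : List D) : M.rev (M.rev l) = l := by
  have : M.inv ∘ M.inv = id := funext M.inv_inv
  simp [rev, List.map_reverse, this]

lemma rev_append (l₁ l₂ : List D) : M.rev (l₁ ++ l₂) = M.rev l₂ ++ M.rev l₁ := by simp [rev]

lemma rev_ne_nil {l : List D} (h : l ≠ []) : M.rev l ≠ [] := by simpa [rev] using h

lemma mem_head_rev {l : List D} {d : D} : d ∈ (M.rev l).head? ↔ M.inv d ∈ l.getLast? := by
  simp only [rev, List.head?_reverse, List.getLast?_map, Option.mem_def, Option.map_eq_some_iff]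
  constructor
  · rintro ⟨a, h, rfl⟩; rwa [M.inv_inv]
  · exact fun h => ⟨_, h, M.inv_inv d⟩

lemma mem_getLast_rev {l : List D} {d : D} : d ∈ (M.rev l).getLast? ↔ M.inv d ∈ l.head? := by
  simp only [rev, List.getLast?_reverse, List.head?_map, Option.mem_def, Option.map_eq_some_iff]
  constructor
  · rintro ⟨a, h, rfl⟩; rwa [M.inv_inv]
  · exact fun h => ⟨_, h, M.inv_inv d⟩

lemma pair_infix_rev {l : List D} {a b : D} (h : [a, b] <:+: l) :
    [M.inv b, M.inv a] <:+: M.rev l := by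
  obtain ⟨s, t, rfl⟩ := h
  exact ⟨M.rev t, M.rev s, by simp [rev]⟩

/-- The list of darts is a path from `u` to `v`, avoiding the vertices in between. -/
structure IsRoute (M : RotMap P D) (pos : V → P) (u v : V) (l : List D) : Prop where
  head : ∀ d ∈ l.head?, M.src d = pos u
  last : ∀ d ∈ l.getLast?, M.src (M.inv d) = pos v
  ne_nil : l ≠ []
  chain : l.IsChain fun d d' => M.src (M.inv d) = M.src d' ∧ ∀ w, M.src d' ≠ pos w

variable {pos : V → P}

lemma IsRoute.rev {u v : V} {l : List D} (h : M.IsRoute pos u v l) :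
    M.IsRoute pos v u (M.rev l) where
  head d hd := by
    have := h.last _ (mem_head_rev.1 hd)
    rwa [M.inv_inv] at this
  last d hd := h.head _ (mem_getLast_rev.1 hd)
  ne_nil := rev_ne_nil h.ne_nil
  chain := by
    rw [RotMap.rev, List.isChain_reverse, List.isChain_map]
    refine h.chain.imp fun a b hab => ⟨by rw [M.inv_inv, hab.1], by rw [hab.1]; exact hab.2⟩

lemma IsRoute.crossNum_rev {u v : V} {l : List D} (h : M.IsRoute pos u v l) :
    M.crossNum (M.rev l) = M.crossNum l :=
  crossNum_map_inv_reverse (h.chain.imp fun _ _ h => h.1)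

lemma IsRoute.src_eq {u v : V} {l : List D} (h : M.IsRoute pos u v l) {a b : D}
    (hab : [a, b] <:+: l) : M.src (M.inv a) = M.src b :=
  (List.isChain_pair.1 (h.chain.infix hab)).1

lemma IsRoute.src_ne {u v : V} {l : List D} (h : M.IsRoute pos u v l) {a b : D}
    (hab : [a, b] <:+: l) (w : V) : M.src b ≠ pos w :=
  (List.isChain_pair.1 (h.chain.infix hab)).2 w

lemma IsRoute.replace {u v u' v' : V} {A X B C Y Z : List D} (h : M.IsRoute pos u v (A ++ X ++ B))
    (h' : M.IsRoute pos u' v' (C ++ Y ++ Z)) (hX : X ≠ []) (hY : Y ≠ []) (hB : B ≠ [])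
    (hZ : Z ≠ [])
    (hAC : A ≠ [] ∧ C ≠ [] ∨ A = [] ∧ C = [] ∧ u = u')
    (hXY : ∀ x ∈ X.head?, ∀ y ∈ Y.head?, M.src x = M.src y)
    (hBZ : ∀ x ∈ B.head?, ∀ y ∈ Z.head?, M.src x = M.src y) :
    M.IsRoute pos u v (A ++ Y ++ B) := by
  obtain ⟨x, hx⟩ : ∃ x, x ∈ X.head? := by cases X <;> simp_all
  obtain ⟨y, hy⟩ : ∃ x, x ∈ Y.head? := by cases Y <;> simp_all
  obtain ⟨b, hb⟩ : ∃ x, x ∈ B.head? := by cases B <;> simp_all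
  obtain ⟨z, hz⟩ : ∃ x, x ∈ Z.head? := by cases Z <;> simp_all
  have e1 := hXY x hx y hy
  have e2 := hBZ b hb z hz
  have c1 := h.chain
  have c2 := h'.chain
  simp only [List.isChain_append] at c1 c2
  obtain ⟨⟨c3, c4, c5⟩, c6, c7⟩ := c1
  obtain ⟨⟨d3, d4, d5⟩, d6, d7⟩ := c2
  refine ⟨?_, ?_, by simp [hY], ?_⟩
  · have h0 := h.head
    have h0' := h'.head
    rcases hAC with ⟨hA, hC⟩ | ⟨rfl, rfl, rfl⟩
    · intro d hd
      refine h0 d ?_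
      rw [List.append_assoc, List.head?_append_of_ne_nil _ hA] at hd ⊢
      exact hd
    · intro d hd
      refine h0' d ?_
      simp only [List.nil_append] at hd ⊢
      rw [List.head?_append_of_ne_nil _ hY] at hd ⊢
      exact hd
  · intro d hd
    refine h.last d ?_
    rw [List.getLast?_append_of_ne_nil _ hB] at hd ⊢
    exact hd
  · simp only [List.isChain_append]
    refine ⟨⟨c3, d4, fun a ha y' hy' => ?_⟩, c6, fun y' hy' b' hb' => ?_⟩
    · rw [Option.mem_unique hy' hy]
      have := c5 a ha x hx
      rwa [e1] at this
    · rw [Option.mem_unique hb' hb]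
      have := d7 y' (by rwa [List.getLast?_append_of_ne_nil _ hY] at hy' ⊢) z hz
      rwa [← e2] at this

/-- A system of paths of `M` joining the ends of the edges of `G`. -/
structure Routing (M : RotMap P D) (G : SimpleGraph V) (pos : V → P) where
  path : G.Dart → List D
  isRoute : ∀ g, M.IsRoute pos g.fst g.snd (path g)
  path_symm : ∀ g, path g.symm = M.rev (path g)

namespace Routing

variable {G : SimpleGraph V} (R : M.Routing G pos)

open Classical in
/-- Replace the path of a single edge. -/
noncomputable def modify (e : G.Dart) (l : List D) (hl : M.IsRoute pos e.fst e.snd l) :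
    M.Routing G pos where
  path g := if g = e then l else if g = e.symm then M.rev l else R.path g
  isRoute g := by
    split_ifs with h1 h2
    · subst h1; exact hl
    · subst h2; exact hl.rev
    · exact R.isRoute g
  path_symm g := by
    have he : e.symm ≠ e := e.symm_ne
    by_cases h1 : g = e
    · subst h1
      simp [he]
    · by_cases h2 : g = e.symm
      · subst h2
        simp [he, rev_rev]
      · have h3 : g.symm ≠ e := fun h => h2 (by rw [← h, g.symm_symm])
        have h4 : g.symm ≠ e.symm := fun h => h1 (by rw [← g.symm_symm, h, e.symm_symm])
        simp [h1, h2, h3, h4, R.path_symm]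

lemma modify_path_self (e : G.Dart) (l : List D) (hl : M.IsRoute pos e.fst e.snd l) :
    (R.modify e l hl).path e = l := by simp [modify]

lemma modify_path_symm (e : G.Dart) (l : List D) (hl : M.IsRoute pos e.fst e.snd l) :
    (R.modify e l hl).path e.symm = M.rev l := by
  rw [path_symm, modify_path_self]

lemma modify_path_of_ne {e g : G.Dart} {l : List D} {hl : M.IsRoute pos e.fst e.snd l}
    (h1 : g ≠ e) (h2 : g ≠ e.symm) : (R.modify e l hl).path g = R.path g := by
  simp [modify, h1, h2]

lemma sum_modify [Fintype G.Dart] (e : G.Dart) (l : List D) (hl : M.IsRoute pos e.fst e.snd l)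
    (F : List D → ℕ) :
    ∑ g, F ((R.modify e l hl).path g) + (F (R.path e) + F (M.rev (R.path e))) =
      ∑ g, F (R.path g) + (F l + F (M.rev l)) := by
  classical
  have hmem : e.symm ∈ univ.erase e := by simp [e.symm_ne]
  rw [← add_sum_erase _ _ (mem_univ e), ← add_sum_erase _ _ hmem,
    ← add_sum_erase _ (fun g => F (R.path g)) (mem_univ e),
    ← add_sum_erase _ (fun g => F (R.path g)) hmem, modify_path_self, modify_path_symm,
    ← R.path_symm e]
  have : ∑ g ∈ (univ.erase e).erase e.symm, F ((R.modify e l hl).path g) =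
      ∑ g ∈ (univ.erase e).erase e.symm, F (R.path g) := by
    refine sum_congr rfl fun g hg => ?_
    simp only [mem_erase] at hg
    rw [R.modify_path_of_ne hg.2.1 hg.1]
  rw [this]
  ring

open Classical in
/-- Every dart is used exactly once, and every path makes at most two crossings. -/
structure IsGood [Fintype G.Dart] (R : M.Routing G pos) : Prop where
  count_eq : ∀ d, ∑ g, (R.path g).count d = 1
  crossNum_le : ∀ g, M.crossNum (R.path g) ≤ 2

variable [Fintype G.Dart] {R}

lemma exists_swap (hR : R.IsGood) {e f : G.Dart} (hef : e ≠ f) (hef' : e ≠ f.symm)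
    {A X B C Y Z : List D} (he : R.path e = A ++ X ++ B) (hf : R.path f = C ++ Y ++ Z)
    (hX : X ≠ []) (hY : Y ≠ []) (hB : B ≠ []) (hZ : Z ≠ [])
    (hAC : A ≠ [] ∧ C ≠ [] ∨ A = [] ∧ C = [] ∧ e.fst = f.fst)
    (hXY : ∀ x ∈ X.head?, ∀ y ∈ Y.head?, M.src x = M.src y)
    (hBZ : ∀ x ∈ B.head?, ∀ y ∈ Z.head?, M.src x = M.src y)
    (j1 : M.joint A X = M.joint C Y) (j2 : M.joint A Y = 0) (j3 : M.joint C X = 0)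
    (j4 : M.joint X B = 1) (j5 : M.joint Y Z = 1) (j6 : M.joint X Z = 0) (j7 : M.joint Y B = 0) :
    ∃ R' : M.Routing G pos, R'.IsGood ∧
      ∑ g, M.crossNum (R'.path g) < ∑ g, M.crossNum (R.path g) := by
  classical
  have h1 := R.isRoute e
  have h2 := R.isRoute f
  rw [he] at h1
  rw [hf] at h2
  have h3 := h1.replace h2 hX hY hB hZ hAC hXY hBZ
  have h4 := h2.replace h1 hY hX hZ hB (hAC.imp And.symm fun h => ⟨h.2.1, h.1, h.2.2.symm⟩)
    (fun y hy x hx => (hXY x hx y hy).symm) fun y hy x hx => (hBZ x hx y hy).symm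
  let R₁ := R.modify e _ h3
  let R₂ := R₁.modify f _ h4
  have hf1 : R₁.path f = C ++ Y ++ Z := by
    rw [R.modify_path_of_ne hef.symm (fun h => hef' (by rw [h, e.symm_symm])), hf]
  have hsum : ∀ F : List D → ℕ, ∑ g, F (R₂.path g) +
      (F (A ++ X ++ B) + F (M.rev (A ++ X ++ B)) + (F (C ++ Y ++ Z) + F (M.rev (C ++ Y ++ Z)))) =
      ∑ g, F (R.path g) + (F (A ++ Y ++ B) + F (M.rev (A ++ Y ++ B)) +
        (F (C ++ X ++ Z) + F (M.rev (C ++ X ++ Z)))) := fun F => by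
    have s1 := R.sum_modify e _ h3 F
    have s2 := R₁.sum_modify f _ h4 F
    rw [he] at s1
    rw [hf1] at s2
    simp only [R₂, R₁] at *
    omega
  have n1 := crossNum_append (M := M) (A ++ X) B
  have n2 := crossNum_append (M := M) (C ++ Y) Z
  have n3 := crossNum_append (M := M) (A ++ Y) B
  have n4 := crossNum_append (M := M) (C ++ X) Z
  rw [joint_append_left hX, crossNum_append A X] at n1
  rw [joint_append_left hY, crossNum_append C Y] at n2
  rw [joint_append_left hY, crossNum_append A Y] at n3
  rw [joint_append_left hX, crossNum_append C X] at n4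
  have l1 := hR.crossNum_le e
  have l2 := hR.crossNum_le f
  rw [he] at l1
  rw [hf] at l2
  refine ⟨R₂, ⟨fun d => ?_, fun g => ?_⟩, ?_⟩
  · refine Eq.trans ?_ (hR.count_eq d)
    have := hsum fun l => l.count d
    simp only [rev_append, List.count_append] at this
    convert Nat.add_right_cancel (this.trans (by congr 1; ring))
  · by_cases g1 : g = f
    · subst g1
      rw [R₁.modify_path_self]
      omega
    by_cases g2 : g = f.symm
    · subst g2
      rw [R₁.modify_path_symm, h4.crossNum_rev]
      omega
    rw [R₁.modify_path_of_ne g1 g2]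
    by_cases g3 : g = e
    · subst g3
      rw [R.modify_path_self]
      omega
    by_cases g4 : g = e.symm
    · subst g4
      rw [R.modify_path_symm, h3.crossNum_rev]
      omega
    rw [R.modify_path_of_ne g3 g4]
    exact hR.crossNum_le g
  · have := hsum M.crossNum
    rw [h1.crossNum_rev, h2.crossNum_rev, h3.crossNum_rev, h4.crossNum_rev] at this
    omega

end Routing

end RotMap

namespace RotMap

variable {V P D : Type*} {M : RotMap P D} {pos : V → P} {G : SimpleGraph V}

lemma Sep.rev_left {d₁ d₂ d₃ d₄ : D} (h : M.Sep d₁ d₂ d₃ d₄) : M.Sep (M.inv d₂) (M.inv d₁) d₃ d₄ :=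
  h.symm.rev.symm

namespace Routing

variable {R : M.Routing G pos}

lemma mem_path_symm {g : G.Dart} {d : D} (h : d ∈ R.path g) : M.inv d ∈ R.path g.symm := by
  rw [R.path_symm, rev, List.mem_reverse]
  exact List.mem_map_of_mem h

lemma pair_infix_symm {g : G.Dart} {a b : D} (h : [a, b] <:+: R.path g) :
    [M.inv b, M.inv a] <:+: R.path g.symm := by
  rw [R.path_symm]
  exact pair_infix_rev h

variable [Fintype G.Dart]

lemma IsGood.eq_of_mem (hR : R.IsGood) {g h : G.Dart} {d : D} (hg : d ∈ R.path g)
    (hh : d ∈ R.path h) : g = h := by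
  classical
  by_contra hne
  have h1 := (hR.count_eq d).le
  have h2 : ∑ x ∈ {g, h}, (R.path x).count d ≤ ∑ x, (R.path x).count d :=
    sum_le_sum_of_subset (subset_univ _)
  rw [sum_pair hne] at h2
  have h3 := List.count_pos_iff.2 hg
  have h4 := List.count_pos_iff.2 hh
  have h5 : ∑ x, (R.path x).count d ≤ 1 := by convert h1
  omega

lemma IsGood.nodup (hR : R.IsGood) (g : G.Dart) : (R.path g).Nodup := by
  classical
  rw [List.nodup_iff_count_le_one]
  intro d
  have h1 := (hR.count_eq d).le
  have h2 : (R.path g).count d ≤ ∑ x, (R.path x).count d :=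
    single_le_sum (f := fun x => (R.path x).count d) (fun _ _ => Nat.zero_le _) (mem_univ g)
  have h5 : ∑ x, (R.path x).count d ≤ 1 := by convert h1
  omega

lemma mem_left_of_pair {α : Type*} {a b : α} {l : List α} (h : [a, b] <:+: l) : a ∈ l :=
  h.subset (by simp)

lemma mem_right_of_pair {α : Type*} {a b : α} {l : List α} (h : [a, b] <:+: l) : b ∈ l :=
  h.subset (by simp)

lemma eq_of_pair_infix_of_nodup {α : Type*} {a a' b : α} {l : List α} (hl : l.Nodup)
    (h : [a, b] <:+: l) (h' : [a', b] <:+: l) : a = a' := by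
  obtain ⟨s, t, rfl⟩ := h
  rw [List.append_assoc] at h'
  have hn : b ∉ s ∧ b ≠ a ∧ b ∉ t := by
    simp only [List.append_assoc, List.nodup_append, List.cons_append, List.nil_append,
      List.nodup_cons, List.mem_cons] at hl
    refine ⟨fun h => hl.2.2 b h b (by simp) rfl, fun h => hl.2.1.1 (by simp [h]), hl.2.1.2.1⟩
  rcases List.pair_infix_append h' with h | h | ⟨-, h⟩
  · exact (hn.1 (mem_right_of_pair h)).elim
  · rcases List.pair_infix_append h with h | h | ⟨h, h2⟩
    · simp only [List.infix_cons_iff, List.cons_prefix_cons, List.prefix_nil, List.cons_ne_self,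
        List.infix_nil] at h
      rcases h with h | h
      · exact h.1.symm
      · simp at h
    · exact (hn.2.2 (mem_right_of_pair h)).elim
    · simp only [List.getLast?_cons_cons, List.getLast?_singleton, Option.mem_def,
        Option.some.injEq] at h
      exact (hn.2.2 (List.mem_of_mem_head? h2)).elim
  · simp only [List.cons_append, List.head?_cons, Option.mem_def, Option.some.injEq] at h
    exact (hn.2.1 h.symm).elim

lemma IsGood.pair_unique (hR : R.IsGood) {g h : G.Dart} {a a' b : D} (hg : [a, b] <:+: R.path g)
    (hh : [a', b] <:+: R.path h) : g = h ∧ a = a' := by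
  have := hR.eq_of_mem (mem_right_of_pair hg) (mem_right_of_pair hh)
  subst this
  exact ⟨rfl, eq_of_pair_infix_of_nodup (hR.nodup g) hg hh⟩

lemma IsGood.pair_unique' (hR : R.IsGood) {g h : G.Dart} {a b b' : D} (hg : [a, b] <:+: R.path g)
    (hh : [a, b'] <:+: R.path h) : g = h ∧ b = b' := by
  obtain ⟨h1, h2⟩ := hR.pair_unique (pair_infix_symm hg) (pair_infix_symm hh)
  exact ⟨by rw [← g.symm_symm, h1, h.symm_symm], M.inv_injective h2⟩

variable [Fintype D]

open Classical in
/-- A good routing with as few crossings as possible. -/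
structure IsReduced (R : M.Routing G pos) : Prop extends R.IsGood where
  le : ∀ R' : M.Routing G pos, R'.IsGood →
    ∑ g, M.crossNum (R.path g) ≤ ∑ g, M.crossNum (R'.path g)
  fiber : ∀ p, (∀ w, p ≠ pos w) → (univ.filter fun d => M.src d = p).card ≤ 4

lemma IsReduced.not_cross (hR : R.IsReduced) {g : G.Dart} {d₁ d₂ d₃ d₄ : D}
    (h : [d₁, d₂] <:+: R.path g) (hs : M.Sep d₁ d₂ d₃ d₄) : ¬ M.Cross d₁ d₄ :=
  hs.not_cross (hR.fiber _ ((R.isRoute g).src_ne h))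

lemma IsReduced.false_of_self (hR : R.IsReduced) {g : G.Dart} {A X B : List D} {d₁ d₂ d₃ d₄ : D}
    (hg : R.path g = A ++ X ++ B) (h1 : d₁ ∈ A.getLast?) (h2 : d₂ ∈ X.head?) (h3 : d₃ ∈ X.getLast?)
    (h4 : d₄ ∈ B.head?) (hs : M.Sep d₁ d₂ d₃ d₄) : False := by
  classical
  have hX : X ≠ [] := fun h => by simp [h] at h2
  have hB : B ≠ [] := fun h => by simp [h] at h4
  have hA : A ≠ [] := fun h => by simp [h] at h1
  have i1 : [d₁, d₂] <:+: R.path g := by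
    rw [hg, List.append_assoc]
    refine List.pair_infix_of_append h1 ?_
    rwa [List.head?_append_of_ne_nil _ hX]
  have i2 : [d₃, d₄] <:+: R.path g := by
    rw [hg]
    refine List.pair_infix_of_append ?_ h4
    rwa [List.getLast?_append_of_ne_nil _ hX]
  have r := R.isRoute g
  have hl : M.IsRoute pos g.fst g.snd (A ++ M.rev X ++ B) := by
    have rc := r.chain
    have hh := r.head
    have hl := r.last
    rw [hg] at rc hh hl
    simp only [List.isChain_append] at rc
    obtain ⟨⟨c1, c2, c3⟩, c4, c5⟩ := rc
    refine ⟨fun d hd => hh d ?_, fun d hd => hl d ?_, by simp [hA], ?_⟩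
    · rw [List.append_assoc, List.head?_append_of_ne_nil _ hA] at hd ⊢
      exact hd
    · rw [List.getLast?_append_of_ne_nil _ hB] at hd ⊢
      exact hd
    · simp only [List.isChain_append]
      refine ⟨⟨c1, ?_, fun a ha b hb => ?_⟩, c4, fun a ha b hb => ?_⟩
      · rw [rev, List.isChain_reverse, List.isChain_map]
        exact c2.imp fun a b hab => ⟨by rw [M.inv_inv, hab.1], by rw [hab.1]; exact hab.2⟩
      · rw [Option.mem_unique ha h1]
        have := Option.mem_unique (mem_head_rev.1 hb) h3
        have hb' : b = M.inv d₃ := by rw [← this, M.inv_inv]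
        rw [hb']
        rw [hs.src₁, hs.src₃, hs.src_eq]
        exact ⟨rfl, r.src_ne i1⟩
      · rw [List.getLast?_append_of_ne_nil _ (rev_ne_nil hX)] at ha
        have := Option.mem_unique (mem_getLast_rev.1 ha) h2
        rw [this, Option.mem_unique hb h4, hs.src_eq]
        exact ⟨rfl, r.src_ne i1⟩
  have n1 := crossNum_append (M := M) (A ++ X) B
  have n2 := crossNum_append (M := M) (A ++ M.rev X) B
  rw [joint_append_left hX, crossNum_append A X] at n1
  rw [joint_append_left (rev_ne_nil hX), crossNum_append A (M.rev X)] at n2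
  have n3 : M.crossNum (M.rev X) = M.crossNum X := by
    refine crossNum_map_inv_reverse ?_
    have rc := r.chain
    rw [hg] at rc
    simp only [List.isChain_append] at rc
    exact rc.1.2.1.imp fun _ _ h => h.1
  have j1 := joint_eq_one h1 h2 hs.cross
  have j2 := joint_eq_one h3 h4 hs.symm.cross
  have j3 : M.joint A (M.rev X) = 0 := by
    refine joint_eq_zero h1 (mem_head_rev.2 ?_) (hR.not_cross i1 hs.rev)
    rwa [M.inv_inv]
  have j4 : M.joint (M.rev X) B = 0 := by
    refine joint_eq_zero (a := M.inv d₂) (mem_getLast_rev.2 ?_) h4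
      (hs.rev_left.not_cross (hR.fiber _ ?_))
    · rwa [M.inv_inv]
    · rw [hs.src₁]
      exact r.src_ne i1
  have l1 := hR.crossNum_le g
  have hsum := R.sum_modify g _ hl
  have hgood : (R.modify g _ hl).IsGood := by
    refine ⟨fun d => ?_, fun h => ?_⟩
    · refine Eq.trans ?_ (hR.count_eq d)
      have := hsum fun l => l.count d
      simp only [hg, rev_append, rev_rev, List.count_append] at this
      convert Nat.add_right_cancel (this.trans (by congr 1; ring))
    · by_cases e1 : h = g
      · rw [e1, R.modify_path_self]
        rw [hg] at l1
        omega
      by_cases e2 : h = g.symm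
      · rw [e2, R.modify_path_symm, hl.crossNum_rev]
        rw [hg] at l1
        omega
      rw [R.modify_path_of_ne e1 e2]
      exact hR.crossNum_le h
  have h5 := hR.le _ hgood
  have h6 := hsum M.crossNum
  rw [hl.crossNum_rev, r.crossNum_rev, hg] at h6
  omega

lemma IsReduced.not_sep_self (hR : R.IsReduced) {g : G.Dart} {d₁ d₂ d₃ d₄ : D}
    (h1 : [d₁, d₂] <:+: R.path g) (h2 : [d₃, d₄] <:+: R.path g) : ¬ M.Sep d₁ d₂ d₃ d₄ := by
  intro hs
  obtain ⟨A, T, hg, a1, a2⟩ := List.exists_append_of_pair_infix h1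
  rw [hg] at h2
  rcases List.pair_infix_append h2 with h | h | ⟨h, h'⟩
  · obtain ⟨A', X, rfl, b1, b2⟩ := List.exists_append_of_pair_infix h
    rw [List.getLast?_append_of_ne_nil _ (fun h => by simp [h] at b2)] at a1
    exact hR.false_of_self hg b1 b2 a1 a2 hs.symm
  · obtain ⟨X, B, rfl, b1, b2⟩ := List.exists_append_of_pair_infix h
    rw [List.head?_append_of_ne_nil _ (fun h => by simp [h] at b1)] at a2
    rw [← List.append_assoc] at hg
    exact hR.false_of_self hg a1 a2 b1 b2 hs
  · exact hs.ne₅ (Option.mem_unique a2 h')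

lemma IsReduced.fst_ne_fst (hR : R.IsReduced) {g h : G.Dart} {d₁ d₂ d₃ d₄ : D}
    (h1 : [d₁, d₂] <:+: R.path g) (h2 : [d₃, d₄] <:+: R.path h) (hs : M.Sep d₁ d₂ d₃ d₄) :
    g.fst ≠ h.fst := by
  intro heq
  by_cases hgh : g = h
  · subst hgh
    exact hR.not_sep_self h1 h2 hs
  obtain ⟨X, B, hg, a1, a2⟩ := List.exists_append_of_pair_infix h1
  obtain ⟨Y, Z, hh, b1, b2⟩ := List.exists_append_of_pair_infix h2
  have hX : X ≠ [] := fun h => by simp [h] at a1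
  have hB : B ≠ [] := fun h => by simp [h] at a2
  have hY : Y ≠ [] := fun h => by simp [h] at b1
  have hZ : Z ≠ [] := fun h => by simp [h] at b2
  have e1 : g ≠ h.symm := by
    rintro rfl
    exact h.fst_ne_snd heq.symm
  have e2 : ∀ x ∈ X.head?, ∀ y ∈ Y.head?, M.src x = M.src y := fun x hx y hy => by
    have i1 := (R.isRoute g).head x (by rwa [hg, List.head?_append_of_ne_nil _ hX])
    have i2 := (R.isRoute h).head y (by rwa [hh, List.head?_append_of_ne_nil _ hY])
    rw [i1, i2, heq]
  have e3 : ∀ x ∈ B.head?, ∀ y ∈ Z.head?, M.src x = M.src y := fun x hx y hy => by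
    rw [Option.mem_unique hx a2, Option.mem_unique hy b2, hs.src_eq]
  obtain ⟨R', hR', hlt⟩ := exists_swap (R := R) (A := []) (C := []) (X := X) (Y := Y) (B := B)
    (Z := Z) hR.toIsGood hgh e1 (by simpa using hg) (by simpa using hh) hX hY hB hZ
    (.inr ⟨rfl, rfl, heq⟩) e2 e3 (by simp [joint_nil_left])
    (joint_nil_left _) (joint_nil_left _) (joint_eq_one a1 a2 hs.cross)
    (joint_eq_one b1 b2 hs.symm.cross) (joint_eq_zero a1 b2 (hR.not_cross h1 hs))
    (joint_eq_zero b1 a2 (hR.not_cross h2 hs.symm))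
  · exact absurd (hR.le R' hR') hlt.not_ge

/-- In a reduced routing, crossing edges have no common end. -/
lemma IsReduced.ends_ne (hR : R.IsReduced) {g h : G.Dart} {d₁ d₂ d₃ d₄ : D}
    (h1 : [d₁, d₂] <:+: R.path g) (h2 : [d₃, d₄] <:+: R.path h) (hs : M.Sep d₁ d₂ d₃ d₄) :
    g.fst ≠ h.fst ∧ g.fst ≠ h.snd ∧ g.snd ≠ h.fst ∧ g.snd ≠ h.snd :=
  ⟨hR.fst_ne_fst h1 h2 hs, hR.fst_ne_fst h1 (pair_infix_symm h2) hs.rev,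
    hR.fst_ne_fst (pair_infix_symm h1) h2 hs.rev_left,
    hR.fst_ne_fst (pair_infix_symm h1) (pair_infix_symm h2) hs.rev_left.rev⟩

lemma IsReduced.false_of_double (hR : R.IsReduced) {g h : G.Dart} {A X B C Y Z : List D}
    {d₁ d₂ d₃ d₄ e₁ e₂ e₃ e₄ : D}
    (hg : R.path g = A ++ X ++ B) (h1 : d₁ ∈ A.getLast?) (h2 : d₂ ∈ X.head?) (h3 : e₁ ∈ X.getLast?)
    (h4 : e₂ ∈ B.head?) (hh : R.path h = C ++ Y ++ Z) (i1 : d₃ ∈ C.getLast?) (i2 : d₄ ∈ Y.head?)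
    (i3 : e₃ ∈ Y.getLast?) (i4 : e₄ ∈ Z.head?) (hs : M.Sep d₁ d₂ d₃ d₄) (he : M.Sep e₁ e₂ e₃ e₄) :
    False := by
  have hA : A ≠ [] := fun h => by simp [h] at h1
  have hX : X ≠ [] := fun h => by simp [h] at h2
  have hB : B ≠ [] := fun h => by simp [h] at h4
  have hC : C ≠ [] := fun h => by simp [h] at i1
  have hY : Y ≠ [] := fun h => by simp [h] at i2
  have hZ : Z ≠ [] := fun h => by simp [h] at i4
  have p1 : [d₁, d₂] <:+: R.path g := by
    rw [hg, List.append_assoc]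
    exact List.pair_infix_of_append h1 (by rwa [List.head?_append_of_ne_nil _ hX])
  have p2 : [e₁, e₂] <:+: R.path g := by
    rw [hg]
    exact List.pair_infix_of_append (by rwa [List.getLast?_append_of_ne_nil _ hX]) h4
  have p3 : [d₃, d₄] <:+: R.path h := by
    rw [hh, List.append_assoc]
    exact List.pair_infix_of_append i1 (by rwa [List.head?_append_of_ne_nil _ hY])
  have p4 : [e₃, e₄] <:+: R.path h := by
    rw [hh]
    exact List.pair_infix_of_append (by rwa [List.getLast?_append_of_ne_nil _ hY]) i4
  have hends := hR.ends_ne p1 p3 hs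
  obtain ⟨R', hR', hlt⟩ := exists_swap hR.toIsGood (fun h' => hends.1 (by rw [h']))
    (fun h' => hends.2.1 (by rw [h']; rfl)) hg hh hX hY hB hZ (.inl ⟨hA, hC⟩)
    (fun x hx y hy => by rw [Option.mem_unique hx h2, Option.mem_unique hy i2, hs.src_eq])
    (fun x hx y hy => by rw [Option.mem_unique hx h4, Option.mem_unique hy i4, he.src_eq])
    (by rw [joint_eq_one h1 h2 hs.cross, joint_eq_one i1 i2 hs.symm.cross])
    (joint_eq_zero h1 i2 (hR.not_cross p1 hs)) (joint_eq_zero i1 h2 (hR.not_cross p3 hs.symm))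
    (joint_eq_one h3 h4 he.cross) (joint_eq_one i3 i4 he.symm.cross)
    (joint_eq_zero h3 i4 (hR.not_cross p2 he)) (joint_eq_zero i3 h4 (hR.not_cross p4 he.symm))
  exact absurd (hR.le R' hR') hlt.not_ge

lemma IsReduced.false_of_double_left (hR : R.IsReduced) {g h : G.Dart} {A X B : List D}
    {d₁ d₂ d₃ d₄ e₁ e₂ e₃ e₄ : D}
    (hg : R.path g = A ++ X ++ B) (h1 : d₁ ∈ A.getLast?) (h2 : d₂ ∈ X.head?) (h3 : e₁ ∈ X.getLast?)
    (h4 : e₂ ∈ B.head?) (i1 : [d₃, d₄] <:+: R.path h) (i2 : [e₃, e₄] <:+: R.path h)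
    (hne : d₄ ≠ e₄) (hs : M.Sep d₁ d₂ d₃ d₄) (he : M.Sep e₁ e₂ e₃ e₄) : False := by
  obtain ⟨C, T, hh, a1, a2⟩ := List.exists_append_of_pair_infix i1
  rw [hh] at i2
  rcases List.pair_infix_append i2 with h' | h' | ⟨-, h'⟩
  · obtain ⟨C', Y, rfl, b1, b2⟩ := List.exists_append_of_pair_infix h'
    rw [List.getLast?_append_of_ne_nil _ (fun h => by simp [h] at b2)] at a1
    have hh' : R.path h.symm = M.rev T ++ M.rev Y ++ M.rev C' := by
      rw [R.path_symm, hh, rev_append, rev_append, List.append_assoc]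
    refine hR.false_of_double hg h1 h2 h3 h4 hh' (mem_getLast_rev.2 ?_) (mem_head_rev.2 ?_)
      (mem_getLast_rev.2 ?_) (mem_head_rev.2 ?_) hs.rev he.rev <;> rwa [M.inv_inv]
  · obtain ⟨Y, Z, rfl, b1, b2⟩ := List.exists_append_of_pair_infix h'
    rw [List.head?_append_of_ne_nil _ (fun h => by simp [h] at b1)] at a2
    rw [← List.append_assoc] at hh
    exact hR.false_of_double hg h1 h2 h3 h4 hh a1 a2 b1 b2 hs he
  · exact hne (Option.mem_unique a2 h')

/-- In a reduced routing, two edges cross at most once. -/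
lemma IsReduced.eq_of_sep (hR : R.IsReduced) {g h : G.Dart} {d₁ d₂ d₃ d₄ e₁ e₂ e₃ e₄ : D}
    (h1 : [d₁, d₂] <:+: R.path g) (h2 : [e₁, e₂] <:+: R.path g) (i1 : [d₃, d₄] <:+: R.path h)
    (i2 : [e₃, e₄] <:+: R.path h) (hs : M.Sep d₁ d₂ d₃ d₄) (he : M.Sep e₁ e₂ e₃ e₄) : d₂ = e₂ := by
  by_contra hne
  have hne' : d₄ ≠ e₄ := by
    rintro rfl
    obtain ⟨-, rfl⟩ := hR.pair_unique i1 i2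
    have hsrc : M.src e₂ = M.src d₂ := by rw [← he.src_eq, hs.src_eq]
    rcases hs.fiber (hR.fiber _ ((R.isRoute g).src_ne h1)) hsrc with h | h | h | h
    · rw [h] at h2
      exact g.symm_ne (hR.pair_unique (pair_infix_symm h1) h2).1
    · exact hne h.symm
    · exact he.ne₄ h
    · exact he.ne₅ h
  obtain ⟨A, T, hg, a1, a2⟩ := List.exists_append_of_pair_infix h1
  rw [hg] at h2
  rcases List.pair_infix_append h2 with h | h | ⟨h, h'⟩
  · obtain ⟨A', X, rfl, b1, b2⟩ := List.exists_append_of_pair_infix h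
    rw [List.getLast?_append_of_ne_nil _ (fun h => by simp [h] at b2)] at a1
    exact hR.false_of_double_left hg b1 b2 a1 a2 i2 i1 hne'.symm he hs
  · obtain ⟨X, B, rfl, b1, b2⟩ := List.exists_append_of_pair_infix h
    rw [List.head?_append_of_ne_nil _ (fun h => by simp [h] at b1)] at a2
    rw [← List.append_assoc] at hg
    exact hR.false_of_double_left hg a1 a2 b1 b2 i1 i2 hne' hs he
  · exact hne (Option.mem_unique a2 h')

open Classical in
lemma exists_isReduced (hR : R.IsGood)
    (hfib : ∀ p, (∀ w, p ≠ pos w) → (univ.filter fun d => M.src d = p).card ≤ 4) :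
    ∃ R : M.Routing G pos, R.IsReduced := by
  have hex : ∃ n, ∃ R : M.Routing G pos, R.IsGood ∧ ∑ g, M.crossNum (R.path g) = n :=
    ⟨_, R, hR, rfl⟩
  obtain ⟨R', hR', h⟩ := Nat.find_spec hex
  exact ⟨R', ⟨hR', fun R'' hR'' => by rw [h]; exact Nat.find_min' hex ⟨R'', hR'', rfl⟩, hfib⟩⟩

end Routing

end RotMap

namespace List

variable {α : Type*}

lemma pair_infix_flatten {L : List (List α)} (hL : [] ∉ L) {a b : α} (h : [a, b] <:+: L.flatten) :
    (∃ m ∈ L, [a, b] <:+: m) ∨ ∃ m m', [m, m'] <:+: L ∧ a ∈ m.getLast? ∧ b ∈ m'.head? := by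
  induction L with
  | nil => simp at h
  | cons l L ih =>
    rw [flatten_cons] at h
    rcases pair_infix_append h with h | h | ⟨h₁, h'⟩
    · exact .inl ⟨l, mem_cons_self, h⟩
    · rcases ih (fun h => hL (mem_cons_of_mem _ h)) h with ⟨m, h1, h2⟩ | ⟨m, m', h1, h2⟩
      · exact .inl ⟨m, mem_cons_of_mem _ h1, h2⟩
      · exact .inr ⟨m, m', h1.trans (suffix_cons l L).isInfix, h2⟩
    · cases L with
      | nil => simp at h'
      | cons l' L =>
        refine .inr ⟨l, l', ⟨[], L, by simp⟩, h₁, ?_⟩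
        rwa [flatten_cons, head?_append_of_ne_nil _ (by rintro rfl; simp at hL)] at h'

lemma flatten_infix {L L' : List (List α)} (h : L <:+: L') : L.flatten <:+: L'.flatten := by
  obtain ⟨s, t, rfl⟩ := h
  exact ⟨s.flatten, t.flatten, by simp⟩

lemma infix_flatten_of_mem {L : List (List α)} {l : List α} (h : l ∈ L) : l <:+: L.flatten := by
  obtain ⟨s, t, rfl⟩ := append_of_mem h
  exact ⟨s.flatten, t.flatten, by simp⟩

lemma exists_getElem_of_pair_infix {l : List α} {a b : α} (h : [a, b] <:+: l) :
    ∃ i, l[i]? = some a ∧ l[i + 1]? = some b := by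
  obtain ⟨s, t, rfl⟩ := h
  exact ⟨s.length, by simp, by simp⟩

lemma pair_infix_of_getElem {l : List α} {a b : α} {i : ℕ} (ha : l[i]? = some a)
    (hb : l[i + 1]? = some b) : [a, b] <:+: l := by
  obtain ⟨h1, rfl⟩ := List.getElem?_eq_some_iff.1 ha
  obtain ⟨h2, rfl⟩ := List.getElem?_eq_some_iff.1 hb
  refine ⟨l.take i, l.drop (i + 2), ?_⟩
  conv_rhs => rw [← take_append_drop i l, drop_eq_getElem_cons h1, drop_eq_getElem_cons h2]
  simp

lemma isChain_of_pair_infix {R : α → α → Prop} {l : List α}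
    (h : ∀ a b, [a, b] <:+: l → R a b) : l.IsChain R := by
  rw [isChain_iff_forall_rel_of_append_cons_cons]
  rintro a b s t rfl
  exact h a b ⟨s, t, by simp⟩

end List

namespace RotMap

variable {V P D : Type*} {M : RotMap P D}

open Classical in
/-- The maximal pieces of a list of darts without crossing passages. -/
noncomputable def pieces (M : RotMap P D) (l : List D) : List (List D) :=
  l.splitBy fun a b => !decide (M.Cross a b)

lemma flatten_pieces (l : List D) : (M.pieces l).flatten = l := List.flatten_splitBy _ _

lemma nil_notMem_pieces (l : List D) : [] ∉ M.pieces l := List.nil_notMem_splitBy _ _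

lemma not_cross_of_pieces {l m : List D} {a b : D} (hm : m ∈ M.pieces l) (h : [a, b] <:+: m) :
    ¬ M.Cross a b := by
  have := (List.isChain_of_mem_splitBy hm).infix h
  simpa using this

lemma cross_of_pieces {l m m' : List D} {a b : D} (hm : [m, m'] <:+: M.pieces l)
    (ha : a ∈ m.getLast?) (hb : b ∈ m'.head?) : M.Cross a b := by
  have := (List.isChain_getLast_head_splitBy _ l).infix hm
  rw [List.isChain_pair] at this
  obtain ⟨h1, h2, h3⟩ := this
  rw [List.getLast?_eq_getLast_of_ne_nil h1, Option.mem_some] at ha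
  rw [List.head?_eq_some_head h2, Option.mem_some] at hb
  rw [ha, hb] at h3
  simpa using h3

lemma pair_infix_of_pieces {l m m' : List D} {a b : D} (hm : [m, m'] <:+: M.pieces l)
    (ha : a ∈ m.getLast?) (hb : b ∈ m'.head?) : [a, b] <:+: l := by
  have := List.flatten_infix hm
  rw [flatten_pieces] at this
  refine List.IsInfix.trans ?_ this
  simpa using List.pair_infix_of_append ha hb

lemma pieces_of_cross {l : List D} {a b : D} (h : [a, b] <:+: l) (hc : M.Cross a b) :
    ∃ m m', [m, m'] <:+: M.pieces l ∧ a ∈ m.getLast? ∧ b ∈ m'.head? := by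
  rw [← flatten_pieces (M := M) l] at h
  rcases List.pair_infix_flatten (nil_notMem_pieces l) h with ⟨m, h1, h2⟩ | h
  · exact (not_cross_of_pieces h1 h2 hc).elim
  · exact h

lemma crossNum_eq_zero {l : List D} (h : ∀ a b, [a, b] <:+: l → ¬ M.Cross a b) :
    M.crossNum l = 0 := by
  induction l with
  | nil => rfl
  | cons a l ih =>
    cases l with
    | nil => rfl
    | cons b l =>
      rw [crossNum, ih fun a' b' h' => h a' b' (h'.trans (List.suffix_cons _ _).isInfix),
        if_neg (h a b ⟨[], l, by simp⟩)]

lemma crossNum_flatten {L : List (List D)} (hn : [] ∉ L) (h1 : ∀ m ∈ L, M.crossNum m = 0)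
    (h2 : L.IsChain fun m m' => M.joint m m' = 1) (hL : L ≠ []) :
    M.crossNum L.flatten + 1 = L.length := by
  induction L with
  | nil => exact (hL rfl).elim
  | cons m L ih =>
    cases L with
    | nil => simp [h1 m (by simp)]
    | cons m' L =>
      have hm' : m' ≠ [] := by rintro rfl; simp at hn
      have := ih (fun h => hn (List.mem_cons_of_mem _ h))
        (fun x hx => h1 x (List.mem_cons_of_mem _ hx)) h2.tail (by simp)
      have hj : M.joint m (m' :: L).flatten = M.joint m m' := by
        rw [List.flatten_cons, joint, List.head?_append_of_ne_nil _ hm', joint]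
      rw [List.isChain_cons_cons] at h2
      rw [List.flatten_cons, crossNum_append, hj, h1 m (by simp), h2.1, List.length_cons, ← this]
      ring

lemma length_pieces {l : List D} (hl : l ≠ []) : (M.pieces l).length = M.crossNum l + 1 := by
  conv_rhs => rw [← flatten_pieces (M := M) l]
  refine (crossNum_flatten (nil_notMem_pieces l)
    (fun m hm => crossNum_eq_zero fun a b => not_cross_of_pieces hm) ?_
    (List.splitBy_ne_nil.2 hl)).symm
  refine List.isChain_of_pair_infix fun m m' h => ?_
  have hm : m ≠ [] := fun h' => nil_notMem_pieces (M := M) l (h' ▸ h.subset (by simp))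
  have hm' : m' ≠ [] := fun h' => nil_notMem_pieces (M := M) l (h' ▸ h.subset (by simp))
  have ha := List.getLast?_eq_getLast_of_ne_nil hm
  have hb := List.head?_eq_some_head hm'
  exact joint_eq_one ha hb (cross_of_pieces h ha hb)

lemma pieces_rev {l : List D} (hl : ∀ a b, [a, b] <:+: l → M.src (M.inv a) = M.src b) :
    M.pieces (M.rev l) = ((M.pieces l).map M.rev).reverse := by
  classical
  rw [pieces, List.splitBy_eq_iff]
  refine ⟨?_, ?_, ?_, ?_⟩
  · conv_lhs => rw [← flatten_pieces (M := M) l]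
    rw [rev, List.map_flatten, List.reverse_flatten, List.map_map]
    rfl
  · simp only [List.mem_reverse, List.mem_map, not_exists, not_and]
    intro m hm h
    exact rev_ne_nil (fun h => nil_notMem_pieces l (h ▸ hm)) h
  · intro m' hm'
    simp only [List.mem_reverse, List.mem_map] at hm'
    obtain ⟨m, hm, rfl⟩ := hm'
    refine List.isChain_of_pair_infix fun a b hab => ?_
    have h1 := List.infix_reverse_map M.inv_inv hab
    have h2 := List.infix_flatten_of_mem hm
    rw [flatten_pieces] at h2
    have h3 := not_cross_of_pieces hm h1
    rw [← cross_inv (hl _ _ (h1.trans h2)), M.inv_inv, M.inv_inv] at h3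
    simpa using h3
  · refine List.isChain_of_pair_infix fun m m' hm => ?_
    have h1 := List.infix_reverse_map rev_rev hm
    have hne : m' ≠ [] ∧ m ≠ [] := by
      constructor <;> rintro rfl <;> exact nil_notMem_pieces (M := M) l (h1.subset (by simp [rev]))
    refine ⟨hne.2, hne.1, ?_⟩
    have ha := (mem_head_rev (l := m) (d := M.inv (m.getLast hne.2))).2
      (by rw [M.inv_inv]; exact List.getLast?_eq_getLast_of_ne_nil hne.2)
    have hb := (mem_getLast_rev (l := m') (d := M.inv (m'.head hne.1))).2
      (by rw [M.inv_inv]; exact List.head?_eq_some_head hne.1)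
    have h3 := cross_of_pieces h1 hb ha
    rw [← cross_inv (hl _ _ (pair_infix_of_pieces h1 hb ha)), M.inv_inv, M.inv_inv] at h3
    simpa using h3

end RotMap

namespace RotMap

variable {V P D : Type*} {M : RotMap P D} {pos : V → P} {G : SimpleGraph V}

lemma IsRotation.apply_apply_of_btw {ρ : Equiv.Perm D} (hρ : M.IsRotation ρ) {a b c e : D}
    (hab : M.src a = M.src b) (hcb : M.src c = M.src b) (heb : M.src e = M.src b) (n1 : a ≠ b)
    (n2 : a ≠ c) (n3 : a ≠ e) (n4 : b ≠ c) (n5 : b ≠ e) (n6 : c ≠ e)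
    (hfib : ∀ d, M.src d = M.src b → d = a ∨ d = b ∨ d = c ∨ d = e)
    (h : M.Btw a b e ↔ ¬ M.Btw a b c) : ρ (ρ b) = a ∧ (ρ b = c ∨ ρ b = e) := by
  have k1 := key_ne_of_ne hab n1
  have k2 := key_ne_of_ne (hab.trans hcb.symm) n2
  have k3 := key_ne_of_ne (hab.trans heb.symm) n3
  have k4 := key_ne_of_ne hcb.symm n4
  have k5 := key_ne_of_ne heb.symm n5
  have k6 := key_ne_of_ne (hcb.trans heb.symm) n6
  have s1 := hρ.1 b
  have s2 := (hρ.1 (ρ b)).trans s1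
  have hs : ∀ d, M.src d = M.src b →
      (M.key d < M.key (ρ d) ∧ ¬ (M.key d < M.key a ∧ M.key a < M.key (ρ d)) ∧
        ¬ (M.key d < M.key b ∧ M.key b < M.key (ρ d)) ∧
        ¬ (M.key d < M.key c ∧ M.key c < M.key (ρ d)) ∧
        ¬ (M.key d < M.key e ∧ M.key e < M.key (ρ d))) ∨
      ((M.key (ρ d) ≤ M.key a ∧ M.key a ≤ M.key d) ∧ (M.key (ρ d) ≤ M.key b ∧ M.key b ≤ M.key d) ∧
        (M.key (ρ d) ≤ M.key c ∧ M.key c ≤ M.key d) ∧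
        (M.key (ρ d) ≤ M.key e ∧ M.key e ≤ M.key d)) := fun d hd =>
    (hρ.2 d).imp (fun h => ⟨h.1, h.2 a (hab.trans hd.symm), h.2 b hd.symm,
      h.2 c (hcb.trans hd.symm), h.2 e (heb.trans hd.symm)⟩) fun h => ⟨h a (hab.trans hd.symm),
        h b hd.symm, h c (hcb.trans hd.symm), h e (heb.trans hd.symm)⟩
  have r1 := hs b rfl
  have r2 := hs (ρ b) s1
  unfold Btw at h
  clear hs hρ
  rcases hfib _ s1 with h1 | h1 | h1 | h1 <;> rcases hfib _ s2 with h2 | h2 | h2 | h2 <;>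
    rw [h1] at h2 r1 r2 <;> rw [h2] at r2 <;> rw [h1, h2] <;> clear hfib s1 s2 hab hcb heb h1 h2 <;>
    grind

namespace Routing

variable {R : M.Routing G pos}

lemma exists_pair_infix {g : G.Dart} {d : D} (hd : d ∈ R.path g) (hp : ∀ w, M.src d ≠ pos w) :
    ∃ a, [a, d] <:+: R.path g := by
  obtain ⟨s, t, hst⟩ := List.append_of_mem hd
  rcases List.eq_nil_or_concat s with rfl | ⟨s, a, rfl⟩
  · exact (hp _ ((R.isRoute g).head d (by simp [hst]))).elim
  · exact ⟨a, s, t, by simp [hst]⟩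

variable (R) in
/-- The pieces into which the edges are cut by the crossings. -/
abbrev Piece := Σ g : G.Dart, Fin (M.crossNum (R.path g) + 1)

variable [Fintype G.Dart]

lemma IsGood.inv_ne (hR : R.IsGood) {g : G.Dart} {a b : D} (h : [a, b] <:+: R.path g) :
    M.inv a ≠ b := fun h' =>
  g.symm_ne (hR.eq_of_mem (mem_path_symm (mem_left_of_pair h)) (h' ▸ mem_right_of_pair h))

/-- Two passages through the same point are parallel or cross each other. -/
lemma IsGood.parallel_or_sep (hR : R.IsGood) {g h : G.Dart} {d₁ d₂ d₃ d₄ : D}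
    (h1 : [d₁, d₂] <:+: R.path g) (h2 : [d₃, d₄] <:+: R.path h) (hs : M.src d₄ = M.src d₂) :
    M.Parallel d₁ d₂ d₃ d₄ ∨ M.Sep d₁ d₂ d₃ d₄ := by
  by_cases e1 : d₄ = d₂
  · subst e1
    exact .inl (.inl ⟨(hR.pair_unique h2 h1).2, rfl⟩)
  by_cases e2 : M.inv d₃ = d₂
  · subst e2
    have := (hR.pair_unique h1 (pair_infix_symm h2)).2
    exact .inl (.inr (.inl ⟨(M.inv_inv _).symm, by rw [this, M.inv_inv]⟩))
  by_cases e3 : d₄ = M.inv d₁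
  · subst e3
    exact .inl (.inr (.inl ⟨(hR.pair_unique h2 (pair_infix_symm h1)).2, rfl⟩))
  by_cases e4 : M.inv d₃ = M.inv d₁
  · have := M.inv_injective e4
    subst this
    exact (e1 (hR.pair_unique' h2 h1).2).elim
  by_cases hb : M.Btw (M.inv d₁) d₂ d₄ ↔ M.Btw (M.inv d₁) d₂ (M.inv d₃)
  · exact .inl (.inr (.inr ⟨e1, e3, e2, e4, hb⟩))
  · exact .inr ⟨(R.isRoute g).src_eq h1, (R.isRoute h).src_eq h2, hs, by grind, hR.inv_ne h1,
      Ne.symm e4, Ne.symm e3, Ne.symm e2, Ne.symm e1, hR.inv_ne h2⟩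

lemma IsGood.exists_mem (hR : R.IsGood) (d : D) : ∃ g, d ∈ R.path g := by
  classical
  by_contra! h
  have := hR.count_eq d
  rw [sum_eq_zero fun g _ => List.count_eq_zero.2 (h g)] at this
  omega

variable [Fintype D]

/-- A crossing passage crosses some passage of another path. -/
lemma IsReduced.exists_sep (hR : R.IsReduced) {g : G.Dart} {a b : D} (h : [a, b] <:+: R.path g)
    (hc : M.Cross a b) : ∃ k a' b', [a', b'] <:+: R.path k ∧ M.Sep a b a' b' := by
  obtain ⟨r, r', h1, h2, h3, h4, h5, h6⟩ := hc
  have hsrc := (R.isRoute g).src_ne h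
  obtain ⟨k, hk⟩ := hR.exists_mem r
  obtain ⟨s, hs⟩ := exists_pair_infix hk fun w => by rw [h1]; exact hsrc w
  refine ⟨k, s, r, hs, ?_⟩
  rcases hR.parallel_or_sep h hs h1 with (⟨-, rfl⟩ | ⟨-, rfl⟩ | ⟨n1, n2, n3, n4, hb⟩) | hsep
  · unfold Btw at h5; grind
  · unfold Btw at h5; grind
  · have e1 := (R.isRoute g).src_eq h
    have e2 := (R.isRoute k).src_eq hs
    rcases eq_of_card_le_four (hR.fiber _ hsrc) e1 rfl h1 (e2.trans h1) h2 (hR.inv_ne h)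
      n2.symm n4.symm n1.symm n3.symm (hR.inv_ne hs).symm with rfl | rfl | rfl | rfl
    · exact (h3 rfl).elim
    · exact (h4 rfl).elim
    · exact (h6 h5).elim
    · exact (h6 (hb.1 h5)).elim
  · exact hsep

end Routing

end RotMap

namespace RotMap

variable {V P D : Type*} {M : RotMap P D} {pos : V → P} {G : SimpleGraph V}

namespace Routing

variable {R : M.Routing G pos}

lemma crossNum_path_symm (g : G.Dart) :
    M.crossNum (R.path g.symm) = M.crossNum (R.path g) := by
  rw [R.path_symm, (R.isRoute g).crossNum_rev]

namespace Piece

lemma ext' {x y : R.Piece} (h1 : x.1 = y.1) (h2 : x.2.val = y.2.val) : x = y := by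
  obtain ⟨g, i⟩ := x
  obtain ⟨h, j⟩ := y
  obtain rfl : g = h := h1
  obtain rfl : i = j := Fin.ext h2
  rfl

/-- The darts of a piece. -/
noncomputable def list (x : R.Piece) : List D :=
  (M.pieces (R.path x.1))[x.2.val]'(by
    rw [length_pieces (R.isRoute x.1).ne_nil]; exact x.2.isLt)

lemma getElem?_pieces (x : R.Piece) : (M.pieces (R.path x.1))[x.2.val]? = some x.list :=
  List.getElem?_eq_getElem _

lemma mem_pieces (x : R.Piece) : x.list ∈ M.pieces (R.path x.1) := List.getElem_mem _

lemma list_ne_nil (x : R.Piece) : x.list ≠ [] := fun h => nil_notMem_pieces _ (h ▸ x.mem_pieces)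

lemma list_infix (x : R.Piece) : x.list <:+: R.path x.1 := by
  have := List.infix_flatten_of_mem x.mem_pieces
  rwa [flatten_pieces] at this

/-- The piece traversed backwards. -/
noncomputable def inv (x : R.Piece) : R.Piece :=
  ⟨x.1.symm, ⟨M.crossNum (R.path x.1) - x.2.val, by rw [crossNum_path_symm]; omega⟩⟩

lemma inv_inv (x : R.Piece) : x.inv.inv = x := by
  refine ext' (SimpleGraph.Dart.symm_symm _) ?_
  have := x.2.isLt
  simp only [inv, crossNum_path_symm]
  omega

lemma list_inv (x : R.Piece) : x.inv.list = M.rev x.list := by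
  have h := x.inv.getElem?_pieces
  have hlen := length_pieces (M := M) (R.isRoute x.1).ne_nil
  have hlt := x.2.isLt
  simp only [inv, R.path_symm] at h
  rw [pieces_rev fun a b => (R.isRoute x.1).src_eq,
    List.getElem?_reverse (by rw [List.length_map, hlen]; omega), List.length_map, hlen,
    List.getElem?_map] at h
  have e : M.crossNum (R.path x.1) + 1 - 1 - (M.crossNum (R.path x.1) - x.2.val) = x.2.val := by
    omega
  rw [e, getElem?_pieces] at h
  simpa [inv, eq_comm] using h

/-- The first dart of a piece. -/
noncomputable def head (x : R.Piece) : D := x.list.head x.list_ne_nil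

lemma head_mem (x : R.Piece) : x.head ∈ x.list.head? := List.head?_eq_some_head _

lemma inv_head_inv (x : R.Piece) : M.inv x.inv.head ∈ x.list.getLast? := by
  have := x.inv.head_mem
  rwa [list_inv, mem_head_rev] at this

lemma src_head_of_eq_zero {x : R.Piece} (h : x.2.val = 0) : M.src x.head = pos x.1.fst := by
  refine (R.isRoute x.1).head _ ?_
  have e := x.getElem?_pieces
  rw [h, ← List.head?_eq_getElem?] at e
  conv => lhs; rw [← flatten_pieces (M := M) (R.path x.1)]
  obtain ⟨t, ht⟩ := List.head?_eq_some_iff.1 e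
  rw [ht, List.flatten_cons, List.head?_append_of_ne_nil _ x.list_ne_nil]
  exact x.head_mem

lemma exists_pred {x : R.Piece} (h : x.2.val ≠ 0) : ∃ y : R.Piece, y.1 = x.1 ∧
    y.2.val + 1 = x.2.val ∧ [M.inv y.inv.head, x.head] <:+: R.path x.1 ∧
      M.Cross (M.inv y.inv.head) x.head := by
  let y : R.Piece := ⟨x.1, ⟨x.2.val - 1, by omega⟩⟩
  have hy : y.2.val + 1 = x.2.val := by simp only [y]; omega
  have h1 := List.pair_infix_of_getElem y.getElem?_pieces (b := x.list) (by
    rw [hy]; exact x.getElem?_pieces)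
  exact ⟨y, rfl, hy, pair_infix_of_pieces h1 y.inv_head_inv x.head_mem,
    cross_of_pieces h1 y.inv_head_inv x.head_mem⟩

lemma exists_of_cross {g : G.Dart} {a b : D} (h : [a, b] <:+: R.path g) (hc : M.Cross a b) :
    ∃ x y : R.Piece, x.1 = g ∧ y.1 = g ∧ y.2.val + 1 = x.2.val ∧ x.head = b ∧
      y.inv.head = M.inv a := by
  obtain ⟨m, m', h1, ha, hb⟩ := pieces_of_cross h hc
  obtain ⟨i, h2, h3⟩ := List.exists_getElem_of_pair_infix h1
  have hlen := length_pieces (M := M) (R.isRoute g).ne_nil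
  have l2 := (List.getElem?_eq_some_iff.1 h2).1
  have l3 := (List.getElem?_eq_some_iff.1 h3).1
  let x : R.Piece := ⟨g, ⟨i + 1, by omega⟩⟩
  let y : R.Piece := ⟨g, ⟨i, by omega⟩⟩
  have hx : x.list = m' := Option.some.inj (x.getElem?_pieces.symm.trans h3)
  have hy : y.list = m := Option.some.inj (y.getElem?_pieces.symm.trans h2)
  refine ⟨x, y, rfl, rfl, rfl, Option.mem_unique x.head_mem (hx ▸ hb), ?_⟩
  have := Option.mem_unique y.inv_head_inv (hy ▸ ha)
  rw [← this, M.inv_inv]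

variable [Fintype G.Dart]

lemma eq_of_mem (hR : R.IsGood) {x y : R.Piece} {d : D} (hx : d ∈ x.list) (hy : d ∈ y.list) :
    x = y := by
  have h1 := hR.eq_of_mem (x.list_infix.subset hx) (y.list_infix.subset hy)
  refine ext' h1 ?_
  have hn := hR.nodup x.1
  rw [← flatten_pieces (M := M) (R.path x.1), List.nodup_flatten] at hn
  have hp := List.pairwise_iff_getElem.1 hn.2
  obtain ⟨hi, e1⟩ := List.getElem?_eq_some_iff.1 x.getElem?_pieces
  have e2' : (M.pieces (R.path x.1))[y.2.val]? = some y.list := by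
    rw [← y.getElem?_pieces, h1]
  obtain ⟨hj, e2⟩ := List.getElem?_eq_some_iff.1 e2'
  rcases lt_trichotomy x.2.val y.2.val with h | h | h
  · exact (hp _ _ hi hj h (by rwa [e1]) (by rwa [e2])).elim
  · exact h
  · exact (hp _ _ hj hi h (by rwa [e2]) (by rwa [e1])).elim

lemma eq_of_head_eq (hR : R.IsGood) {x y : R.Piece} (h : x.head = y.head) : x = y :=
  eq_of_mem hR (List.head_mem x.list_ne_nil) (by
    change x.head ∈ _; rw [h]; exact List.head_mem y.list_ne_nil)

end Piece

variable [Fintype G.Dart]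

/-- The map cut out by the pieces. -/
noncomputable def pieceMap (hR : R.IsGood) : RotMap P R.Piece where
  src x := M.src x.head
  key x := M.key x.head
  inv := Piece.inv
  inv_inv := Piece.inv_inv
  inv_ne x h := x.1.symm_ne (congrArg Sigma.fst h)
  key_inj _ _ hs hk := Piece.eq_of_head_eq hR (M.key_inj _ _ hs hk)

variable [Fintype D]

lemma IsReduced.fiber_of_sep (hR : R.IsReduced) {g : G.Dart} {a b a' b' d : D}
    (h1 : [a, b] <:+: R.path g) (hs : M.Sep a b a' b') (hd : M.src d = M.src b) :
    d = M.inv a ∨ d = b ∨ d = M.inv a' ∨ d = b' :=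
  hs.fiber (hR.fiber _ ((R.isRoute g).src_ne h1)) hd

/-- At a crossing, every passage is crossing. -/
lemma IsReduced.cross_of_src_eq (hR : R.IsReduced) {g h : G.Dart} {a b d₁ d₂ : D}
    (h1 : [a, b] <:+: R.path g) (hc : M.Cross a b) (h2 : [d₁, d₂] <:+: R.path h)
    (hs : M.src d₂ = M.src b) : M.Cross d₁ d₂ := by
  obtain ⟨k, a', b', h3, hsep⟩ := hR.exists_sep h1 hc
  have key : ∀ {u v k}, [u, v] <:+: R.path k → M.Cross u v → (d₂ = M.inv u ∨ d₂ = v) →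
      M.Cross d₁ d₂ := by
    rintro u v k huv hcuv (rfl | rfl)
    · rw [(hR.pair_unique h2 (pair_infix_symm huv)).2]
      exact (cross_inv ((R.isRoute k).src_eq huv)).2 hcuv
    · rwa [(hR.pair_unique h2 huv).2]
  rcases hR.fiber_of_sep h1 hsep hs with h | h | h | h
  · exact key h1 hc (.inl h)
  · exact key h1 hc (.inr h)
  · exact key h3 hsep.symm.cross (.inl h)
  · exact key h3 hsep.symm.cross (.inr h)

lemma isPlanar_pieceMap (hR : R.IsReduced) (hM : M.IsPlanar) :
    (pieceMap hR.toIsGood).IsPlanar := by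
  let S : PathSystem M (pieceMap hR.toIsGood) :=
    { path := Piece.list
      path_ne := Piece.list_ne_nil
      src_eq := fun _ => rfl
      key_eq := fun _ => rfl
      path_inv := Piece.list_inv
      chain := fun x a b h => (R.isRoute x.1).src_eq (h.trans x.list_infix)
      src_ne := fun x a b h y hy => by
        change M.src y.head = _ at hy
        have h1 := h.trans x.list_infix
        by_cases h0 : y.2.val = 0
        · rw [Piece.src_head_of_eq_zero h0] at hy
          exact (R.isRoute x.1).src_ne h1 _ hy.symm
        · obtain ⟨z, -, -, h2, hc⟩ := Piece.exists_pred h0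
          exact not_cross_of_pieces x.mem_pieces h (hR.cross_of_src_eq h2 hc h1 hy.symm)
      parallel := fun x a b y c d h h' hs =>
        (hR.parallel_or_sep (h.trans x.list_infix) (h'.trans y.list_infix) hs).resolve_right
          fun hsep => not_cross_of_pieces x.mem_pieces h hsep.cross }
  exact S.isPlanar hM

/-- The rotation at a crossing. -/
lemma exists_of_ne_zero (hR : R.IsReduced) {ρ : Equiv.Perm R.Piece}
    (hρ : (pieceMap hR.toIsGood).IsRotation ρ) {x : R.Piece} (hx : x.2.val ≠ 0) :
    ∃ (y : R.Piece) (a a' b' : D), y.1 = x.1 ∧ y.2.val + 1 = x.2.val ∧ ρ (ρ x) = y.inv ∧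
      (ρ x).2.val ≠ 0 ∧ [a, x.head] <:+: R.path x.1 ∧ [a', b'] <:+: R.path (ρ x).1 ∧
        M.Sep a x.head a' b' := by
  obtain ⟨y, hy1, hy2, h1, hc⟩ := Piece.exists_pred hx
  obtain ⟨k, a', b', h2, hs⟩ := hR.exists_sep h1 hc
  obtain ⟨z, w, hz, hw, hzw, rfl, hw'⟩ := Piece.exists_of_cross h2 hs.symm.cross
  have e1 := hs.src₁
  have e2 := hs.src₃
  have e3 := hs.src_eq
  rw [M.inv_inv] at e1
  have hne : ∀ {u v : R.Piece}, u.head ≠ v.head → u ≠ v := fun h h' => h (congrArg _ h')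
  have n1 := hs.ne₁
  have n2 := hs.ne₂
  have n3 := hs.ne₃
  have n4 := hs.ne₄
  have n6 := hs.ne₆
  have hb := hs.btw
  rw [M.inv_inv] at n1 n2 n3 hb
  rw [← hw'] at n2 n4 n6 hb e2
  have := hρ.apply_apply_of_btw (a := y.inv) (b := x) (c := w.inv) (e := z) e1 (e2.trans e3) e3
    (hne n1) (hne n2) (hne n3) (hne n4) (hne hs.ne₅) (hne n6) (fun d hd => ?_) hb
  · obtain ⟨h3, h4⟩ := this
    have hlt := z.2.isLt
    have hcr : M.crossNum (R.path w.1) = M.crossNum (R.path z.1) := by rw [hw, hz]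
    have hws : w.inv.1 = k.symm := congrArg SimpleGraph.Dart.symm hw
    rcases h4 with h4 | h4
    · refine ⟨y, _, _, _, hy1, hy2, h3, ?_, h1, ?_, hs.rev⟩
      · rw [h4]
        change M.crossNum (R.path w.1) - w.2.val ≠ 0
        omega
      · rw [h4, hws]
        exact pair_infix_symm h2
    · refine ⟨y, _, _, _, hy1, hy2, h3, ?_, h1, ?_, hs⟩
      · rw [h4]
        omega
      · rw [h4, hz]
        exact h2
  · have heq : ∀ {v : R.Piece}, d.head = v.head → d = v := Piece.eq_of_head_eq hR.toIsGood
    rcases hR.fiber_of_sep h1 hs hd with h | h | h | h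
    · rw [M.inv_inv] at h
      exact .inl (heq h)
    · exact .inr (.inl (heq h))
    · rw [← hw'] at h
      exact .inr (.inr (.inl (heq h)))
    · exact .inr (.inr (.inr (heq h)))

end Routing

end RotMap

namespace RotMap

variable {V P D : Type*}

/-- A rotation system arising from a drawing of `G` by turning crossings into vertices: each dart
is the `idx`-th part of an oriented edge `arc` of `G` with `num` crossings. -/
structure CrossingMap (M : RotMap P D) (G : SimpleGraph V) (ρ : Equiv.Perm D) where
  isRotation : M.IsRotation ρ
  pos : V → P
  pos_inj : Function.Injective pos
  arc : D → G.Dart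
  idx : D → ℕ
  num : G.Dart → ℕ
  ext : ∀ {x y}, arc x = arc y → idx x = idx y → x = y
  arc_inv : ∀ x, arc (M.inv x) = (arc x).symm
  idx_inv : ∀ x, idx (M.inv x) + idx x = num (arc x)
  num_symm : ∀ g, num g.symm = num g
  num_le : ∀ g, num g ≤ 2
  exists_eq : ∀ {g i}, i ≤ num g → ∃ x, arc x = g ∧ idx x = i
  src_eq : ∀ {x}, idx x = 0 → M.src x = pos (arc x).fst
  src_ne : ∀ {x}, idx x ≠ 0 → ∀ v, M.src x ≠ pos v
  next : ∀ {x}, idx x ≠ 0 → ∃ y, arc y = arc x ∧ idx y + 1 = idx x ∧ ρ (ρ x) = M.inv y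
  idx_next : ∀ {x}, idx x ≠ 0 → idx (ρ x) ≠ 0
  ends_ne : ∀ {x}, idx x ≠ 0 → (arc x).fst ≠ (arc (ρ x)).fst ∧ (arc x).fst ≠ (arc (ρ x)).snd ∧
    (arc x).snd ≠ (arc (ρ x)).fst ∧ (arc x).snd ≠ (arc (ρ x)).snd
  eq_of_arc_eq : ∀ {x y}, idx x ≠ 0 → idx y ≠ 0 → arc x = arc y →
    (arc (ρ x) = arc (ρ y) ∨ arc (ρ x) = (arc (ρ y)).symm) → x = y

variable {M : RotMap P D} {pos : V → P} {G : SimpleGraph V}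

namespace Routing

variable {R : M.Routing G pos} [Fintype G.Dart] [Fintype D]

/-- The rotation system of the pieces of a reduced routing. -/
noncomputable def crossingMap (hR : R.IsReduced) (hpos : Function.Injective pos)
    {ρ : Equiv.Perm R.Piece} (hρ : (pieceMap hR.toIsGood).IsRotation ρ) :
    (pieceMap hR.toIsGood).CrossingMap G ρ where
  isRotation := hρ
  pos := pos
  pos_inj := hpos
  arc x := x.1
  idx x := x.2.val
  num g := M.crossNum (R.path g)
  ext := Piece.ext'
  arc_inv _ := rfl
  idx_inv x := Nat.sub_add_cancel (Nat.lt_succ_iff.1 x.2.isLt)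
  num_symm := crossNum_path_symm
  num_le := hR.crossNum_le
  exists_eq {g i} h := ⟨⟨g, ⟨i, Nat.lt_succ_iff.2 h⟩⟩, rfl, rfl⟩
  src_eq := Piece.src_head_of_eq_zero
  src_ne {x} h v := by
    obtain ⟨_, -, -, h1, -⟩ := Piece.exists_pred (x := x) h
    exact (R.isRoute x.1).src_ne h1 v
  next h := by
    obtain ⟨y, -, -, -, h1, h2, h3, -⟩ := exists_of_ne_zero hR hρ h
    exact ⟨y, h1, h2, h3⟩
  idx_next h := by
    obtain ⟨-, -, -, -, -, -, -, h1, -⟩ := exists_of_ne_zero hR hρ h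
    exact h1
  ends_ne h := by
    obtain ⟨-, a, a', b', -, -, -, -, h1, h2, h3⟩ := exists_of_ne_zero hR hρ h
    exact hR.ends_ne h1 h2 h3
  eq_of_arc_eq {x y} hx hy h h' := by
    obtain ⟨-, a, a', b', -, -, -, -, h1, h2, h3⟩ := exists_of_ne_zero hR hρ hx
    obtain ⟨-, c, c', e', -, -, -, -, i1, i2, i3⟩ := exists_of_ne_zero hR hρ hy
    rw [← h] at i1
    refine Piece.eq_of_head_eq hR.toIsGood ?_
    rcases h' with h' | h'
    · rw [← h'] at i2
      exact hR.eq_of_sep h1 i1 h2 i2 h3 i3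
    · have := pair_infix_symm i2
      rw [← h'] at this
      exact hR.eq_of_sep h1 i1 h2 this h3 i3.rev

open Classical in
/-- Pairwise noncrossing edges of a graph without four-cycles. -/
lemma card_le_of_noncrossing [Fintype V] (hR : R.IsReduced) (hM : M.IsPlanar)
    (hpos : Function.Injective pos) {ρ : Equiv.Perm R.Piece}
    (hρ : (pieceMap hR.toIsGood).IsRotation ρ)
    (hC : ∀ a b c d, G.Adj a b → G.Adj b c → G.Adj c d → G.Adj d a → a = c ∨ b = d)
    (S : Finset G.Dart) (hS : ∀ g ∈ S, g.symm ∈ S)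
    (hind : ∀ x : R.Piece, x.2.val ≠ 0 → x.1 ∈ S → (ρ x).1 ∉ S) :
    7 * S.card ≤ 30 * Fintype.card V := by
  let hd (g : G.Dart) : D := (R.path g).head (R.isRoute g).ne_nil
  have hhd : ∀ g, hd g ∈ R.path g := fun g => List.head_mem _
  have hsrc : ∀ g, M.src (hd g) = pos g.fst := fun g =>
    (R.isRoute g).head _ (List.head?_eq_some_head _)
  let M' : RotMap P {g // g ∈ S} :=
    { src := fun g => M.src (hd g)
      key := fun g => M.key (hd g)
      inv := fun g => ⟨g.1.symm, hS _ g.2⟩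
      inv_inv := fun g => Subtype.ext g.1.symm_symm
      inv_ne := fun g h => g.1.symm_ne (congrArg Subtype.val h)
      key_inj := fun g h hs hk => Subtype.ext <| hR.eq_of_mem (hhd g) <| by
        rw [M.key_inj _ _ hs hk]; exact hhd h }
  let T : PathSystem M M' :=
    { path := fun g => R.path g
      path_ne := fun g => (R.isRoute g.1).ne_nil
      src_eq := fun _ => rfl
      key_eq := fun _ => rfl
      path_inv := fun g => R.path_symm g
      chain := fun g a b h => (R.isRoute g.1).src_eq h
      src_ne := fun g a b h y hy =>
        (R.isRoute g.1).src_ne h _ (hy.symm.trans (hsrc y))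
      parallel := fun g a b h c d h1 h2 hs => by
        refine (hR.parallel_or_sep h1 h2 hs).resolve_right fun hsep => ?_
        obtain ⟨x, y, hx, -, h3, rfl, -⟩ := Piece.exists_of_cross h1 hsep.cross
        obtain ⟨-, u, a', b', -, -, -, -, h4, h5, h6⟩ := exists_of_ne_zero hR hρ (x := x) (by omega)
        obtain rfl := (hR.pair_unique h1 h4).2
        have h7 := hind x (by omega) (hx ▸ g.2)
        rcases hR.fiber_of_sep h1 h6 hs with h8 | h8 | h8 | h8
        · exact hsep.ne₃ h8.symm
        · exact hsep.ne₅ h8.symm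
        · subst h8
          have h9 := (hR.pair_unique h2 (pair_infix_symm h5)).1
          refine h7 ?_
          rw [← (ρ x).1.symm_symm, ← h9]
          exact hS _ h.2
        · subst h8
          have h9 := (hR.pair_unique h2 h5).1
          exact h7 (h9 ▸ h.2) }
  have hs' : ∀ g, M'.src g = pos g.1.fst := fun g => hsrc g
  have ht' : ∀ g, M'.src (M'.inv g) = pos g.1.snd := fun g => hsrc _
  have key := (T.isPlanar hM).card_le (M := M') _ rfl
    ⟨fun g h => g.1.adj.ne (hpos (by rw [← hs', ← ht', h])), fun g h h1 h2 => by
      rw [hs', hs'] at h1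
      rw [ht', ht'] at h2
      exact Subtype.ext (SimpleGraph.Dart.ext _ _ (Prod.ext (hpos h1) (hpos h2)))⟩
    (fun d₀ d₁ d₂ d₃ h0 h1 h2 h3 => by
      rw [ht', hs'] at h0 h1 h2 h3
      rw [hs', hs', hs', hs']
      have e0 := d₀.1.adj
      have e1 := d₁.1.adj
      have e2 := d₂.1.adj
      have e3 := d₃.1.adj
      have h0 := hpos h0
      have h1 := hpos h1
      have h2 := hpos h2
      have h3 := hpos h3
      rw [h0] at e0
      rw [h1] at e1
      rw [h2] at e2
      rw [h3] at e3
      exact (hC _ _ _ _ e0 e1 e2 e3).imp (congrArg pos) (congrArg pos))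
  have h1 : (univ.image M'.src).card ≤ Fintype.card V := by
    refine (card_le_card (t := univ.image pos) fun p hp => ?_).trans card_image_le
    obtain ⟨g, -, rfl⟩ := mem_image.1 hp
    exact mem_image.2 ⟨_, mem_univ _, (hs' g).symm⟩
  rw [Fintype.card_coe] at key
  refine (key.trans ?_)
  convert Nat.mul_le_mul_left 30 h1

end Routing

end RotMap

namespace RotMap

variable {V P D : Type*} {M : RotMap P D} {G : SimpleGraph V} {ρ : Equiv.Perm D}

lemma face_inv_apply (d : D) : M.face ρ (M.inv (ρ d)) = d := by
  rw [face_apply, M.inv_inv, Equiv.symm_apply_apply]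

namespace CrossingMap

variable (X : M.CrossingMap G ρ)

lemma arc_sq {d : D} (h : X.idx d ≠ 0) : X.arc (ρ (ρ d)) = (X.arc d).symm := by
  obtain ⟨y, h1, -, h3⟩ := X.next h
  rw [h3, X.arc_inv, h1]

lemma idx_sq {d : D} (h : X.idx d ≠ 0) : X.idx (ρ (ρ d)) + X.idx d = X.num (X.arc d) + 1 := by
  obtain ⟨y, h1, h2, h3⟩ := X.next h
  have := X.idx_inv y
  rw [h1] at this
  rw [h3]
  omega

lemma idx_le (d : D) : X.idx d ≤ X.num (X.arc d) := by
  have := X.idx_inv d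
  omega

lemma num_arc_inv (d : D) : X.num (X.arc (M.inv d)) = X.num (X.arc d) := by
  rw [X.arc_inv, X.num_symm]

lemma num_sq {d : D} (h : X.idx d ≠ 0) : X.num (X.arc (ρ (ρ d))) = X.num (X.arc d) := by
  rw [X.arc_sq h, X.num_symm]

lemma idx_inv_sq {d : D} (h : X.idx d ≠ 0) : X.idx (M.inv (ρ (ρ d))) + 1 = X.idx d := by
  have h1 := X.idx_sq h
  have h2 := X.idx_inv (ρ (ρ d))
  have := X.idx_le d
  rw [X.num_sq h] at h2
  omega

lemma idx_sq_ne {d : D} (h : X.idx d ≠ 0) : X.idx (ρ (ρ d)) ≠ 0 := X.idx_next (X.idx_next h)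

lemma sq_sq {d : D} (h : X.idx d ≠ 0) : ρ (ρ (ρ (ρ d))) = d := by
  have h' := X.idx_sq_ne h
  refine X.ext (by rw [X.arc_sq h', X.arc_sq h, SimpleGraph.Dart.symm_symm]) ?_
  have h1 := X.idx_sq h
  have h2 := X.idx_sq h'
  rw [X.num_sq h] at h2
  omega

lemma idx_eq_zero_of_src_eq {x y : D} (h : M.src x = M.src y) (hx : X.idx x = 0) :
    X.idx y = 0 := by
  by_contra hy
  exact X.src_ne hy _ (h.symm.trans (X.src_eq hx))

lemma idx_next_eq_zero {d : D} : X.idx (ρ d) = 0 ↔ X.idx d = 0 :=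
  ⟨X.idx_eq_zero_of_src_eq (X.isRotation.1 d), X.idx_eq_zero_of_src_eq (X.isRotation.1 d).symm⟩

lemma idx_face_eq_zero {d : D} : X.idx (M.face ρ d) = 0 ↔ X.idx (M.inv d) = 0 := by
  rw [← X.idx_next_eq_zero, apply_face]

lemma src_inv_eq {d : D} (h : X.idx (M.inv d) = 0) : M.src (M.inv d) = X.pos (X.arc d).snd := by
  rw [X.src_eq h, X.arc_inv]
  rfl

lemma sq_inv_ne {d : D} (h : X.idx (M.inv d) ≠ 0) : ρ (ρ (M.inv d)) ≠ d := by
  intro h'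
  have h1 := X.idx_inv_sq h
  have h2 := X.idx_inv d
  rw [h'] at h1
  omega

/-- Two edges cross at most once. -/
lemma eq_or_eq_sq {x y : D} (hx : X.idx x ≠ 0) (hy : X.idx y ≠ 0)
    (h : X.arc x = X.arc y ∨ X.arc x = (X.arc y).symm)
    (h' : X.arc (ρ x) = X.arc (ρ y) ∨ X.arc (ρ x) = (X.arc (ρ y)).symm) :
    x = y ∨ x = ρ (ρ y) := by
  rcases h with h | h
  · exact .inl (X.eq_of_arc_eq hx hy h h')
  · refine .inr (X.eq_of_arc_eq hx (X.idx_sq_ne hy) (by rw [h, X.arc_sq hy]) ?_)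
    rw [X.arc_sq (X.idx_next hy), SimpleGraph.Dart.symm_symm]
    exact h'.symm

lemma arc_eq_of_ends {x y : D} (h1 : (X.arc x).fst = (X.arc y).fst)
    (h2 : (X.arc x).snd = (X.arc y).snd) : X.arc x = X.arc y :=
  SimpleGraph.Dart.ext _ _ (Prod.ext h1 h2)

lemma not_inner_sq {d : D} (h : X.idx d ≠ 0) (h1 : X.idx (M.inv d) ≠ 0) :
    X.idx (M.inv (ρ (ρ d))) = 0 := by
  have h2 := X.idx_inv_sq h
  have h3 := X.idx_inv d
  have := X.num_le (X.arc d)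
  omega

lemma num_of_inner {d : D} (h : X.idx d ≠ 0) (h1 : X.idx (M.inv d) ≠ 0) :
    X.num (X.arc d) = 2 ∧ X.idx d = 1 := by
  have h3 := X.idx_inv d
  have := X.num_le (X.arc d)
  omega

lemma inner_of_num {d : D} (h : X.idx d ≠ 0) (h1 : X.num (X.arc d) = 2) :
    X.idx (M.inv d) ≠ 0 ∨ X.idx (M.inv (ρ (ρ d))) ≠ 0 := by
  have h2 := X.idx_inv_sq h
  have h3 := X.idx_inv d
  omega

lemma eq_or_eq_inv_of_inner {x y : D} (h : X.idx x ≠ 0) (h1 : X.idx (M.inv x) ≠ 0)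
    (h' : X.idx y ≠ 0) (h1' : X.idx (M.inv y) ≠ 0)
    (ha : X.arc x = X.arc y ∨ X.arc x = (X.arc y).symm) : x = y ∨ x = M.inv y := by
  have e1 := (X.num_of_inner h h1).2
  have e2 := (X.num_of_inner h' h1').2
  have e3 := X.idx_inv y
  rw [(X.num_of_inner h' h1').1] at e3
  refine ha.imp (fun ha => X.ext ha (by omega)) fun ha => X.ext ?_ (by omega)
  rw [ha, X.arc_inv]

/-- The end points of consecutive darts of a face are distinct at a crossing. -/
lemma ends_ne_face {d : D} (h : X.idx (M.inv d) ≠ 0) :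
    (X.arc (M.face ρ d)).fst ≠ (X.arc d).snd ∧ (X.arc (M.face ρ d)).fst ≠ (X.arc d).fst ∧
    (X.arc (M.face ρ d)).snd ≠ (X.arc d).snd ∧ (X.arc (M.face ρ d)).snd ≠ (X.arc d).fst := by
  have := X.ends_ne (x := M.face ρ d) (X.idx_face_eq_zero.not.2 h)
  rw [apply_face, X.arc_inv] at this
  exact this

lemma face_ne (X : M.CrossingMap G ρ) (d : D) : M.face ρ d ≠ d := by
  intro h
  by_cases h1 : X.idx (M.inv d) = 0
  · have h2 : X.idx d = 0 := by rwa [← X.idx_face_eq_zero, h] at h1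
    have h3 := X.isRotation.src_face d
    rw [h, X.src_eq h2, X.src_inv_eq h1] at h3
    exact (X.arc d).adj.ne (X.pos_inj h3)
  · have := (X.ends_ne_face h1).2.1
    rw [h] at this
    exact this rfl

lemma face_face_ne (X : M.CrossingMap G ρ) (hdeg : ∀ x, X.idx x = 0 → ρ x ≠ x) (d : D) :
    M.face ρ (M.face ρ d) ≠ d := by
  intro h
  set e := M.face ρ d with he
  have s1 : ρ e = M.inv d := M.apply_face ρ d
  have s2 : ρ d = M.inv e := by rw [← M.apply_face ρ e, h]
  have h1 : X.idx (M.inv d) = 0 ↔ X.idx e = 0 := X.idx_face_eq_zero.symm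
  have h2 : X.idx (M.inv e) = 0 ↔ X.idx d = 0 := by rw [← X.idx_face_eq_zero, h]
  by_cases hd : X.idx d = 0 <;> by_cases he : X.idx e = 0
  · have e1 := X.src_inv_eq (h1.2 he)
    have e2 := X.src_inv_eq (h2.2 hd)
    rw [← s1, X.isRotation.1, X.src_eq he] at e1
    rw [← s2, X.isRotation.1, X.src_eq hd] at e2
    refine hdeg d hd (s2.trans (X.ext ?_ ((h2.2 hd).trans hd.symm)))
    rw [X.arc_inv]
    exact SimpleGraph.Dart.ext _ _ (Prod.ext (X.pos_inj e2).symm (X.pos_inj e1))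
  · have e1 := X.src_inv_eq (h2.2 hd)
    rw [← s2, X.isRotation.1, X.src_eq hd] at e1
    exact (X.ends_ne_face (h1.not.2 he)).2.2.2 (X.pos_inj e1).symm
  · have e1 := X.src_inv_eq (h1.2 he)
    rw [← s1, X.isRotation.1, X.src_eq he] at e1
    have := (X.ends_ne_face (d := e) (h2.not.2 hd)).2.2.2
    rw [h] at this
    exact this (X.pos_inj e1).symm
  · have a1 : X.arc e = X.arc (ρ (ρ (ρ d))) := by
      rw [X.arc_sq (X.idx_next hd), s2, X.arc_inv, SimpleGraph.Dart.symm_symm]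
    have a2 : X.arc (ρ e) = (X.arc (ρ (ρ (ρ (ρ d))))).symm := by
      rw [X.sq_sq hd, s1, X.arc_inv]
    rcases X.eq_or_eq_sq he (X.idx_sq_ne (X.idx_next hd)) (.inl a1) (.inr a2) with h3 | h3
    · exact X.sq_inv_ne (h2.not.2 hd) (by rw [← s2]; exact h3.symm)
    · rw [X.sq_sq (X.idx_next hd), s2] at h3
      exact M.inv_ne e h3.symm

end CrossingMap

end RotMap

namespace RotMap

variable {V P D : Type*} {M : RotMap P D} {G : SimpleGraph V} {ρ : Equiv.Perm D}

variable (M ρ) in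
/-- The dart starts a face of length three (or one). -/
def Tri (d : D) : Prop := M.face ρ (M.face ρ (M.face ρ d)) = d

lemma Tri.face_face {d : D} (h : M.Tri ρ d) : M.face ρ (M.face ρ d) = M.inv (ρ d) :=
  (M.face ρ).injective (by rw [face_inv_apply]; exact h)

lemma Tri.face {d : D} (h : M.Tri ρ d) : M.Tri ρ (M.face ρ d) := congrArg (M.face ρ) h

namespace CrossingMap

variable (X : M.CrossingMap G ρ)

lemma face_inv {d : D} (h : X.idx d ≠ 0) : M.face ρ (M.inv d) = ρ (ρ (ρ d)) := by
  rw [face_apply, M.inv_inv, Equiv.symm_apply_eq, X.sq_sq h]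

lemma face_apex {d : D} (h : X.idx d ≠ 0) (ht : M.Tri ρ (M.inv d)) :
    M.face ρ (ρ (ρ (ρ d))) = M.inv (ρ (ρ (M.face ρ d))) := by
  have := ht.face_face
  rwa [X.face_inv h, ← M.apply_face ρ d] at this

lemma src_apex {d : D} (h : X.idx d ≠ 0) (ht : M.Tri ρ (M.inv d)) :
    M.src (M.inv (ρ (ρ (ρ d)))) = M.src (M.inv (ρ (ρ (M.face ρ d)))) := by
  rw [← X.face_apex h ht, X.isRotation.src_face]

lemma apex_left {d : D} (h : X.idx d ≠ 0) (h1 : X.idx (M.inv d) ≠ 0) (ht : M.Tri ρ (M.inv d))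
    (h2 : X.idx (M.inv (M.face ρ d)) ≠ 0) : X.idx (M.inv (ρ (ρ (ρ d)))) = 0 :=
  X.idx_eq_zero_of_src_eq (X.src_apex h ht).symm
    (X.not_inner_sq (X.idx_face_eq_zero.not.2 h1) h2)

lemma apex_right {d : D} (h1 : X.idx (M.face ρ d) ≠ 0) (ht : M.Tri ρ (M.inv (M.face ρ d)))
    (h : X.idx d ≠ 0) : X.idx (M.inv (ρ (ρ (M.face ρ (M.face ρ d))))) = 0 := by
  refine X.idx_eq_zero_of_src_eq (X.src_apex h1 ht) ?_
  have h3 := X.idx_face_eq_zero.not.1 h1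
  rw [M.apply_face]
  exact X.not_inner_sq h3 (by rwa [M.inv_inv])

/-- The edges before and after a side of a face end at the apex of the triangle beyond the side. -/
lemma snd_eq_fst {d : D} (h1 : X.idx (M.face ρ d) ≠ 0)
    (ht : M.Tri ρ (M.inv (M.face ρ d))) (h2 : X.idx (M.face ρ (M.face ρ d)) ≠ 0)
    (h3 : X.idx (M.face ρ (M.face ρ (M.face ρ d))) ≠ 0) :
    (X.arc d).snd = (X.arc (M.face ρ (M.face ρ d))).fst := by
  have i2 := X.idx_face_eq_zero.not.1 h2
  have i3 := X.idx_face_eq_zero.not.1 h3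
  have i1 := X.idx_face_eq_zero.not.1 h1
  have e := X.src_apex h1 ht
  rw [X.src_inv_eq (X.apex_left h1 i2 ht i3), X.src_inv_eq (X.not_inner_sq h2 i3),
    M.apply_face, X.arc_sq i1, X.arc_inv, X.arc_sq h2] at e
  exact X.pos_inj e

/-- The triangle opposite to a corner between two crossings provides an edge. -/
lemma adj_of_tri_sq {d : D} (h : X.idx d ≠ 0) (h1 : X.idx (M.face ρ d) ≠ 0)
    (h2 : X.idx (M.face ρ (M.face ρ d)) ≠ 0) (ht : M.Tri ρ (ρ (ρ (M.face ρ d)))) :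
    G.Adj (X.arc (M.face ρ d)).fst (X.arc d).snd := by
  have i1 := X.idx_face_eq_zero.not.1 h1
  have i2 := X.idx_face_eq_zero.not.1 h2
  set c := ρ (ρ (M.face ρ d)) with hc
  have hρc : ρ c = ρ (ρ (M.inv d)) := by rw [hc, M.apply_face]
  have j1 : X.idx (M.inv c) = 0 := X.not_inner_sq h1 i2
  have j2 : X.idx (M.inv (ρ c)) = 0 := by
    rw [hρc]
    exact X.not_inner_sq i1 (by rwa [M.inv_inv])
  have k1 : (X.arc (M.face ρ c)).fst = (X.arc (M.face ρ d)).fst := by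
    have := X.isRotation.src_face c
    rw [X.src_inv_eq j1, X.src_eq (X.idx_face_eq_zero.2 j1), X.arc_sq h1] at this
    exact X.pos_inj this
  have k2 : (X.arc (M.face ρ c)).snd = (X.arc d).snd := by
    have e := X.isRotation.src_face (M.face ρ c)
    rw [ht.face_face] at e
    have j3 := X.idx_eq_zero_of_src_eq e j2
    rw [X.src_inv_eq j2, X.src_inv_eq j3, hρc, X.arc_sq i1, X.arc_inv] at e
    exact (X.pos_inj e).symm
  have := (X.arc (M.face ρ c)).adj
  rwa [k1, k2] at this

lemma not_tri_and_tri_inv {d : D} (h : X.idx d ≠ 0) (h1 : X.idx (M.inv d) ≠ 0)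
    (ht : M.Tri ρ d) : ¬ M.Tri ρ (M.inv d) := by
  intro ht'
  have hb := X.idx_face_eq_zero.not.2 h1
  have ha := X.idx_next h
  have f1 := ht.face_face
  have f2 := X.face_apex h ht'
  have s1 : M.src (M.inv (ρ d)) = M.src (M.inv (M.face ρ d)) := by
    rw [← f1, X.isRotation.src_face]
  have s2 := X.src_apex h ht'
  by_cases c1 : X.idx (M.inv (ρ d)) = 0
  · have e1 := s1
    rw [X.src_inv_eq c1, X.src_inv_eq (X.idx_eq_zero_of_src_eq s1 c1)] at e1
    by_cases c2 : X.idx (M.inv (ρ (ρ (ρ d)))) = 0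
    · have e2 := s2
      rw [X.src_inv_eq c2, X.src_inv_eq (X.idx_eq_zero_of_src_eq s2 c2), X.arc_sq ha,
        X.arc_sq hb] at e2
      have e3 := X.arc_eq_of_ends (X.pos_inj e2) (X.pos_inj e1)
      have a1 : X.arc d = (X.arc (M.inv d)).symm := by
        rw [X.arc_inv, SimpleGraph.Dart.symm_symm]
      have a2 : X.arc (ρ d) = (X.arc (ρ (M.inv d))).symm := by
        rw [← M.apply_face ρ d, X.arc_sq hb, SimpleGraph.Dart.symm_symm, e3]
      rcases X.eq_or_eq_sq h h1 (.inr a1) (.inr a2) with h3 | h3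
      · exact M.inv_ne d h3.symm
      · exact X.sq_inv_ne h1 h3.symm
    · refine (X.ends_ne_face c2).2.2.2 ?_
      rw [f2, X.arc_inv, X.arc_sq ha, X.arc_sq hb]
      exact (X.pos_inj e1).symm
  · have c2 := X.not_inner_sq ha c1
    have e2 := s2
    rw [X.src_inv_eq c2, X.src_inv_eq (X.idx_eq_zero_of_src_eq s2 c2), X.arc_sq ha,
      X.arc_sq hb] at e2
    refine (X.ends_ne_face (d := M.face ρ d) fun h' => c1
      (X.idx_eq_zero_of_src_eq s1.symm h')).2.2.2
      ?_
    rw [f1, X.arc_inv]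
    exact X.pos_inj e2

/-- No edge has both its sides on a face all of whose corners are crossings. -/
lemma face_ne_inv {x p : D} (h : X.idx (M.inv x) ≠ 0) (hp : X.idx p ≠ 0)
    (hx : X.idx (M.inv (M.face ρ x)) ≠ 0) : M.face ρ p ≠ M.inv x := by
  intro h'
  have e1 : ρ (M.inv x) = M.inv p := by rw [← h', M.apply_face]
  have e2 : M.face ρ x = ρ (ρ (M.inv p)) := by
    rw [face_apply, Equiv.symm_apply_eq, ← e1, X.sq_sq h]
  rw [e2] at hx
  exact hx (X.not_inner_sq (by rw [← e1]; exact X.idx_next h) (by rwa [M.inv_inv]))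

end CrossingMap

end RotMap

namespace RotMap

variable {V P D : Type*} {M : RotMap P D} {G : SimpleGraph V} {ρ : Equiv.Perm D}

namespace CrossingMap

variable (X : M.CrossingMap G ρ) (Q : Finset G.Dart)

/-- Both ends of the dart are crossings. -/
def Inner (d : D) : Prop := X.idx d ≠ 0 ∧ X.idx (M.inv d) ≠ 0

open Classical in
/-- Indicator of inner darts starting a triangle. -/
noncomputable def tri (d : D) : ℤ := if X.Inner d ∧ M.Tri ρ d then 1 else 0

open Classical in
/-- Indicator of inner darts with a triangle on their other side. -/
noncomputable def apex (d : D) : ℤ := if X.Inner d ∧ M.Tri ρ (M.inv d) then 1 else 0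

open Classical in
/-- Indicator of the darts of the edges in `Q`. -/
noncomputable def spec (d : D) : ℤ := if X.arc d ∈ Q then 1 else 0

open Classical in
/-- Charge sent through a crossing to a corner between two crossings. -/
noncomputable def across (d : D) : ℤ :=
  if X.idx d ≠ 0 ∧ X.idx (M.inv d) = 0 ∧ X.idx (M.inv (ρ d)) = 0 ∧
    X.idx (M.inv (ρ (ρ d))) ≠ 0 ∧ X.idx (M.inv (ρ (ρ (ρ d)))) ≠ 0 then
    if M.Tri ρ d then 22 else 46 else 0

open Classical in
/-- Charge sent to the next corner. -/
noncomputable def toNext (d : D) : ℤ :=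
  if X.idx d ≠ 0 ∧ X.idx (M.inv d) = 0 ∧ X.idx (M.inv (ρ d)) = 0 ∧
    X.idx (M.inv (ρ (ρ d))) ≠ 0 ∧ X.idx (M.inv (ρ (ρ (ρ d)))) = 0 then 22 else 0

open Classical in
/-- Charge sent to the previous corner. -/
noncomputable def toPrev (d : D) : ℤ :=
  if X.idx d ≠ 0 ∧ X.idx (M.inv d) = 0 ∧ X.idx (M.inv (ρ d)) = 0 ∧
    X.idx (M.inv (ρ (ρ d))) = 0 ∧ X.idx (M.inv (ρ (ρ (ρ d)))) ≠ 0 then 22 else 0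

/-- Net charge received at a corner. -/
noncomputable def transfer (d : D) : ℤ :=
  (X.across (ρ (ρ d)) - X.across d) + (X.toNext (ρ (ρ (ρ d))) - X.toNext d) +
    (X.toPrev (ρ d) - X.toPrev d)

open Classical in
/-- Initial charge of a corner. -/
noncomputable def base (d : D) : ℤ :=
  if X.idx d = 0 then 146 + (if X.idx (M.inv d) = 0 then 30 else 0) else 100

open Classical in
/-- Charge lost by the corners between two crossings at the edges in `Q`. -/
noncomputable def draw (d : D) : ℤ :=
  if X.Inner d ∧ X.Inner (ρ d) then 30 * (X.spec Q d + X.spec Q (ρ d)) else 0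

/-- Half of the charge sent through the sides of triangles. -/
noncomputable def side (d : D) : ℤ := 27 * (X.tri d - X.apex d)

/-- The final charge of a corner. -/
noncomputable def charge (d : D) : ℤ :=
  X.base d + X.transfer d - X.draw Q d + (X.side d - X.side (ρ d))

variable {X}

lemma tri_nonneg (d : D) : 0 ≤ X.tri d := by unfold tri; split_ifs <;> omega

lemma apex_nonneg (d : D) : 0 ≤ X.apex d := by unfold apex; split_ifs <;> omega

lemma tri_add_apex_le (d : D) : X.tri d + X.apex d ≤ 1 := by
  unfold tri apex
  split_ifs with h1 h2 <;> try omega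
  exact (X.not_tri_and_tri_inv h1.1.1 h1.1.2 h1.2 h2.2).elim

lemma spec_nonneg (d : D) : 0 ≤ X.spec Q d := by unfold spec; split_ifs <;> omega

lemma spec_le (d : D) : X.spec Q d ≤ 1 := by unfold spec; split_ifs <;> omega

lemma inner_inv {d : D} : X.Inner (M.inv d) ↔ X.Inner d := by
  simp only [Inner, M.inv_inv, and_comm]

lemma tri_inv (d : D) : X.tri (M.inv d) = X.apex d := by
  unfold tri apex
  rw [inner_inv]

lemma apex_inv (d : D) : X.apex (M.inv d) = X.tri d := by
  unfold tri apex
  rw [inner_inv, M.inv_inv]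

lemma side_inv (d : D) : X.side (M.inv d) = - X.side d := by
  rw [side, side, tri_inv, apex_inv]; ring

lemma side_eq_zero {d : D} (h : ¬ X.Inner d) : X.side d = 0 := by
  simp [side, tri, apex, h]

lemma across_nonneg (d : D) : 0 ≤ X.across d := by unfold across; split_ifs <;> omega

lemma toNext_nonneg (d : D) : 0 ≤ X.toNext d := by unfold toNext; split_ifs <;> omega

lemma toPrev_nonneg (d : D) : 0 ≤ X.toPrev d := by unfold toPrev; split_ifs <;> omega

lemma sent_le (d : D) : X.across d + X.toNext d + X.toPrev d ≤ 46 ∧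
    (M.Tri ρ d → X.across d + X.toNext d + X.toPrev d ≤ 22) := by
  unfold across toNext toPrev
  constructor
  · split_ifs <;> grind
  · intro h
    split_ifs <;> grind

lemma sent_eq_zero {d : D} (h : X.idx d = 0 ∨ X.idx (M.inv d) ≠ 0 ∨ X.idx (M.inv (ρ d)) ≠ 0) :
    X.across d = 0 ∧ X.toNext d = 0 ∧ X.toPrev d = 0 := by
  unfold across toNext toPrev
  refine ⟨if_neg ?_, if_neg ?_, if_neg ?_⟩ <;> tauto

lemma transfer_ge (d : D) : -46 ≤ X.transfer d ∧ (M.Tri ρ d → -22 ≤ X.transfer d) := by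
  have h := X.sent_le d
  have h1 := X.across_nonneg (ρ (ρ d))
  have h2 := X.toNext_nonneg (ρ (ρ (ρ d)))
  have h3 := X.toPrev_nonneg (ρ d)
  unfold transfer
  exact ⟨by omega, fun ht => by have := h.2 ht; omega⟩

lemma transfer_ge_of {d : D}
    (h : X.idx d = 0 ∨ X.idx (M.inv d) ≠ 0 ∨ X.idx (M.inv (ρ d)) ≠ 0) :
    X.across (ρ (ρ d)) + X.toNext (ρ (ρ (ρ d))) + X.toPrev (ρ d) ≤ X.transfer d := by
  obtain ⟨h1, h2, h3⟩ := X.sent_eq_zero h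
  unfold transfer
  omega

lemma transfer_nonneg {d : D}
    (h : X.idx d = 0 ∨ X.idx (M.inv d) ≠ 0 ∨ X.idx (M.inv (ρ d)) ≠ 0) : 0 ≤ X.transfer d := by
  have h0 := X.transfer_ge_of h
  have h1 := X.across_nonneg (ρ (ρ d))
  have h2 := X.toNext_nonneg (ρ (ρ (ρ d)))
  have h3 := X.toPrev_nonneg (ρ d)
  omega

/-- A corner between two crossings receives charge through its crossing. -/
lemma transfer_ge_of_inner {d : D} (h : X.Inner d) (h' : X.Inner (ρ d)) :
    22 ≤ X.transfer d ∧ (¬ M.Tri ρ (ρ (ρ d)) → 46 ≤ X.transfer d) := by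
  classical
  have h0 := X.transfer_ge_of (.inr (.inl h.2))
  have h2 := X.toNext_nonneg (ρ (ρ (ρ d)))
  have h3 := X.toPrev_nonneg (ρ d)
  have h4 : X.across (ρ (ρ d)) = if M.Tri ρ (ρ (ρ d)) then 22 else 46 := by
    rw [across, if_pos]
    rw [X.sq_sq h.1]
    exact ⟨X.idx_sq_ne h.1, X.not_inner_sq h.1 h.2, X.not_inner_sq h'.1 h'.2, h.2, h'.2⟩
  constructor
  · split_ifs at h4 <;> omega
  · intro ht
    rw [if_neg ht] at h4
    omega

lemma transfer_ge_left {d : D} (h : X.Inner d) (h1 : X.idx (M.inv (ρ d)) = 0)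
    (h3 : X.idx (M.inv (ρ (ρ (ρ d)))) = 0) : 22 ≤ X.transfer d := by
  have h0 := X.transfer_ge_of (.inr (.inl h.2))
  have i1 := X.across_nonneg (ρ (ρ d))
  have i2 := X.toNext_nonneg (ρ (ρ (ρ d)))
  have h4 : X.toPrev (ρ d) = 22 := by
    rw [toPrev, if_pos]
    rw [X.sq_sq h.1]
    exact ⟨X.idx_next h.1, h1, X.not_inner_sq h.1 h.2, h3, h.2⟩
  omega

lemma transfer_ge_right {d : D} (h : X.Inner (ρ d)) (h1 : X.idx (M.inv d) = 0)
    (h3 : X.idx (M.inv (ρ (ρ d))) = 0) : 22 ≤ X.transfer d := by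
  have h0 := X.transfer_ge_of (d := d) (.inr (.inr h.2))
  have i1 := X.across_nonneg (ρ (ρ d))
  have i2 := X.toPrev_nonneg (ρ d)
  have hd : X.idx d ≠ 0 := fun h' => h.1 (X.idx_next_eq_zero.2 h')
  have h4 : X.toNext (ρ (ρ (ρ d))) = 22 := by
    rw [toNext, if_pos]
    rw [X.sq_sq hd]
    exact ⟨X.idx_sq_ne h.1, X.not_inner_sq h.1 h.2, h1, h.2, h3⟩
  omega

variable {Q}

lemma draw_eq_zero {d : D} (h : ¬ (X.Inner d ∧ X.Inner (ρ d))) : X.draw Q d = 0 := if_neg h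

lemma inner_next_face {d : D} : X.Inner (ρ (M.face ρ d)) ↔ X.Inner d := by
  rw [M.apply_face, inner_inv]

lemma side_next_face (d : D) : X.side (ρ (M.face ρ d)) = - X.side d := by
  rw [M.apply_face, side_inv]

lemma charge_real {d : D} (h : X.idx (M.face ρ d) = 0) : 146 ≤ X.charge Q (M.face ρ d) := by
  have h1 := X.transfer_nonneg (.inl h)
  have h2 : ¬ X.Inner (M.face ρ d) := fun h' => h'.1 h
  have h3 : ¬ X.Inner d := fun h' => X.idx_face_eq_zero.not.2 h'.2 h
  rw [charge, draw_eq_zero (fun h => h2 h.1), side_next_face, side_eq_zero h2, side_eq_zero h3,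
    base,
    if_pos h]
  split_ifs <;> omega

lemma charge_real_real {d : D} (h : X.idx (M.face ρ d) = 0)
    (h' : X.idx (M.face ρ (M.face ρ d)) = 0) : 176 ≤ X.charge Q (M.face ρ d) := by
  have h1 := X.transfer_nonneg (.inl h)
  have h2 : ¬ X.Inner (M.face ρ d) := fun h' => h'.1 h
  have h3 : ¬ X.Inner d := fun h' => X.idx_face_eq_zero.not.2 h'.2 h
  rw [charge, draw_eq_zero (fun h => h2 h.1), side_next_face, side_eq_zero h2, side_eq_zero h3,
    base,
    if_pos h, if_pos (X.idx_face_eq_zero.1 h')]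
  omega

lemma charge_single {d : D} (h0 : X.idx d = 0) (h1 : X.idx (M.face ρ d) ≠ 0)
    (h2 : X.idx (M.face ρ (M.face ρ d)) = 0) : 54 ≤ X.charge Q (M.face ρ d) ∧
      (M.Tri ρ d → 78 ≤ X.charge Q (M.face ρ d)) := by
  have i1 := X.transfer_ge (M.face ρ d)
  have i2 : ¬ X.Inner (M.face ρ d) := fun h' => X.idx_face_eq_zero.not.2 h'.2 h2
  have i3 : ¬ X.Inner d := fun h' => h'.1 h0
  rw [charge, draw_eq_zero (fun h => i2 h.1), side_next_face, side_eq_zero i2, side_eq_zero i3,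
    base,
    if_neg h1]
  exact ⟨by omega, fun ht => by have := i1.2 ht.face; omega⟩

/-- What the discharging argument needs to know about `Q`. -/
structure IsSpecial (X : M.CrossingMap G ρ) (Q : Finset G.Dart) : Prop where
  symm : ∀ g ∈ Q, g.symm ∈ Q
  notMem : ∀ x, X.idx x ≠ 0 → X.arc x ∈ Q → X.arc (ρ x) ∉ Q
  num_eq : ∀ x, X.idx x ≠ 0 → X.arc x ∈ Q → X.num (X.arc (ρ x)) = 2
  num_eq' : ∀ g ∈ Q, X.num g = 2

lemma IsSpecial.mem_inv (hQ : X.IsSpecial Q) {d : D} : X.arc (M.inv d) ∈ Q ↔ X.arc d ∈ Q := by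
  rw [X.arc_inv]
  exact ⟨fun h => by simpa using hQ.symm _ h, hQ.symm _⟩

lemma IsSpecial.spec_inv (hQ : X.IsSpecial Q) (d : D) : X.spec Q (M.inv d) = X.spec Q d := by
  by_cases h : X.arc d ∈ Q
  · rw [spec, spec, if_pos h, if_pos (hQ.mem_inv.2 h)]
  · rw [spec, spec, if_neg h, if_neg (mt hQ.mem_inv.1 h)]

lemma IsSpecial.inner_or (hQ : X.IsSpecial Q) {d : D} (h : X.idx d ≠ 0) (hd : X.arc d ∈ Q) :
    X.idx (M.inv (ρ d)) ≠ 0 ∨ X.idx (M.inv (ρ (ρ (ρ d)))) ≠ 0 :=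
  X.inner_of_num (X.idx_next h) (hQ.num_eq d h hd)

lemma IsSpecial.spec_add_le (hQ : X.IsSpecial Q) {d : D} (h : X.idx (M.face ρ d) ≠ 0) :
    X.spec Q d + X.spec Q (M.face ρ d) ≤ 1 := by
  have := hQ.notMem _ h
  rw [M.apply_face, hQ.mem_inv] at this
  unfold spec
  split_ifs <;> first | omega | tauto

lemma charge_left {d : D} (h0 : X.idx d = 0) (h1 : X.Inner (M.face ρ d)) :
    100 + X.side (M.face ρ d) + X.transfer (M.face ρ d) ≤ X.charge Q (M.face ρ d) ∧
      0 ≤ X.transfer (M.face ρ d) := by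
  have i1 := X.transfer_nonneg (.inr (.inl h1.2))
  have i3 : ¬ X.Inner d := fun h' => h'.1 h0
  rw [charge, draw_eq_zero (fun h => i3 (inner_next_face.1 h.2)), side_next_face, side_eq_zero i3,
    base, if_neg h1.1]
  omega

lemma charge_left' (hQ : X.IsSpecial Q) {d : D} (h0 : X.idx d = 0) (h1 : X.Inner (M.face ρ d))
    (h2 : X.Inner (M.face ρ (M.face ρ d))) :
    100 - 5 * X.apex (M.face ρ d) ≤ X.charge Q (M.face ρ d) ∧
      X.apex (M.face ρ d) + X.spec Q (M.face ρ d) ≤ 1 := by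
  obtain ⟨i1, i2⟩ := charge_left (Q := Q) h0 h1
  have i3 := X.tri_nonneg (M.face ρ d)
  have i4 := X.tri_add_apex_le (M.face ρ d)
  unfold side at i1
  by_cases ht : M.Tri ρ (M.inv (M.face ρ d))
  · have j1 := X.apex_left h1.1 h1.2 ht h2.2
    have j0 : X.idx (M.inv (ρ (M.face ρ d))) = 0 := by rwa [M.apply_face, M.inv_inv]
    have j2 := X.transfer_ge_left h1 j0 j1
    have j3 : X.spec Q (M.face ρ d) = 0 := if_neg fun h => by
      have := hQ.inner_or h1.1 h
      tauto
    omega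
  · have j1 : X.apex (M.face ρ d) = 0 := if_neg fun h => ht h.2
    have := X.spec_le Q (M.face ρ d)
    omega

lemma charge_right {d : D} (h0 : X.Inner d) (h1 : X.idx (M.face ρ (M.face ρ d)) = 0) :
    100 + X.side d + X.transfer (M.face ρ d) ≤ X.charge Q (M.face ρ d) ∧
      0 ≤ X.transfer (M.face ρ d) := by
  have i0 := inner_next_face.2 h0
  have i1 := X.transfer_nonneg (d := M.face ρ d) (.inr (.inr i0.2))
  have i3 : ¬ X.Inner (M.face ρ d) := fun h' => X.idx_face_eq_zero.not.2 h'.2 h1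
  rw [charge, draw_eq_zero (fun h => i3 h.1), side_next_face, side_eq_zero i3,
    base, if_neg (X.idx_face_eq_zero.not.2 h0.2)]
  omega

lemma charge_right' (hQ : X.IsSpecial Q) {d : D} (h : X.idx d ≠ 0) (h0 : X.Inner (M.face ρ d))
    (h1 : X.idx (M.face ρ (M.face ρ (M.face ρ d))) = 0) :
    100 - 5 * X.apex (M.face ρ d) ≤ X.charge Q (M.face ρ (M.face ρ d)) ∧
      X.apex (M.face ρ d) + X.spec Q (M.face ρ d) ≤ 1 := by
  obtain ⟨i1, i2⟩ := charge_right (Q := Q) h0 h1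
  have i3 := X.tri_nonneg (M.face ρ d)
  have i4 := X.tri_add_apex_le (M.face ρ d)
  unfold side at i1
  by_cases ht : M.Tri ρ (M.inv (M.face ρ d))
  · have j1 := X.apex_right h0.1 ht h
    have j0 := X.idx_face_eq_zero.1 h1
    have j2 := X.transfer_ge_right (inner_next_face.2 h0) j0 j1
    have j3 : X.spec Q (M.face ρ d) = 0 := if_neg fun h' => by
      have := hQ.inner_or h0.2 (hQ.mem_inv.2 h')
      rw [← M.apply_face ρ (M.face ρ d), X.sq_sq (X.idx_face_eq_zero.not.2 h0.2)] at this
      tauto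
    omega
  · have j1 : X.apex (M.face ρ d) = 0 := if_neg fun h => ht h.2
    have := X.spec_le Q (M.face ρ d)
    omega

lemma charge_inner (hQ : X.IsSpecial Q) {d : D} (h0 : X.Inner d) (h1 : X.Inner (M.face ρ d)) :
    122 + X.side d + X.side (M.face ρ d) - 30 * (X.spec Q d + X.spec Q (M.face ρ d)) ≤
        X.charge Q (M.face ρ d) ∧ (¬ M.Tri ρ (ρ (ρ (M.face ρ d))) →
      146 + X.side d + X.side (M.face ρ d) - 30 * (X.spec Q d + X.spec Q (M.face ρ d)) ≤
        X.charge Q (M.face ρ d)) := by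
  have i1 := X.transfer_ge_of_inner h1 (inner_next_face.2 h0)
  rw [charge, draw, if_pos ⟨h1, inner_next_face.2 h0⟩, side_next_face, base, if_neg h1.1,
    M.apply_face, hQ.spec_inv]
  exact ⟨by omega, fun h => by have := i1.2 (by rwa [M.apply_face]); omega⟩

end CrossingMap

end RotMap

namespace RotMap

variable {V P D : Type*} {M : RotMap P D} {G : SimpleGraph V} {ρ : Equiv.Perm D}

namespace CrossingMap

variable {X : M.CrossingMap G ρ} {Q : Finset G.Dart}

lemma inner_iff {b c : D} (hbc : M.face ρ b = c) : X.Inner b ↔ X.idx b ≠ 0 ∧ X.idx c ≠ 0 := by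
  subst hbc
  rw [Inner, Ne, Ne, Ne, X.idx_face_eq_zero]

lemma side_ge (d : D) : -27 * X.apex d ≤ X.side d ∧ -27 ≤ X.side d := by
  have h1 := X.tri_nonneg d
  have h2 := X.tri_add_apex_le d
  have h3 := X.apex_nonneg d
  unfold side
  omega

lemma side_of_tri {d : D} (h : X.Inner d) (ht : M.Tri ρ d) : X.side d = 27 := by
  have h1 : X.tri d = 1 := if_pos ⟨h, ht⟩
  have h2 := X.tri_add_apex_le d
  have h3 := X.apex_nonneg d
  unfold side
  omega

lemma charge_ge_of_real {a b c : D} (hab : M.face ρ a = b) (hbc : M.face ρ b = c)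
    (hb : X.idx b = 0) : 146 ≤ X.charge Q b ∧ (X.idx c = 0 → 176 ≤ X.charge Q b) := by
  subst hab hbc
  exact ⟨charge_real hb, charge_real_real hb⟩

lemma charge_ge_of_single {a b c : D} (hab : M.face ρ a = b) (hbc : M.face ρ b = c)
    (ha : X.idx a = 0) (hb : X.idx b ≠ 0) (hc : X.idx c = 0) :
    54 ≤ X.charge Q b ∧ (M.Tri ρ a → 78 ≤ X.charge Q b) := by
  subst hab hbc
  exact charge_single ha hb hc

lemma charge_ge_of_left {a b c : D} (hab : M.face ρ a = b) (hbc : M.face ρ b = c)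
    (ha : X.idx a = 0) (hb : X.idx b ≠ 0) (hc : X.idx c ≠ 0) :
    73 ≤ X.charge Q b ∧ 100 + X.side b ≤ X.charge Q b := by
  have hi := (X.inner_iff hbc).2 ⟨hb, hc⟩
  subst hab
  have h1 := charge_left (Q := Q) ha hi
  have := (X.side_ge (M.face ρ a)).2
  omega

lemma charge_ge_of_right {a b c : D} (hab : M.face ρ a = b) (hbc : M.face ρ b = c)
    (ha : X.idx a ≠ 0) (hb : X.idx b ≠ 0) (hc : X.idx c = 0) :
    73 ≤ X.charge Q b ∧ 100 + X.side a ≤ X.charge Q b := by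
  have hi := (X.inner_iff hab).2 ⟨ha, hb⟩
  subst hab hbc
  have h1 := charge_right (Q := Q) hi hc
  have := (X.side_ge a).2
  omega

lemma charge_ge_of_inner (hQ : X.IsSpecial Q) {a b c : D} (hab : M.face ρ a = b)
    (hbc : M.face ρ b = c) (ha : X.idx a ≠ 0) (hb : X.idx b ≠ 0) (hc : X.idx c ≠ 0) :
    122 + X.side a + X.side b - 30 * (X.spec Q a + X.spec Q b) ≤ X.charge Q b ∧
      (¬ M.Tri ρ (ρ (ρ b)) →
        146 + X.side a + X.side b - 30 * (X.spec Q a + X.spec Q b) ≤ X.charge Q b) ∧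
      X.spec Q a + X.spec Q b ≤ 1 ∧ 38 ≤ X.charge Q b := by
  have hi := (X.inner_iff hab).2 ⟨ha, hb⟩
  have hi' := (X.inner_iff hbc).2 ⟨hb, hc⟩
  subst hab hbc
  have h1 := charge_inner hQ hi hi'
  have h2 := hQ.spec_add_le hb
  have := (X.side_ge a).2
  have := (X.side_ge (M.face ρ a)).2
  exact ⟨h1.1, h1.2, h2, by omega⟩

lemma charge_ge (hQ : X.IsSpecial Q) {a b : D} (hab : M.face ρ a = b) : 38 ≤ X.charge Q b := by
  by_cases hb : X.idx b = 0
  · have := (charge_ge_of_real (Q := Q) hab rfl hb).1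
    omega
  by_cases ha : X.idx a = 0 <;> by_cases hc : X.idx (M.face ρ b) = 0
  · have := (charge_ge_of_single (Q := Q) hab rfl ha hb hc).1
    omega
  · have := (charge_ge_of_left (Q := Q) hab rfl ha hb hc).1
    omega
  · have := (charge_ge_of_right (Q := Q) hab rfl ha hb hc).1
    omega
  · exact (charge_ge_of_inner hQ hab rfl ha hb hc).2.2.2

lemma tri_of_face_eq {a b c : D} (hab : M.face ρ a = b) (hbc : M.face ρ b = c)
    (hca : M.face ρ c = a) : M.Tri ρ a := by
  rw [Tri, hab, hbc, hca]

lemma charge_three {a b c : D} (hab : M.face ρ a = b)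
    (hbc : M.face ρ b = c) (hca : M.face ρ c = a) (ha : X.idx a = 0) :
    400 ≤ X.charge Q a + X.charge Q b + X.charge Q c := by
  have hR := charge_ge_of_real (Q := Q) hca hab ha
  by_cases hb : X.idx b = 0 <;> by_cases hc : X.idx c = 0
  · have := charge_ge_of_real (Q := Q) hab hbc hb
    have := charge_ge_of_real (Q := Q) hbc hca hc
    omega
  · have h1 := charge_ge_of_real (Q := Q) hab hbc hb
    have h2 := (charge_ge_of_single (Q := Q) hbc hca hb hc ha).2 (tri_of_face_eq hbc hca hab)
    have := hR.2 hb
    omega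
  · have h1 := charge_ge_of_real (Q := Q) hbc hca hc
    have h2 := (charge_ge_of_single (Q := Q) hab hbc ha hb hc).2 (tri_of_face_eq hab hbc hca)
    have := h1.2 ha
    omega
  · have h1 := (charge_ge_of_left (Q := Q) hab hbc ha hb hc).2
    have h2 := (charge_ge_of_right (Q := Q) hbc hca hb hc ha).2
    have h3 := X.side_of_tri ((X.inner_iff hbc).2 ⟨hb, hc⟩) (tri_of_face_eq hbc hca hab)
    omega

lemma charge_four (hQ : X.IsSpecial Q) {a b c d : D} (hab : M.face ρ a = b)
    (hbc : M.face ρ b = c) (hcd : M.face ρ c = d) (hda : M.face ρ d = a) (ha : X.idx a = 0) :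
    400 ≤ X.charge Q a + X.charge Q b + X.charge Q c + X.charge Q d := by
  have hR := charge_ge_of_real (Q := Q) hda hab ha
  have hB := charge_ge hQ hab
  have hC := charge_ge hQ hbc
  have hD := charge_ge hQ hcd
  by_cases hb : X.idx b = 0 <;> by_cases hc : X.idx c = 0 <;> by_cases hd : X.idx d = 0
  · have := charge_ge_of_real (Q := Q) hab hbc hb
    have := charge_ge_of_real (Q := Q) hbc hcd hc
    omega
  · have := charge_ge_of_real (Q := Q) hab hbc hb
    have := charge_ge_of_real (Q := Q) hbc hcd hc
    omega
  · have := charge_ge_of_real (Q := Q) hab hbc hb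
    have := charge_ge_of_real (Q := Q) hcd hda hd
    omega
  · have := charge_ge_of_real (Q := Q) hab hbc hb
    have := charge_ge_of_left (Q := Q) hbc hcd hb hc hd
    omega
  · have := charge_ge_of_real (Q := Q) hbc hcd hc
    have := charge_ge_of_real (Q := Q) hcd hda hd
    omega
  · have := charge_ge_of_real (Q := Q) hbc hcd hc
    have := charge_ge_of_single (Q := Q) hab hbc ha hb hc
    have := charge_ge_of_single (Q := Q) hcd hda hc hd ha
    omega
  · have := (charge_ge_of_real (Q := Q) hcd hda hd).2 ha
    have := charge_ge_of_left (Q := Q) hab hbc ha hb hc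
    omega
  · have i1 := (X.inner_iff hbc).2 ⟨hb, hc⟩
    have i2 := (X.inner_iff hcd).2 ⟨hc, hd⟩
    have h2 := charge_ge_of_inner hQ hbc hcd hb hc hd
    have s1 := (X.side_ge b).1
    have s2 := (X.side_ge c).1
    have t1 := X.spec_nonneg Q b
    have t2 := X.spec_nonneg Q c
    subst hab hbc hcd
    have h1 := charge_left' hQ ha i1 i2
    have h3 := charge_right' hQ hb i2 (by rwa [hda])
    omega

lemma charge_five (hQ : X.IsSpecial Q) {a b c d e : D} (hab : M.face ρ a = b)
    (hbc : M.face ρ b = c) (hcd : M.face ρ c = d) (hde : M.face ρ d = e) (hea : M.face ρ e = a)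
    (ha : X.idx a = 0) :
    400 ≤ X.charge Q a + X.charge Q b + X.charge Q c + X.charge Q d + X.charge Q e := by
  have hR := charge_ge_of_real (Q := Q) hea hab ha
  have hB := charge_ge hQ hab
  have hC := charge_ge hQ hbc
  have hD := charge_ge hQ hcd
  have hE := charge_ge hQ hde
  by_cases hb : X.idx b = 0
  · have := charge_ge_of_real (Q := Q) hab hbc hb
    omega
  by_cases hc : X.idx c = 0
  · have := charge_ge_of_real (Q := Q) hbc hcd hc
    omega
  by_cases hd : X.idx d = 0
  · have := charge_ge_of_real (Q := Q) hcd hde hd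
    omega
  by_cases he : X.idx e = 0
  · have := charge_ge_of_real (Q := Q) hde hea he
    omega
  have i1 := (X.inner_iff hbc).2 ⟨hb, hc⟩
  have i2 := (X.inner_iff hcd).2 ⟨hc, hd⟩
  have i3 := (X.inner_iff hde).2 ⟨hd, he⟩
  have j1 := X.tri_add_apex_le b
  have j2 := X.tri_nonneg b
  have j3 := X.tri_add_apex_le d
  have j4 := X.tri_nonneg d
  subst hab hbc hcd hde
  have h1 := charge_left' hQ ha i1 i2
  have h3 := charge_right' hQ hc i3 (by rwa [hea])
  omega

lemma charge_six_le (hQ : X.IsSpecial Q) {d : D}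
    (hp : 6 ≤ Function.minimalPeriod (M.face ρ) d) (hd : X.idx d = 0) :
    400 ≤ ∑ i ∈ range (Function.minimalPeriod (M.face ρ) d), X.charge Q ((M.face ρ)^[i] d) := by
  obtain ⟨n, hn⟩ : ∃ n, Function.minimalPeriod (M.face ρ) d = n + 3 :=
    ⟨_, (Nat.sub_add_cancel (by omega)).symm⟩
  have hper : (M.face ρ)^[n + 3] d = d := by
    rw [← hn]; exact Function.isPeriodicPt_minimalPeriod _ _
  rw [hn] at hp ⊢
  set f : ℕ → D := fun i => (M.face ρ)^[i] d with hf
  have hs (i : ℕ) : M.face ρ (f i) = f (i + 1) := (Function.iterate_succ_apply' _ _ _).symm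
  have h0 : f 0 = d := rfl
  have hlast : f (n + 3) = f 0 := hper
  have hge (i : ℕ) : 38 ≤ X.charge Q (f i) := by
    rcases i with _ | i
    · rw [← hlast]; exact charge_ge hQ (hs _)
    · exact charge_ge hQ (hs i)
  have hc0 : 146 ≤ X.charge Q (f 0) :=
    (charge_ge_of_real ((hs (n + 2)).trans hlast) (hs 0) hd).1
  change 400 ≤ ∑ i ∈ range (n + 3), X.charge Q (f i)
  by_cases hreal : ∃ j < n + 3, j ≠ 0 ∧ X.idx (f j) = 0
  · obtain ⟨j, hj, hj0, hji⟩ := hreal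
    obtain ⟨k, rfl⟩ := Nat.exists_eq_succ_of_ne_zero hj0
    have hcj : 146 ≤ X.charge Q (f (k + 1)) := (charge_ge_of_real (hs k) (hs _) hji).1
    have h1 : ∑ i ∈ ({0, k + 1} : Finset ℕ), (X.charge Q (f i) - 38) ≤
        ∑ i ∈ range (n + 3), (X.charge Q (f i) - 38) := by
      refine sum_le_sum_of_subset_of_nonneg ?_ fun i _ _ => sub_nonneg.2 (hge i)
      simp only [insert_subset_iff, mem_range, singleton_subset_iff]
      omega
    rw [sum_pair (by omega), sum_sub_distrib, sum_const, card_range, nsmul_eq_mul] at h1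
    push_cast at h1
    omega
  · push Not at hreal
    have h1 : 73 ≤ X.charge Q (f 1) :=
      (charge_ge_of_left (hs 0) (hs 1) hd (hreal 1 (by omega) (by omega))
        (hreal 2 (by omega) (by omega))).1
    have h2 : 73 ≤ X.charge Q (f (n + 2)) :=
      (charge_ge_of_right (hs (n + 1)) (hs (n + 2)) (hreal _ (by omega) (by omega))
        (hreal _ (by omega) (by omega)) (by rw [hlast]; exact hd)).1
    have h3 : ∑ i ∈ range n, (38 : ℤ) ≤ ∑ i ∈ range n, X.charge Q (f (i + 1 + 1)) :=
      sum_le_sum fun i _ => hge _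
    rw [sum_range_succ, sum_range_succ', sum_range_succ']
    rw [sum_const, card_range, nsmul_eq_mul] at h3
    simp only [zero_add] at *
    omega

end CrossingMap

end RotMap

namespace RotMap

variable {V P D : Type*} {M : RotMap P D} {G : SimpleGraph V} {ρ : Equiv.Perm D}

namespace CrossingMap

variable {X : M.CrossingMap G ρ} {Q : Finset G.Dart}

variable (M ρ) in
open Classical in
/-- Indicator of darts whose opposite corner is in a triangle. -/
noncomputable def oppTri (d : D) : ℤ := if M.Tri ρ (ρ (ρ d)) then 1 else 0

lemma oppTri_nonneg (d : D) : 0 ≤ oppTri M ρ d ∧ oppTri M ρ d ≤ 1 := by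
  unfold oppTri; split_ifs <;> omega

lemma charge_ge_of_inner' (hQ : X.IsSpecial Q) {a b c : D} (hab : M.face ρ a = b)
    (hbc : M.face ρ b = c) (ha : X.idx a ≠ 0) (hb : X.idx b ≠ 0) (hc : X.idx c ≠ 0) :
    146 - 24 * oppTri M ρ b - 27 * (X.apex a + X.apex b) - 30 * (X.spec Q a + X.spec Q b) ≤
      X.charge Q b := by
  have h := charge_ge_of_inner hQ hab hbc ha hb hc
  have s1 := (X.side_ge a).1
  have s2 := (X.side_ge b).1
  unfold oppTri
  split_ifs with ht
  · omega
  · have := h.2.1 ht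
    omega

lemma apex_le_one (d : D) : X.apex d ≤ 1 := by
  have := X.tri_add_apex_le d
  have := X.tri_nonneg d
  omega

lemma apex_cases (d : D) : X.apex d = 0 ∨ M.Tri ρ (M.inv d) := by
  by_cases h : M.Tri ρ (M.inv d)
  · exact .inr h
  · exact .inl (if_neg fun h' => h h'.2)

lemma oppTri_cases (d : D) : oppTri M ρ d = 0 ∨ M.Tri ρ (ρ (ρ d)) := by
  by_cases h : M.Tri ρ (ρ (ρ d))
  · exact .inr h
  · exact .inl (if_neg h)

lemma snd_eq_fst' {a b c d : D} (hab : M.face ρ a = b) (hbc : M.face ρ b = c)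
    (hcd : M.face ρ c = d) (hb : X.idx b ≠ 0) (hc : X.idx c ≠ 0) (hd : X.idx d ≠ 0)
    (ht : M.Tri ρ (M.inv b)) : (X.arc a).snd = (X.arc c).fst := by
  subst hab hbc hcd
  exact X.snd_eq_fst hb ht hc hd

lemma adj_of_tri {a b c : D} (hab : M.face ρ a = b) (hbc : M.face ρ b = c)
    (ha : X.idx a ≠ 0) (hb : X.idx b ≠ 0) (hc : X.idx c ≠ 0) (ht : M.Tri ρ (ρ (ρ b))) :
    G.Adj (X.arc b).fst (X.arc a).snd := by
  subst hab hbc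
  exact X.adj_of_tri_sq ha hb hc ht

lemma ends_ne_of_face {a b : D} (hab : M.face ρ a = b) (hb : X.idx b ≠ 0) :
    (X.arc b).fst ≠ (X.arc a).snd ∧ (X.arc b).fst ≠ (X.arc a).fst ∧
    (X.arc b).snd ≠ (X.arc a).snd ∧ (X.arc b).snd ≠ (X.arc a).fst := by
  subst hab
  exact X.ends_ne_face (X.idx_face_eq_zero.not.1 hb)

lemma apex_opposite_le {a b c d : D} (hab : M.face ρ a = b) (hbc : M.face ρ b = c)
    (hcd : M.face ρ c = d) (hda : M.face ρ d = a) (ha : X.idx a ≠ 0) (hb : X.idx b ≠ 0)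
    (hc : X.idx c ≠ 0) (hd : X.idx d ≠ 0) : X.apex b + X.apex d ≤ 1 := by
  have l1 := X.apex_le_one b
  have l2 := X.apex_le_one d
  rcases X.apex_cases b with h1 | h1
  · omega
  rcases X.apex_cases d with h2 | h2
  · omega
  exfalso
  have e1 := X.snd_eq_fst' hab hbc hcd hb hc hd h1
  have e2 := X.snd_eq_fst' hcd hda hab hd ha hb h2
  have ia := ((X.inner_iff hab).2 ⟨ha, hb⟩).2
  have ib := ((X.inner_iff hbc).2 ⟨hb, hc⟩).2
  have ic := ((X.inner_iff hcd).2 ⟨hc, hd⟩).2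
  rcases X.eq_or_eq_inv_of_inner hc ic ha ia
    (.inr (SimpleGraph.Dart.ext _ _ (Prod.ext e1.symm e2))) with h | h
  · rw [h] at e2
    exact (X.arc a).adj.ne e2.symm
  · exact X.face_ne_inv ia hb (by rwa [hab]) (hbc.trans h)

lemma apex_adjacent_le
    (hC : ∀ a b c d, G.Adj a b → G.Adj b c → G.Adj c d → G.Adj d a → a = c ∨ b = d)
    {a b c d : D} (hab : M.face ρ a = b) (hbc : M.face ρ b = c)
    (hcd : M.face ρ c = d) (hda : M.face ρ d = a) (ha : X.idx a ≠ 0) (hb : X.idx b ≠ 0)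
    (hc : X.idx c ≠ 0) (hd : X.idx d ≠ 0) :
    X.apex a + X.apex b + oppTri M ρ a + oppTri M ρ c ≤ 3 := by
  have l1 := X.apex_le_one a
  have l2 := X.apex_le_one b
  have l3 := oppTri_nonneg (M := M) (ρ := ρ) a
  have l4 := oppTri_nonneg (M := M) (ρ := ρ) c
  rcases X.apex_cases a with h1 | h1
  · omega
  rcases X.apex_cases b with h2 | h2
  · omega
  rcases oppTri_cases (M := M) (ρ := ρ) a with h3 | h3
  · omega
  rcases oppTri_cases (M := M) (ρ := ρ) c with h4 | h4
  · omega
  exfalso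
  have e1 := X.snd_eq_fst' hda hab hbc ha hb hc h1
  have e2 := X.snd_eq_fst' hab hbc hcd hb hc hd h2
  have a1 := X.adj_of_tri hda hab hd ha hb h3
  have a2 := X.adj_of_tri hbc hcd hb hc hd h4
  have n := X.ends_ne_of_face hab hb
  rw [e1] at a1
  rw [← e2] at a2
  rcases hC _ _ _ _ a1 (X.arc b).adj a2.symm (X.arc a).adj.symm with h | h
  · exact n.2.2.2 h.symm
  · exact n.1 h

lemma apex_five_le (hC : ∀ a b c d, G.Adj a b → G.Adj b c → G.Adj c d → G.Adj d a → a = c ∨ b = d)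
    {a b c d e : D} (hab : M.face ρ a = b) (hbc : M.face ρ b = c)
    (hcd : M.face ρ c = d) (hde : M.face ρ d = e) (hea : M.face ρ e = a) (ha : X.idx a ≠ 0)
    (hb : X.idx b ≠ 0) (hc : X.idx c ≠ 0) (hd : X.idx d ≠ 0) (he : X.idx e ≠ 0) :
    X.apex a + X.apex d + oppTri M ρ c ≤ 2 := by
  have l1 := X.apex_le_one a
  have l2 := X.apex_le_one d
  have l3 := oppTri_nonneg (M := M) (ρ := ρ) c
  rcases X.apex_cases a with h1 | h1
  · omega
  rcases X.apex_cases d with h2 | h2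
  · omega
  rcases oppTri_cases (M := M) (ρ := ρ) c with h3 | h3
  · omega
  exfalso
  have e1 := X.snd_eq_fst' hea hab hbc ha hb hc h1
  have e2 := X.snd_eq_fst' hcd hde hea hd he ha h2
  have a1 := X.adj_of_tri hbc hcd hb hc hd h3
  have n := X.ends_ne_of_face hbc hc
  have a2 := (X.arc e).adj
  rw [e1, ← e2] at a2
  rcases hC _ _ _ _ (X.arc b).adj.symm a2.symm (X.arc c).adj.symm a1 with h | h
  · exact n.2.2.1 h.symm
  · exact n.2.1 h.symm

lemma inner_charge_three (hQ : X.IsSpecial Q) {a b c : D} (hab : M.face ρ a = b)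
    (hbc : M.face ρ b = c) (hca : M.face ρ c = a) (ha : X.idx a ≠ 0) (hb : X.idx b ≠ 0)
    (hc : X.idx c ≠ 0) (hspec : X.spec Q a + X.spec Q b + X.spec Q c ≤ 1) :
    400 ≤ X.charge Q a + X.charge Q b + X.charge Q c := by
  have h1 := X.side_of_tri ((X.inner_iff hab).2 ⟨ha, hb⟩) (tri_of_face_eq hab hbc hca)
  have h2 := X.side_of_tri ((X.inner_iff hbc).2 ⟨hb, hc⟩) (tri_of_face_eq hbc hca hab)
  have h3 := X.side_of_tri ((X.inner_iff hca).2 ⟨hc, ha⟩) (tri_of_face_eq hca hab hbc)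
  have c1 := (charge_ge_of_inner hQ hab hbc ha hb hc).1
  have c2 := (charge_ge_of_inner hQ hbc hca hb hc ha).1
  have c3 := (charge_ge_of_inner hQ hca hab hc ha hb).1
  omega

lemma inner_charge_four
    (hC : ∀ a b c d, G.Adj a b → G.Adj b c → G.Adj c d → G.Adj d a → a = c ∨ b = d)
    (hQ : X.IsSpecial Q) {a b c d : D} (hab : M.face ρ a = b)
    (hbc : M.face ρ b = c) (hcd : M.face ρ c = d) (hda : M.face ρ d = a) (ha : X.idx a ≠ 0)
    (hb : X.idx b ≠ 0) (hc : X.idx c ≠ 0) (hd : X.idx d ≠ 0)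
    (hspec : X.spec Q a + X.spec Q b + X.spec Q c + X.spec Q d ≤ 0) :
    400 ≤ X.charge Q a + X.charge Q b + X.charge Q c + X.charge Q d := by
  have c1 := charge_ge_of_inner' hQ hab hbc ha hb hc
  have c2 := charge_ge_of_inner' hQ hbc hcd hb hc hd
  have c3 := charge_ge_of_inner' hQ hcd hda hc hd ha
  have c4 := charge_ge_of_inner' hQ hda hab hd ha hb
  have o1 := X.apex_opposite_le hab hbc hcd hda ha hb hc hd
  have o2 := X.apex_opposite_le hbc hcd hda hab hb hc hd ha
  have p1 := apex_adjacent_le hC hab hbc hcd hda ha hb hc hd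
  have p2 := apex_adjacent_le hC hbc hcd hda hab hb hc hd ha
  have p3 := apex_adjacent_le hC hcd hda hab hbc hc hd ha hb
  have p4 := apex_adjacent_le hC hda hab hbc hcd hd ha hb hc
  have t1 := oppTri_nonneg (M := M) (ρ := ρ) a
  have t2 := oppTri_nonneg (M := M) (ρ := ρ) b
  have t3 := oppTri_nonneg (M := M) (ρ := ρ) c
  have t4 := oppTri_nonneg (M := M) (ρ := ρ) d
  have q1 := X.apex_nonneg a
  have q2 := X.apex_nonneg b
  have q3 := X.apex_nonneg c
  have q4 := X.apex_nonneg d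
  omega

lemma inner_charge_five
    (hC : ∀ a b c d, G.Adj a b → G.Adj b c → G.Adj c d → G.Adj d a → a = c ∨ b = d)
    (hQ : X.IsSpecial Q) {a b c d e : D} (hab : M.face ρ a = b)
    (hbc : M.face ρ b = c) (hcd : M.face ρ c = d) (hde : M.face ρ d = e) (hea : M.face ρ e = a)
    (ha : X.idx a ≠ 0) (hb : X.idx b ≠ 0) (hc : X.idx c ≠ 0) (hd : X.idx d ≠ 0)
    (he : X.idx e ≠ 0)
    (hspec : X.spec Q a + X.spec Q b + X.spec Q c + X.spec Q d + X.spec Q e ≤ 1) :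
    400 ≤ X.charge Q a + X.charge Q b + X.charge Q c + X.charge Q d + X.charge Q e := by
  have c1 := charge_ge_of_inner' hQ hab hbc ha hb hc
  have c2 := charge_ge_of_inner' hQ hbc hcd hb hc hd
  have c3 := charge_ge_of_inner' hQ hcd hde hc hd he
  have c4 := charge_ge_of_inner' hQ hde hea hd he ha
  have c5 := charge_ge_of_inner' hQ hea hab he ha hb
  have p1 := apex_five_le hC hab hbc hcd hde hea ha hb hc hd he
  have p2 := apex_five_le hC hbc hcd hde hea hab hb hc hd he ha
  have p3 := apex_five_le hC hcd hde hea hab hbc hc hd he ha hb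
  have p4 := apex_five_le hC hde hea hab hbc hcd hd he ha hb hc
  have p5 := apex_five_le hC hea hab hbc hcd hde he ha hb hc hd
  have q1 := X.apex_le_one a
  have q2 := X.apex_le_one b
  have q3 := X.apex_le_one c
  have q4 := X.apex_le_one d
  have q5 := X.apex_le_one e
  omega

lemma sum_face_shift {A : Type*} [AddCommGroup A] (φ : D → D) (d : D) (g : D → A) :
    ∑ i ∈ range (Function.minimalPeriod φ d), g (φ^[i + 1] d) =
      ∑ i ∈ range (Function.minimalPeriod φ d), g (φ^[i] d) := by
  have h := sum_range_succ (fun i => g (φ^[i] d)) (Function.minimalPeriod φ d)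
  rw [sum_range_succ', Function.iterate_minimalPeriod] at h
  exact add_right_cancel h

lemma inner_charge_six_le (hQ : X.IsSpecial Q) {d : D}
    (hp : 6 ≤ Function.minimalPeriod (M.face ρ) d) (hd : ∀ i, X.idx ((M.face ρ)^[i] d) ≠ 0)
    (h1 : ∑ i ∈ range (Function.minimalPeriod (M.face ρ) d), X.spec Q ((M.face ρ)^[i] d) ≤ 1)
    (h0 : Even (Function.minimalPeriod (M.face ρ) d) →
      ∑ i ∈ range (Function.minimalPeriod (M.face ρ) d), X.spec Q ((M.face ρ)^[i] d) ≤ 0) :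
    400 ≤ ∑ i ∈ range (Function.minimalPeriod (M.face ρ) d), X.charge Q ((M.face ρ)^[i] d) := by
  have h2 : ∑ i ∈ range (Function.minimalPeriod (M.face ρ) d),
      (68 - 30 * (X.spec Q ((M.face ρ)^[i] d) + X.spec Q ((M.face ρ)^[i + 1] d))) ≤
      ∑ i ∈ range (Function.minimalPeriod (M.face ρ) d), X.charge Q ((M.face ρ)^[i + 1] d) := by
    refine sum_le_sum fun i _ => ?_
    have := charge_ge_of_inner hQ (b := (M.face ρ)^[i + 1] d)
      (Function.iterate_succ_apply' _ _ _).symm (Function.iterate_succ_apply' _ _ _).symm (hd i)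
        (hd _) (hd _)
    have := (X.side_ge ((M.face ρ)^[i] d)).2
    have := (X.side_ge ((M.face ρ)^[i + 1] d)).2
    omega
  rw [sum_face_shift, sum_sub_distrib, ← mul_sum, sum_add_distrib,
    sum_face_shift (g := X.spec Q), sum_const, card_range, nsmul_eq_mul] at h2
  rcases Nat.lt_or_ge 6 (Function.minimalPeriod (M.face ρ) d) with h | h
  · omega
  · have h6 : Function.minimalPeriod (M.face ρ) d = 6 := by omega
    have := h0 (by rw [h6]; decide)
    omega

theorem sum_charge_ge
    (hC : ∀ a b c d, G.Adj a b → G.Adj b c → G.Adj c d → G.Adj d a → a = c ∨ b = d)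
    [Finite D] (hQ : X.IsSpecial Q) (hdeg : ∀ x, X.idx x = 0 → ρ x ≠ x)
    (hface : ∀ d, (∀ i, X.idx ((M.face ρ)^[i] d) ≠ 0) →
      ∑ i ∈ range (Function.minimalPeriod (M.face ρ) d), X.spec Q ((M.face ρ)^[i] d) ≤ 1 ∧
      (Even (Function.minimalPeriod (M.face ρ) d) →
        ∑ i ∈ range (Function.minimalPeriod (M.face ρ) d), X.spec Q ((M.face ρ)^[i] d) ≤ 0))
    (d : D) :
    400 ≤ ∑ i ∈ range (Function.minimalPeriod (M.face ρ) d), X.charge Q ((M.face ρ)^[i] d) := by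
  have hpos (d : D) : d ∈ Function.periodicPts (M.face ρ) :=
    (M.face ρ).injective.mem_periodicPts d
  have hinv (d : D) : ∑ i ∈ range (Function.minimalPeriod (M.face ρ) (M.face ρ d)),
      X.charge Q ((M.face ρ)^[i] (M.face ρ d)) =
      ∑ i ∈ range (Function.minimalPeriod (M.face ρ) d), X.charge Q ((M.face ρ)^[i] d) := by
    rw [Function.minimalPeriod_apply (hpos d), ← sum_face_shift]
    rfl
  have hinv' (d : D) (j : ℕ) :
      ∑ i ∈ range (Function.minimalPeriod (M.face ρ) ((M.face ρ)^[j] d)),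
      X.charge Q ((M.face ρ)^[i] ((M.face ρ)^[j] d)) =
      ∑ i ∈ range (Function.minimalPeriod (M.face ρ) d), X.charge Q ((M.face ρ)^[i] d) := by
    induction j with
    | zero => rfl
    | succ j ih => rw [Function.iterate_succ_apply', hinv, ih]
  have key (d : D) (h : X.idx d = 0 ∨ ∀ i, X.idx ((M.face ρ)^[i] d) ≠ 0) :
      400 ≤ ∑ i ∈ range (Function.minimalPeriod (M.face ρ) d),
        X.charge Q ((M.face ρ)^[i] d) := by
    have hper := Function.iterate_minimalPeriod (f := M.face ρ) (x := d)
    have hp0 := Function.minimalPeriod_pos_of_mem_periodicPts (hpos d)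
    rcases Nat.lt_or_ge 5 (Function.minimalPeriod (M.face ρ) d) with hp | hp
    · rcases h with h | h
      · exact charge_six_le hQ hp h
      · exact inner_charge_six_le hQ hp h (hface d h).1 (hface d h).2
    have hf := hface d
    generalize Function.minimalPeriod (M.face ρ) d = p at *
    interval_cases p
    · exact (X.face_ne d hper).elim
    · exact (X.face_face_ne hdeg d hper).elim
    · simp only [sum_range_succ, range_zero, sum_empty, zero_add] at hf ⊢
      rcases h with h | h
      · exact charge_three rfl rfl hper h
      · exact inner_charge_three hQ rfl rfl hper (h 0) (h 1) (h 2) (hf h).1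
    · simp only [sum_range_succ, range_zero, sum_empty, zero_add] at hf ⊢
      rcases h with h | h
      · exact charge_four hQ rfl rfl rfl hper h
      · exact inner_charge_four hC hQ rfl rfl rfl hper (h 0) (h 1) (h 2) (h 3)
          ((hf h).2 (by decide))
    · simp only [sum_range_succ, range_zero, sum_empty, zero_add] at hf ⊢
      rcases h with h | h
      · exact charge_five hQ rfl rfl rfl rfl hper h
      · exact inner_charge_five hC hQ rfl rfl rfl rfl hper (h 0) (h 1) (h 2) (h 3) (h 4) (hf h).1
  by_cases h : ∃ j, X.idx ((M.face ρ)^[j] d) = 0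
  · obtain ⟨j, hj⟩ := h
    rw [← hinv' d j]
    exact key _ (.inl hj)
  · exact key d (.inr (not_exists.1 h))

end CrossingMap

end RotMap

namespace RotMap

variable {V P D : Type*} {M : RotMap P D} {G : SimpleGraph V} {ρ : Equiv.Perm D}

namespace CrossingMap

variable {X : M.CrossingMap G ρ} {Q : Finset G.Dart}

lemma sum_transfer [Fintype D] : ∑ d, X.transfer d = 0 := by
  have h1 := Equiv.sum_comp (ρ * ρ) X.across
  have h2 := Equiv.sum_comp (ρ * ρ * ρ) X.toNext
  have h3 := Equiv.sum_comp ρ X.toPrev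
  simp only [Equiv.Perm.mul_apply] at h1 h2
  simp only [transfer, sum_add_distrib, sum_sub_distrib, h1, h2, h3, sub_self, add_zero]

open Classical in
lemma sum_base [Fintype D] : ∑ d, X.base d =
    146 * (univ.filter fun d => X.idx d = 0).card +
    30 * (univ.filter fun d => X.idx d = 0 ∧ X.idx (M.inv d) = 0).card +
    100 * (univ.filter fun d => X.idx d ≠ 0).card := by
  have h (d : D) : X.base d = 146 * (if X.idx d = 0 then 1 else 0) +
      30 * (if X.idx d = 0 ∧ X.idx (M.inv d) = 0 then 1 else 0) +
      100 * (if X.idx d ≠ 0 then 1 else 0) := by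
    unfold base
    by_cases h1 : X.idx d = 0 <;> by_cases h2 : X.idx (M.inv d) = 0 <;> simp [h1, h2]
  simp only [h, sum_add_distrib, ← mul_sum, sum_boole]

open Classical in
lemma le_sum_draw [Fintype D] (hQ : X.IsSpecial Q) : 30 * (Q.card : ℤ) ≤ ∑ d, X.draw Q d := by
  have e1 : ∑ d, X.draw Q d = 30 * (∑ d, (if X.Inner d ∧ X.Inner (ρ d) then X.spec Q d else 0) +
      ∑ d, (if X.Inner (ρ.symm d) ∧ X.Inner d then X.spec Q d else 0)) := by
    rw [← Equiv.sum_comp ρ fun d => if X.Inner (ρ.symm d) ∧ X.Inner d then X.spec Q d else 0]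
    simp only [Equiv.symm_apply_apply, ← sum_add_distrib, mul_sum]
    refine sum_congr rfl fun d _ => ?_
    unfold draw
    split_ifs <;> simp
  rw [e1, ← sum_add_distrib]
  have h1 (d : D) : (if X.Inner d ∧ X.arc d ∈ Q then 1 else 0) ≤
      (if X.Inner d ∧ X.Inner (ρ d) then X.spec Q d else 0) +
      (if X.Inner (ρ.symm d) ∧ X.Inner d then X.spec Q d else 0) := by
    by_cases hd : X.Inner d ∧ X.arc d ∈ Q
    · have hs : X.spec Q d = 1 := if_pos hd.2
      have h3 : ρ (ρ (ρ d)) = ρ.symm d := by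
        rw [Equiv.eq_symm_apply, X.sq_sq hd.1.1]
      have hi : X.Inner (ρ d) ∨ X.Inner (ρ.symm d) := by
        refine (hQ.inner_or hd.1.1 hd.2).imp (fun h => ⟨X.idx_next hd.1.1, h⟩) fun h => ?_
        rw [← h3]
        exact ⟨X.idx_next (X.idx_sq_ne hd.1.1), h⟩
      rw [if_pos hd, hs]
      rcases hi with hi | hi
      · rw [if_pos ⟨hd.1, hi⟩]
        split_ifs <;> omega
      · rw [if_pos (c := X.Inner (ρ.symm d) ∧ X.Inner d) ⟨hi, hd.1⟩]
        split_ifs <;> omega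
    · rw [if_neg hd]
      have := X.spec_nonneg Q d
      split_ifs <;> omega
  have h2 := sum_le_sum fun d (_ : d ∈ univ) => h1 d
  rw [sum_boole] at h2
  have h3 : Q.card ≤ (univ.filter fun d => X.Inner d ∧ X.arc d ∈ Q).card := by
    refine card_le_card_of_surjOn X.arc fun g hg => ?_
    have hn := hQ.num_eq' g hg
    obtain ⟨x, hx, hi⟩ := X.exists_eq (g := g) (i := 1) (by omega)
    have := X.idx_inv x
    rw [hx, hn] at this
    refine ⟨x, mem_coe.2 (mem_filter.2 ⟨mem_univ _, ⟨?_, ?_⟩, by rwa [hx]⟩), hx⟩ <;> omega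
  have h4 : (Q.card : ℤ) ≤ (univ.filter fun d => X.Inner d ∧ X.arc d ∈ Q).card := by
    exact_mod_cast h3
  omega

lemma next_ne {d : D} (h : X.idx d ≠ 0) : ρ d ≠ d := fun h' => by
  have := (X.ends_ne h).1
  rw [h'] at this
  exact this rfl

lemma sq_ne {d : D} (h : X.idx d ≠ 0) : ρ (ρ d) ≠ d := fun h' => by
  have := X.arc_sq h
  rw [h'] at this
  exact (X.arc d).symm_ne this.symm

open Classical in
lemma four_mul_card_le [Fintype D] :
    4 * ((univ.filter fun d => X.idx d ≠ 0).image M.src).card ≤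
      (univ.filter fun d => X.idx d ≠ 0).card := by
  rw [card_eq_sum_card_image M.src (univ.filter fun d => X.idx d ≠ 0), mul_comm, ← smul_eq_mul]
  refine card_nsmul_le_sum _ _ _ fun p hp => ?_
  obtain ⟨d, hd, rfl⟩ := mem_image.1 hp
  replace hd := (mem_filter.1 hd).2
  have n1 := X.next_ne hd
  have n2 := X.sq_ne hd
  have n3 := X.next_ne (X.idx_next hd)
  have n4 := X.sq_ne (X.idx_next hd)
  have n5 := X.next_ne (X.idx_sq_ne hd)
  have n6 : ρ (ρ (ρ d)) ≠ d := fun h => n1 (by rw [← h, X.sq_sq hd, h])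
  have hcard : ({d, ρ d, ρ (ρ d), ρ (ρ (ρ d))} : Finset D).card = 4 := by
    rw [card_insert_of_notMem, card_insert_of_notMem, card_pair n5.symm] <;>
    simp [n1.symm, n2.symm, n3.symm, n4.symm, n6.symm]
  rw [← hcard]
  refine card_le_card fun x hx => ?_
  have s (d : D) : M.src (ρ d) = M.src d := X.isRotation.1 d
  simp only [mem_insert, mem_singleton] at hx
  rcases hx with rfl | rfl | rfl | rfl
  · simpa using hd
  · simpa [s] using X.idx_next hd
  · simpa [s] using X.idx_sq_ne hd
  · simpa [s] using X.idx_next (X.idx_sq_ne hd)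

open Classical in
lemma card_image_src_le [Fintype D] [Fintype V] :
    4 * (univ.image M.src).card ≤
      4 * Fintype.card V + (univ.filter fun d => X.idx d ≠ 0).card := by
  have h : univ.image M.src ⊆
      univ.image X.pos ∪ (univ.filter fun d => X.idx d ≠ 0).image M.src := by
    intro p hp
    obtain ⟨d, -, rfl⟩ := mem_image.1 hp
    by_cases hd : X.idx d = 0
    · rw [X.src_eq hd]
      exact mem_union_left _ (mem_image_of_mem _ (mem_univ _))
    · exact mem_union_right _ (mem_image_of_mem _ (by simpa using hd))
  have h1 := (card_le_card h).trans (card_union_le _ _)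
  have h2 : (univ.image X.pos).card ≤ Fintype.card V := card_image_le
  have := X.four_mul_card_le
  omega

open Classical in
/-- The discharging inequality. -/
theorem card_dart_le [Fintype D] [Nonempty D] [Fintype V] (hM : M.IsPlanar)
    (hC : ∀ a b c d, G.Adj a b → G.Adj b c → G.Adj c d → G.Adj d a → a = c ∨ b = d)
    (hQ : X.IsSpecial Q) (hdeg : ∀ x, X.idx x = 0 → ρ x ≠ x)
    (hface : ∀ d, (∀ i, X.idx ((M.face ρ)^[i] d) ≠ 0) →
      ∑ i ∈ range (Function.minimalPeriod (M.face ρ) d), X.spec Q ((M.face ρ)^[i] d) ≤ 1 ∧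
      (Even (Function.minimalPeriod (M.face ρ) d) →
        ∑ i ∈ range (Function.minimalPeriod (M.face ρ) d), X.spec Q ((M.face ρ)^[i] d) ≤ 0)) :
    54 * Fintype.card G.Dart + 30 * Q.card + 400 ≤
      400 * Fintype.card V + 30 * (univ.filter fun g => X.num g = 0).card := by
  have h1 := mul_card_cycles_le (M.face ρ) (fun d => (X.charge Q d : ℚ)) 400 fun d => by
    exact_mod_cast sum_charge_ge hC hQ hdeg hface d
  have h2 := hM.euler X.isRotation
  generalize Nat.card (Quotient (Equiv.Perm.SameCycle.setoid (M.face ρ))) = F at h1 h2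
  replace h1 : 400 * (F : ℤ) ≤ ∑ d, X.charge Q d := by exact_mod_cast h1
  have h3 : ∑ d, X.charge Q d = ∑ d, X.base d - ∑ d, X.draw Q d := by
    simp only [charge, sum_add_distrib, sum_sub_distrib, sum_transfer, Equiv.sum_comp ρ X.side]
    ring
  have h4 := X.sum_base
  have h5 := le_sum_draw hQ
  have h6 := X.card_image_src_le
  have h7 : Fintype.card D = (univ.filter fun d => X.idx d = 0).card +
      (univ.filter fun d => X.idx d ≠ 0).card := by
    rw [card_filter_add_card_filter_not, card_univ]
  have h8 : Fintype.card G.Dart ≤ (univ.filter fun d => X.idx d = 0).card := by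
    refine card_le_card_of_surjOn X.arc fun g _ => ?_
    obtain ⟨x, hx, hi⟩ := X.exists_eq (g := g) (i := 0) (by omega)
    exact ⟨x, by simpa using hi, hx⟩
  have h9 : (univ.filter fun d => X.idx d = 0 ∧ X.idx (M.inv d) = 0).card ≤
      (univ.filter fun g => X.num g = 0).card := by
    refine card_le_card_of_injOn X.arc (fun d hd => ?_) fun x hx y hy h => ?_
    · simp only [coe_filter, mem_univ, true_and, Set.mem_ofPred_eq] at hd ⊢
      rw [← X.idx_inv, hd.1, hd.2]
    · simp only [coe_filter, mem_univ, true_and, Set.mem_ofPred_eq] at hx hy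
      exact X.ext h (by rw [hx.1, hy.1])
  have h2' : Fintype.card D + 2 ≤ 2 * (univ.image M.src).card + 2 * F := by convert h2
  omega

end CrossingMap

end RotMap

namespace RotMap

variable {V P D : Type*} {M : RotMap P D} {G : SimpleGraph V} {ρ : Equiv.Perm D}

namespace CrossingMap

variable (X : M.CrossingMap G ρ)

/-- A colouring of the edges outside `Q` in which crossing edges have different colours. -/
structure IsColoring (c : G.Dart → Bool) (Q : Finset G.Dart) : Prop where
  color_symm : ∀ g, c g.symm = c g
  symm : ∀ g ∈ Q, g.symm ∈ Q
  ne : ∀ x, X.idx x ≠ 0 → X.arc x ∉ Q → X.arc (ρ x) ∉ Q → c (X.arc x) ≠ c (X.arc (ρ x))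

/-- A colouring with the fewest uncoloured edges. -/
structure IsMinColoring (c : G.Dart → Bool) (Q : Finset G.Dart) : Prop
    extends X.IsColoring c Q where
  card_le : ∀ c' Q', X.IsColoring c' Q' → Q.card ≤ Q'.card

lemma exists_isMinColoring [Fintype G.Dart] : ∃ c Q, X.IsMinColoring c Q := by
  classical
  have h : ∃ n, ∃ c Q, X.IsColoring c Q ∧ Q.card = n :=
    ⟨_, fun _ => false, univ, ⟨fun _ => rfl, by simp, by simp⟩, rfl⟩
  obtain ⟨c, Q, hc, hn⟩ := Nat.find_spec h
  exact ⟨c, Q, hc, fun c' Q' h' => hn ▸ Nat.find_min' h ⟨c', Q', h', rfl⟩⟩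

variable {X} {c : G.Dart → Bool} {Q : Finset G.Dart}

open Classical in
/-- Every uncoloured edge crosses edges of both colours. -/
lemma IsMinColoring.exists_color (h : X.IsMinColoring c Q) {q : G.Dart} (hq : q ∈ Q) (b : Bool) :
    ∃ x, X.idx x ≠ 0 ∧ X.arc x = q ∧ X.arc (ρ x) ∉ Q ∧ c (X.arc (ρ x)) = b := by
  by_contra! hb
  have hne {x : D} (hx : X.idx x ≠ 0) (hxq : X.arc x = q ∨ X.arc x = q.symm) :
      X.arc (ρ x) ≠ q ∧ X.arc (ρ x) ≠ q.symm := by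
    have := X.ends_ne hx
    constructor <;> rintro h' <;> rcases hxq with h'' | h'' <;> simp_all
  have key {x : D} (hx : X.idx x ≠ 0) (hxq : X.arc x = q ∨ X.arc x = q.symm)
      (hn : X.arc (ρ x) ∉ Q) : c (X.arc (ρ x)) ≠ b := by
    rcases hxq with hxq | hxq
    · exact hb x hx hxq hn
    · have e1 : X.arc (ρ (ρ (ρ x))) = (X.arc (ρ x)).symm := X.arc_sq (X.idx_next hx)
      have := hb (ρ (ρ x)) (X.idx_sq_ne hx) (by rw [X.arc_sq hx, hxq, SimpleGraph.Dart.symm_symm])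
        (by rw [e1]; exact fun h' => hn (by simpa using h.symm _ h'))
      rwa [e1, h.color_symm] at this
  have hcol : X.IsColoring (fun g => if g = q ∨ g = q.symm then b else c g)
      ((Q.erase q).erase q.symm) := by
    refine ⟨fun g => ?_, fun g hg => ?_, fun x hx h1 h2 => ?_⟩
    · have : (g.symm = q ∨ g.symm = q.symm) ↔ (g = q ∨ g = q.symm) := by
        rw [SimpleGraph.Dart.symm_involutive.eq_iff,
          SimpleGraph.Dart.symm_involutive.injective.eq_iff, or_comm]
      simp only [this, h.color_symm]
    · simp only [mem_erase] at hg ⊢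
      refine ⟨fun h' => hg.2.1 ?_, fun h' => hg.1 ?_, h.symm _ hg.2.2⟩
      · exact SimpleGraph.Dart.symm_involutive.injective h'
      · rw [← h', SimpleGraph.Dart.symm_symm]
    · simp only [mem_erase, not_and] at h1 h2
      by_cases hxq : X.arc x = q ∨ X.arc x = q.symm
      · have hn := hne hx hxq
        rw [if_pos hxq, if_neg (by tauto)]
        exact (key hx hxq (h2 hn.2 hn.1)).symm
      by_cases hyq : X.arc (ρ x) = q ∨ X.arc (ρ x) = q.symm
      · have e1 := X.arc_sq hx
        have h1' := h1 (fun h' => hxq (.inr h')) (fun h' => hxq (.inl h'))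
        have := key (X.idx_next hx) hyq
          (by rw [e1]; exact fun h' => h1' (by simpa using h.symm _ h'))
        rw [if_neg hxq, if_pos hyq]
        rwa [e1, h.color_symm] at this
      · rw [if_neg hxq, if_neg hyq]
        exact h.ne x hx (h1 (fun h' => hxq (.inr h')) (fun h' => hxq (.inl h')))
          (h2 (fun h' => hyq (.inr h')) (fun h' => hyq (.inl h')))
  have h1 := h.card_le _ _ hcol
  have h2 : ((Q.erase q).erase q.symm).card ≤ (Q.erase q).card := card_erase_le
  rw [card_erase_of_mem hq] at h2
  have := card_pos.2 ⟨q, hq⟩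
  omega

lemma num_eq_two_of_ne {x y : D} (hx : X.idx x ≠ 0) (hy : X.idx y ≠ 0) (h : X.arc x = X.arc y)
    (hne : x ≠ y) : X.num (X.arc x) = 2 ∧ ∀ z, X.idx z ≠ 0 → X.arc z = X.arc x → z = x ∨ z = y := by
  have h1 : X.idx x ≠ X.idx y := fun h' => hne (X.ext h h')
  have h2 := X.num_le (X.arc x)
  have h3 := X.idx_le x
  have h4 := X.idx_le y
  rw [← h] at h4
  refine ⟨by omega, fun z hz hzx => ?_⟩
  have h5 := X.idx_le z
  rw [hzx] at h5
  have : X.idx z = X.idx x ∨ X.idx z = X.idx y := by omega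
  exact this.imp (fun h' => X.ext hzx h') fun h' => X.ext (hzx.trans h) h'

lemma IsMinColoring.color_ne (h : X.IsMinColoring c Q) {q : G.Dart} (hq : q ∈ Q) :
    X.num q = 2 ∧ ∀ x, X.idx x ≠ 0 → X.arc x = q → X.arc (ρ x) ∉ Q ∧
      ∃ y, X.idx y ≠ 0 ∧ X.arc y = q ∧ x ≠ y ∧ c (X.arc (ρ x)) ≠ c (X.arc (ρ y)) := by
  obtain ⟨y, hy, hyq, hyn, hyc⟩ := h.exists_color hq false
  obtain ⟨z, hz, hzq, hzn, hzc⟩ := h.exists_color hq true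
  have hyz : y ≠ z := by rintro rfl; simp [hyc] at hzc
  have := X.num_eq_two_of_ne hy hz (hyq.trans hzq.symm) hyz
  rw [hyq] at this
  refine ⟨this.1, fun x hx hxq => ?_⟩
  rcases this.2 x hx hxq with rfl | rfl
  · exact ⟨hyn, z, hz, hzq, hyz, by simp [hyc, hzc]⟩
  · exact ⟨hzn, y, hy, hyq, hyz.symm, by simp [hyc, hzc]⟩

open Classical in
lemma IsMinColoring.isSpecial (h : X.IsMinColoring c Q) : X.IsSpecial Q where
  symm := h.symm
  notMem x hx hxq := ((h.color_ne hxq).2 x hx rfl).1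
  num_eq' g hg := (h.color_ne hg).1
  num_eq x hx hxq := by
    by_contra hnum
    obtain ⟨hxn, y, hy, hyx, hxy, hc⟩ := (h.color_ne hxq).2 x hx rfl
    set r := X.arc (ρ x) with hr
    have hr1 : ∀ z, X.idx z ≠ 0 → X.arc z = r → z = ρ x := by
      intro z hz hzr
      by_contra hne
      exact hnum ((X.num_eq_two_of_ne (X.idx_next hx) hz hzr.symm (Ne.symm hne)).1)
    have hQ' {z : D} (hz : X.idx z ≠ 0) (hzr : X.arc z = r ∨ X.arc z = r.symm) :
        X.arc (ρ z) ∈ Q := by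
      rcases hzr with hzr | hzr
      · rw [hr1 z hz hzr, X.arc_sq hx]
        exact h.symm _ hxq
      · have h1 := hr1 (ρ (ρ z)) (X.idx_sq_ne hz)
          (by rw [X.arc_sq hz, hzr, SimpleGraph.Dart.symm_symm])
        have h2 : ρ z = x := by
          have := congrArg ρ (congrArg ρ h1)
          rw [X.sq_sq hz] at this
          rw [this, X.sq_sq hx]
        rwa [h2]
    have hcol : X.IsMinColoring (fun g => if g = r ∨ g = r.symm then !c g else c g) Q := by
      refine ⟨⟨fun g => ?_, h.symm, fun z hz h1 h2 => ?_⟩, h.card_le⟩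
      · have : (g.symm = r ∨ g.symm = r.symm) ↔ (g = r ∨ g = r.symm) := by
          rw [SimpleGraph.Dart.symm_involutive.eq_iff,
            SimpleGraph.Dart.symm_involutive.injective.eq_iff, or_comm]
        simp only [this, h.color_symm]
      · have n1 : ¬ (X.arc z = r ∨ X.arc z = r.symm) := fun h' => h2 (hQ' hz h')
        have n2 : ¬ (X.arc (ρ z) = r ∨ X.arc (ρ z) = r.symm) := fun h' => h1 (by
          have := hQ' (X.idx_next hz) h'
          rw [X.arc_sq hz] at this
          simpa using h.symm _ this)
        rw [if_neg n1, if_neg n2]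
        exact h.ne z hz h1 h2
    obtain ⟨-, z, hz, hzx, hxz, hc'⟩ := (hcol.color_ne hxq).2 x hx rfl
    have hzy : z = y :=
      ((X.num_eq_two_of_ne hx hy hyx.symm hxy).2 z hz hzx).resolve_left hxz.symm
    subst hzy
    have hn : ¬ (X.arc (ρ z) = r ∨ X.arc (ρ z) = r.symm) := fun h' =>
      hxz (X.eq_of_arc_eq hx hz hyx.symm (h'.imp Eq.symm fun h' => by rw [h']; simp [hr]))
    rw [if_pos (.inl hr.symm), if_neg hn] at hc'
    revert hc hc'
    rw [← hr]
    cases c r <;> cases c (X.arc (ρ z)) <;> simp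

end CrossingMap

end RotMap

namespace RotMap

variable {V P D : Type*} {M : RotMap P D} {G : SimpleGraph V} {ρ : Equiv.Perm D}

namespace CrossingMap

variable {X : M.CrossingMap G ρ} {c : G.Dart → Bool} {Q : Finset G.Dart}

/-- The edge of `g` lies on the boundary of the face of `d`. -/
def OnFace (X : M.CrossingMap G ρ) (d : D) (g : G.Dart) (i : ℕ) : Prop :=
  g = X.arc ((M.face ρ)^[i] d) ∨ g = (X.arc ((M.face ρ)^[i] d)).symm

lemma OnFace.symm {d : D} {g : G.Dart} {i : ℕ} (h : X.OnFace d g i) : X.OnFace d g.symm i :=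
  Or.symm (Or.imp (fun h => by rw [h]) (fun h => by rw [h, SimpleGraph.Dart.symm_symm]) h)

lemma inner_iterate {d : D} (hd : ∀ i, X.idx ((M.face ρ)^[i] d) ≠ 0) (i : ℕ) :
    X.Inner ((M.face ρ)^[i] d) :=
  (X.inner_iff (Function.iterate_succ_apply' _ _ _).symm).2 ⟨hd i, hd (i + 1)⟩

lemma OnFace.index_eq {d : D} (hp : 0 < Function.minimalPeriod (M.face ρ) d)
    (hd : ∀ i, X.idx ((M.face ρ)^[i] d) ≠ 0) {g : G.Dart} {i j : ℕ}
    (hi : i < Function.minimalPeriod (M.face ρ) d) (hj : j < Function.minimalPeriod (M.face ρ) d)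
    (h : X.OnFace d g i) (h' : X.OnFace d g j) : i = j := by
  have h1 : X.arc ((M.face ρ)^[i] d) = X.arc ((M.face ρ)^[j] d) ∨
      X.arc ((M.face ρ)^[i] d) = (X.arc ((M.face ρ)^[j] d)).symm := by
    rcases h with h | h <;> rcases h' with h' | h' <;> rw [h] at h'
    · exact .inl h'
    · exact .inr h'
    · exact .inr (by rw [← h', SimpleGraph.Dart.symm_symm])
    · exact .inl (SimpleGraph.Dart.symm_involutive.injective h')
  rcases X.eq_or_eq_inv_of_inner (hd i) (X.inner_iterate hd i).2 (hd j)
    (X.inner_iterate hd j).2 h1 with h2 | h2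
  · exact Function.iterate_injOn_Iio_minimalPeriod hi hj h2
  · refine (X.face_ne_inv (X.inner_iterate hd j).2
      (hd (i + (Function.minimalPeriod (M.face ρ) d - 1)))
      (by rw [← Function.iterate_succ_apply' (M.face ρ)]; exact (X.inner_iterate hd (j + 1)).2)
      ?_).elim
    rw [← Function.iterate_succ_apply' (M.face ρ), ← h2, Nat.succ_eq_add_one, add_assoc,
      Nat.sub_add_cancel hp, Function.iterate_add_minimalPeriod_eq]

/-- The edges crossing an edge of a face without vertices. -/
lemma OnFace.next {d : D} (hp : 0 < Function.minimalPeriod (M.face ρ) d)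
    (hd : ∀ i, X.idx ((M.face ρ)^[i] d) ≠ 0) {x : D} {j : ℕ} (hx : X.idx x ≠ 0)
    (hj : j < Function.minimalPeriod (M.face ρ) d) (h : X.OnFace d (X.arc x) j) :
    ∃ k < Function.minimalPeriod (M.face ρ) d, X.OnFace d (X.arc (ρ x)) k ∧
      (k = j + 1 ∨ j = k + 1 ∨ (k = 0 ∧ j + 1 = Function.minimalPeriod (M.face ρ) d) ∨
        (j = 0 ∧ k + 1 = Function.minimalPeriod (M.face ρ) d)) := by
  wlog hxj : X.arc x = X.arc ((M.face ρ)^[j] d) generalizing x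
  · have h1 := h.resolve_left hxj
    have h2 : X.arc (ρ (ρ x)) = X.arc ((M.face ρ)^[j] d) := by
      rw [X.arc_sq hx, h1, SimpleGraph.Dart.symm_symm]
    obtain ⟨k, hk, hk1, hk2⟩ := this (X.idx_sq_ne hx) (.inl h2) h2
    refine ⟨k, hk, ?_, hk2⟩
    rw [X.arc_sq (X.idx_next hx)] at hk1
    simpa using hk1.symm
  have hs (i : ℕ) : ρ ((M.face ρ)^[i + 1] d) = M.inv ((M.face ρ)^[i] d) := by
    rw [Function.iterate_succ_apply', M.apply_face]
  have hper : (M.face ρ)^[Function.minimalPeriod (M.face ρ) d] d = d :=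
    Function.iterate_minimalPeriod
  have hin := X.inner_iterate hd j
  have hnum := X.num_of_inner hin.1 hin.2
  have hle := X.idx_le x
  rw [hxj, hnum.1] at hle
  rcases (show X.idx x = 1 ∨ X.idx x = 2 by omega) with h1 | h1
  · have hxe : x = (M.face ρ)^[j] d := X.ext hxj (by rw [h1, hnum.2])
    rcases j with _ | j
    · refine ⟨Function.minimalPeriod (M.face ρ) d - 1, by omega, .inr ?_, by omega⟩
      have := hs (Function.minimalPeriod (M.face ρ) d - 1)
      rw [Nat.sub_add_cancel hp, hper] at this
      rw [hxe, Function.iterate_zero_apply, this, X.arc_inv]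
    · refine ⟨j, by omega, .inr ?_, by omega⟩
      rw [hxe, hs, X.arc_inv]
  · have hxe : x = ρ (ρ (ρ ((M.face ρ)^[j + 1] d))) := by
      rw [hs]
      refine X.ext ?_ ?_
      · rw [X.arc_sq hin.2, X.arc_inv, hxj, SimpleGraph.Dart.symm_symm]
      · have e1 := X.idx_sq hin.2
        have e2 := X.idx_inv ((M.face ρ)^[j] d)
        rw [X.num_arc_inv] at e1
        omega
    have hρ : ρ x = (M.face ρ)^[j + 1] d := by rw [hxe, X.sq_sq (hd _)]
    rcases Nat.lt_or_ge (j + 1) (Function.minimalPeriod (M.face ρ) d) with hlt | hge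
    · exact ⟨j + 1, hlt, .inl (by rw [hρ]), by omega⟩
    · have hj1 : j + 1 = Function.minimalPeriod (M.face ρ) d := by omega
      refine ⟨0, hp, .inl ?_, by omega⟩
      rw [hρ, hj1, hper, Function.iterate_zero_apply]

open Classical in
/-- A face without vertices can be recoloured alternately. -/
lemma IsMinColoring.card_onFace_le (h : X.IsMinColoring c Q) {d : D}
    (hp : 0 < Function.minimalPeriod (M.face ρ) d)
    (hd : ∀ i, X.idx ((M.face ρ)^[i] d) ≠ 0) :
    (Q.filter fun g => ∃ i < Function.minimalPeriod (M.face ρ) d, X.OnFace d g i).card ≤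
      if Odd (Function.minimalPeriod (M.face ρ) d) then 2 else 0 := by
  set p := Function.minimalPeriod (M.face ρ) d with hpdef
  set F : G.Dart → Prop := fun g => ∃ i < p, X.OnFace d g i with hF
  set c' : G.Dart → Bool := fun g => if F g then decide (∃ i < p, X.OnFace d g i ∧ Odd i) else c g
    with hc'
  set R : Finset G.Dart := if Odd p then {X.arc d, (X.arc d).symm} else ∅ with hR
  have hFs {g : G.Dart} : F g.symm ↔ F g :=
    ⟨fun ⟨i, hi, h⟩ => ⟨i, hi, by simpa using h.symm⟩, fun ⟨i, hi, h⟩ => ⟨i, hi, h.symm⟩⟩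
  have hcF {g : G.Dart} {i : ℕ} (hi : i < p) (hg : X.OnFace d g i) : c' g = decide (Odd i) := by
    rw [hc']
    dsimp only
    rw [if_pos ⟨i, hi, hg⟩]
    refine decide_eq_decide.2 ⟨fun ⟨j, hj, hgj, ho⟩ => ?_, fun ho => ⟨i, hi, hg, ho⟩⟩
    rwa [hg.index_eq hp hd hi hj hgj]
  have hR0 {g : G.Dart} (hg : X.OnFace d g 0) (ho : Odd p) : g ∈ R := by
    rw [hR, if_pos ho]
    simpa [OnFace] using hg
  have hRs {g : G.Dart} (hg : g ∈ R) : g.symm ∈ R := by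
    rw [hR] at hg ⊢
    split_ifs at hg ⊢
    · simp only [mem_insert, mem_singleton] at hg ⊢
      rcases hg with rfl | rfl <;> simp
    · simp at hg
  have hnext {x : D} (hx : X.idx x ≠ 0) (hF : F (X.arc x)) : F (X.arc (ρ x)) := by
    obtain ⟨i, hi, hg⟩ := hF
    obtain ⟨k, hk, hk', -⟩ := hg.next hp hd hx hi
    exact ⟨k, hk, hk'⟩
  have hcol : X.IsColoring c' (Q.filter (fun g => ¬ F g) ∪ R) := by
    refine ⟨fun g => ?_, fun g hg => ?_, fun x hx h1 h2 => ?_⟩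
    · by_cases hg : F g
      · obtain ⟨i, hi, hg⟩ := hg
        rw [hcF hi hg, hcF hi hg.symm]
      · rw [hc']
        dsimp only
        rw [if_neg hg, if_neg (hFs.not.2 hg), h.color_symm]
    · rw [mem_union, mem_filter] at hg ⊢
      exact hg.imp (fun hg => ⟨h.symm _ hg.1, hFs.not.2 hg.2⟩) hRs
    · rw [mem_union, mem_filter, not_or, not_and, not_not] at h1 h2
      by_cases hg : F (X.arc x)
      · obtain ⟨i, hi, hg⟩ := hg
        obtain ⟨k, hk, hk', hik⟩ := hg.next hp hd hx hi
        rw [hcF hi hg, hcF hk hk', Ne, decide_eq_decide]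
        rcases hik with rfl | rfl | ⟨rfl, hip⟩ | ⟨rfl, hkp⟩
        · rw [Nat.odd_add_one]; tauto
        · rw [Nat.odd_add_one]; tauto
        · have : ¬ Odd p := fun ho => h2.2 (hR0 hk' ho)
          rw [← hpdef] at hip
          rw [← hip, Nat.odd_add_one, not_not] at this
          simpa using this
        · have : ¬ Odd p := fun ho => h1.2 (hR0 hg ho)
          rw [← hpdef] at hkp
          rw [← hkp, Nat.odd_add_one, not_not] at this
          simpa using this
      · have hg' : ¬ F (X.arc (ρ x)) := fun h' => by
          have := hnext (X.idx_next hx) h'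
          rw [X.arc_sq hx] at this
          exact hg (hFs.1 this)
        rw [hc']
        dsimp only
        rw [if_neg hg, if_neg hg']
        exact h.ne x hx (fun h' => hg (h1.1 h')) fun h' => hg' (h2.1 h')
  have h1 := (h.card_le _ _ hcol).trans (card_union_le _ _)
  have h2 := card_filter_add_card_filter_not (s := Q) F
  have h3 : R.card ≤ if Odd p then 2 else 0 := by
    rw [hR]
    split_ifs
    · exact card_le_two
    · simp
  change (Q.filter F).card ≤ _
  omega

lemma IsMinColoring.sum_spec_le (h : X.IsMinColoring c Q) [Finite D] {d : D}
    (hd : ∀ i, X.idx ((M.face ρ)^[i] d) ≠ 0) :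
    ∑ i ∈ range (Function.minimalPeriod (M.face ρ) d), X.spec Q ((M.face ρ)^[i] d) ≤ 1 ∧
    (Even (Function.minimalPeriod (M.face ρ) d) →
      ∑ i ∈ range (Function.minimalPeriod (M.face ρ) d), X.spec Q ((M.face ρ)^[i] d) ≤ 0) := by
  classical
  have hp := Function.minimalPeriod_pos_of_mem_periodicPts
    ((M.face ρ).injective.mem_periodicPts d)
  have h1 := h.card_onFace_le hp hd
  set p := Function.minimalPeriod (M.face ρ) d with hpdef
  set J := (range p).filter fun i => X.arc ((M.face ρ)^[i] d) ∈ Q with hI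
  have h2 : ∑ i ∈ range p, X.spec Q ((M.face ρ)^[i] d) = J.card := by
    rw [hI, ← sum_boole]
    refine sum_congr rfl fun i _ => ?_
    unfold spec
    congr
  set f : ℕ → G.Dart := fun i => X.arc ((M.face ρ)^[i] d) with hf
  have hlt {i : ℕ} (hi : i ∈ J) : i < p := mem_range.1 (mem_filter.1 hi).1
  have i1 : Set.InjOn f J := fun i hi j hj hij =>
    OnFace.index_eq hp hd (hlt hi) (hlt hj) (g := f i) (.inl rfl) (.inl hij)
  have i2 : Set.InjOn (fun i => (f i).symm) J := fun i hi j hj hij =>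
    i1 hi hj (SimpleGraph.Dart.symm_involutive.injective hij)
  have hdisj : Disjoint (J.image f) (J.image fun i => (f i).symm) := by
    rw [disjoint_left]
    rintro g hg hg'
    obtain ⟨i, hi, rfl⟩ := mem_image.1 hg
    obtain ⟨j, hj, hij⟩ := mem_image.1 hg'
    have : i = j := OnFace.index_eq hp hd (hlt hi) (hlt hj) (g := f i) (.inl rfl) (.inr hij.symm)
    subst this
    exact (f i).symm_ne hij
  have h3 : (J.image f ∪ J.image fun i => (f i).symm).card ≤
      (Q.filter fun g => ∃ i < p, X.OnFace d g i).card := by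
    refine card_le_card (union_subset ?_ ?_)
    · refine image_subset_iff.2 fun i hi => mem_filter.2 ⟨(mem_filter.1 hi).2, i, hlt hi, .inl rfl⟩
    · refine image_subset_iff.2 fun i hi =>
        mem_filter.2 ⟨h.symm _ (mem_filter.1 hi).2, i, hlt hi, .inr rfl⟩
  rw [card_union_of_disjoint hdisj, card_image_of_injOn i1, card_image_of_injOn i2] at h3
  have h4 := h3.trans h1
  rw [h2]
  constructor
  · split_ifs at h4 <;> omega
  · intro he
    rw [if_neg (Nat.not_odd_iff_even.2 he)] at h4
    omega

/-- Combination of the discharging inequality with the bound for edge sets without crossings. -/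
theorem card_dart_mul_le (X : M.CrossingMap G ρ) [Fintype D] [Nonempty D] [Fintype V]
    [Fintype G.Dart] (hM : M.IsPlanar)
    (hC : ∀ a b c d, G.Adj a b → G.Adj b c → G.Adj c d → G.Adj d a → a = c ∨ b = d)
    (hdeg : ∀ x, X.idx x = 0 → ρ x ≠ x)
    (hN : ∀ S : Finset G.Dart, (∀ g ∈ S, g.symm ∈ S) →
      (∀ x, X.idx x ≠ 0 → X.arc x ∈ S → X.arc (ρ x) ∉ S) → 7 * S.card ≤ 30 * Fintype.card V) :
    588 * Fintype.card G.Dart ≤ 4600 * Fintype.card V := by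
  classical
  obtain ⟨c, Q, h⟩ := X.exists_isMinColoring
  have hQ := h.isSpecial
  have h1 : 54 * Fintype.card G.Dart + 30 * Q.card + 400 ≤
      400 * Fintype.card V + 30 * (univ.filter fun g => X.num g = 0).card := by
    convert card_dart_le hM hC hQ hdeg fun d hd => h.sum_spec_le hd
  set S : Bool → Finset G.Dart := fun b => univ.filter fun g => X.num g = 0 ∨ (g ∉ Q ∧ c g = b)
    with hS
  have hmem {b : Bool} {g : G.Dart} : g ∈ S b ↔ X.num g = 0 ∨ (g ∉ Q ∧ c g = b) := by
    simp [hS]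
  have hSb (b : Bool) : 7 * (S b).card ≤ 30 * Fintype.card V := by
    refine hN _ (fun g hg => ?_) fun x hx h1 h2 => ?_
    · rw [hmem, X.num_symm, h.color_symm]
      exact (hmem.1 hg).imp_right (.imp_left fun hg hg' => hg (by simpa using h.symm _ hg'))
    · have n1 : X.num (X.arc x) ≠ 0 := fun h' => by
        have := X.idx_le x
        omega
      have n2 : X.num (X.arc (ρ x)) ≠ 0 := fun h' => by
        have := X.idx_le (ρ x)
        have := X.idx_next hx
        omega
      have m1 := (hmem.1 h1).resolve_left n1
      have m2 := (hmem.1 h2).resolve_left n2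
      exact h.ne x hx m1.1 m2.1 (m1.2.trans m2.2.symm)
  have h2 : (S false ∪ S true).card + (S false ∩ S true).card =
      (S false).card + (S true).card := card_union_add_card_inter _ _
  have h3 : Fintype.card G.Dart ≤ (S false ∪ S true).card + Q.card := by
    rw [← card_univ]
    refine (card_le_card fun g _ => ?_).trans (card_union_le _ _)
    by_cases hg : g ∈ Q
    · exact mem_union_right _ hg
    · refine mem_union_left _ (mem_union.2 ?_)
      rw [hmem, hmem]
      cases hcg : c g
      · exact .inl (.inr ⟨hg, rfl⟩)
      · exact .inr (.inr ⟨hg, rfl⟩)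
  have h4 : (univ.filter fun g => X.num g = 0).card ≤ (S false ∩ S true).card := by
    refine card_le_card fun g hg => ?_
    rw [mem_inter, hmem, hmem]
    exact ⟨.inl (mem_filter.1 hg).2, .inl (mem_filter.1 hg).2⟩
  have h5 := hSb false
  have h6 := hSb true
  omega

end CrossingMap

end RotMap

/-- A finite family of simple polygonal chains in the plane that meet only at their ends. -/
structure ChainSystem (J : Type*) where
  n : J → ℕ
  f : J → ℕ → ℝ × ℝ
  inj : ∀ {j a b}, a ≤ n j → b ≤ n j → f j a = f j b → a = b
  simple : ∀ {j a b}, a < b → b < n j → ∀ y ∈ segment ℝ (f j a) (f j (a + 1)),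
    y ∈ segment ℝ (f j b) (f j (b + 1)) → b = a + 1 ∧ y = f j b
  disj : ∀ {j k}, j ≠ k → ∀ a < n j, ∀ b < n k, ∀ y ∈ segment ℝ (f j a) (f j (a + 1)),
    y ∈ segment ℝ (f k b) (f k (b + 1)) → (y = f j 0 ∨ y = f j (n j)) ∧ (y = f k 0 ∨ y = f k (n k))

namespace ChainSystem

variable {J : Type*} (C : ChainSystem J)

variable {C}

lemma mem_segment {j : J} {m a : ℕ} (hm : m ≤ C.n j) (ha : a < C.n j)
    (h : C.f j m ∈ segment ℝ (C.f j a) (C.f j (a + 1))) : m = a ∨ m = a + 1 := by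
  rcases lt_trichotomy m a with h1 | rfl | h1
  · have h2 := C.simple h1 ha _ (left_mem_segment ℝ _ _) h
    exact .inl (C.inj hm ha.le h2.2)
  · exact .inl rfl
  · obtain ⟨m, rfl⟩ : ∃ m', m = m' + 1 := ⟨m - 1, by omega⟩
    rcases (Nat.lt_succ_iff.1 h1).eq_or_lt with rfl | h2
    · exact .inr rfl
    · have h3 := C.simple h2 (by omega) _ h (right_mem_segment ℝ _ _)
      have := C.inj hm (by omega) h3.2
      omega

lemma eq_or_eq_of_mem {j k : J} {a b : ℕ} (ha : a < C.n j) (hb : b < C.n k)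
    (hne : ¬ (j = k ∧ a = b)) {y : ℝ × ℝ} (h : y ∈ segment ℝ (C.f j a) (C.f j (a + 1)))
    (h' : y ∈ segment ℝ (C.f k b) (C.f k (b + 1))) : y = C.f j a ∨ y = C.f j (a + 1) := by
  by_cases hjk : j = k
  · subst hjk
    rcases Nat.lt_or_gt_of_ne (fun h => hne ⟨rfl, h⟩) with h1 | h1
    · obtain ⟨rfl, h3⟩ := C.simple h1 hb _ h h'
      exact .inr h3
    · exact .inl (C.simple h1 ha _ h' h).2
  · rcases (C.disj hjk a ha b hb y h h').1 with rfl | rfl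
    · exact (mem_segment (Nat.zero_le _) ha h).imp (fun h => by rw [h]) fun h => by rw [h]
    · exact (mem_segment le_rfl ha h).imp (fun h => congrArg _ h) fun h => congrArg _ h

lemma succ_ne {j : J} {a : ℕ} (ha : a < C.n j) : C.f j a ≠ C.f j (a + 1) := fun h => by
  have := C.inj ha.le ha h
  omega

lemma index_eq {j k : J} {a b : ℕ} (ha : a < C.n j) (hb : b < C.n k)
    (h : C.f j a ∈ segment ℝ (C.f k b) (C.f k (b + 1)))
    (h' : C.f j (a + 1) ∈ segment ℝ (C.f k b) (C.f k (b + 1))) : j = k ∧ a = b := by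
  by_contra hne
  have hm := midpoint_mem_segment (𝕜 := ℝ) (C.f j a) (C.f j (a + 1))
  rcases eq_or_eq_of_mem ha hb hne hm ((convex_segment _ _).segment_subset h h' hm) with h1 | h1
  · exact succ_ne ha ((midpoint_eq_left_iff ℝ).1 h1)
  · exact succ_ne ha ((midpoint_eq_right_iff ℝ).1 h1)

/-- The rotation system of a family of chains. -/
theorem exists_rotMap [Finite J] (C : ChainSystem J) :
    ∃ (D : Type) (_ : Fintype D) (M : RotMap (ℝ × ℝ) D) (dart : ∀ j, Fin (C.n j) → D),
      M.IsPlanar ∧ (∀ j i, M.src (dart j i) = C.f j i ∧ M.src (M.inv (dart j i)) = C.f j (i + 1)) ∧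
      (∀ d, ∃ j i, d = dart j i ∨ d = M.inv (dart j i)) ∧
      (∀ j i k i', dart j i = dart k i' → (⟨j, i⟩ : Σ j, Fin (C.n j)) = ⟨k, i'⟩) ∧
      ∀ j i k i', dart j i ≠ M.inv (dart k i') := by
  classical
  have := Fintype.ofFinite J
  let e : (Σ j, Fin (C.n j)) → (ℝ × ℝ) × (ℝ × ℝ) := fun x => (C.f x.1 x.2, C.f x.1 (x.2 + 1))
  have he {x y : Σ j, Fin (C.n j)} (h : e x = e y ∨ e x = (e y).swap) : x = y := by
    obtain ⟨j, i⟩ := x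
    obtain ⟨k, i'⟩ := y
    have h1 : C.f j i ∈ segment ℝ (C.f k i') (C.f k (i' + 1)) ∧
        C.f j (i + 1) ∈ segment ℝ (C.f k i') (C.f k (i' + 1)) := by
      simp only [e, Prod.swap_prod_mk, Prod.mk.injEq] at h
      rcases h with ⟨h, h'⟩ | ⟨h, h'⟩ <;> rw [h, h']
      · exact ⟨left_mem_segment _ _ _, right_mem_segment _ _ _⟩
      · exact ⟨right_mem_segment _ _ _, left_mem_segment _ _ _⟩
    obtain ⟨rfl, h2⟩ := index_eq i.2 i'.2 h1.1 h1.2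
    rw [Fin.ext h2]
  have hee (x : Σ j, Fin (C.n j)) : (e x).1 ≠ (e x).2 := succ_ne x.2.2
  let Γ : Finset ((ℝ × ℝ) × (ℝ × ℝ)) := univ.image e ∪ univ.image fun x => (e x).swap
  have hΓ {d} : d ∈ Γ ↔ ∃ x, d = e x ∨ d = (e x).swap := by
    simp only [Γ, mem_union, mem_image, mem_univ, true_and]
    constructor
    · rintro (⟨x, rfl⟩ | ⟨x, rfl⟩)
      · exact ⟨x, .inl rfl⟩
      · exact ⟨x, .inr rfl⟩
    · rintro ⟨x, rfl | rfl⟩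
      · exact .inl ⟨x, rfl⟩
      · exact .inr ⟨x, rfl⟩
  have hseg {d} {x : Σ j, Fin (C.n j)} (h : d = e x ∨ d = (e x).swap) :
      segment ℝ d.1 d.2 = segment ℝ (e x).1 (e x).2 := by
    rcases h with rfl | rfl
    · rfl
    · exact segment_symm _ _ _
  obtain ⟨M, h1, h2, h3⟩ := exists_planar_rotMap Γ (fun d hd => by
    obtain ⟨x, hx⟩ := hΓ.1 hd
    exact hΓ.2 ⟨x, hx.symm.imp (fun h => by rw [h, Prod.swap_swap]) fun h => by rw [h]⟩)
      (fun d hd => by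
    obtain ⟨x, rfl | rfl⟩ := hΓ.1 hd
    · exact hee x
    · exact (hee x).symm) (fun d hd d' hd' hne hne' q hq hq' => by
    obtain ⟨x, hx⟩ := hΓ.1 hd
    obtain ⟨y, hy⟩ := hΓ.1 hd'
    have hxy : ¬ (x.1 = y.1 ∧ (x.2 : ℕ) = y.2) := by
      rintro ⟨h3, h4⟩
      obtain ⟨j, i⟩ := x
      obtain ⟨k, i'⟩ := y
      obtain rfl : j = k := h3
      obtain rfl : i = i' := Fin.ext h4
      rcases hx with rfl | rfl <;> rcases hy with rfl | rfl <;> simp at hne hne'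
    rw [hseg hx] at hq
    rw [hseg hy] at hq'
    have k1 := eq_or_eq_of_mem x.2.2 y.2.2 hxy hq hq'
    have k2 := eq_or_eq_of_mem y.2.2 x.2.2 (fun h => hxy ⟨h.1.symm, h.2.symm⟩) hq' hq
    constructor
    · rcases hx with rfl | rfl
      · exact k1
      · exact k1.symm
    · rcases hy with rfl | rfl
      · exact k2
      · exact k2.symm)
  have hm (x) : e x ∈ Γ := hΓ.2 ⟨x, .inl rfl⟩
  have hinv (x) : M.inv ⟨e x, hm x⟩ = ⟨(e x).swap, hΓ.2 ⟨x, .inr rfl⟩⟩ := Subtype.ext (h2 _)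
  refine ⟨Γ, inferInstance, M, fun j i => ⟨e ⟨j, i⟩, hm _⟩, h3, fun j i => ⟨h1 _, ?_⟩,
    fun ⟨d, hd⟩ => ?_, fun j i k i' h => he (.inl (congrArg Subtype.val h)), fun j i k i' h => ?_⟩
  · rw [hinv, h1]
    rfl
  · obtain ⟨⟨j, i⟩, hx⟩ := hΓ.1 hd
    refine ⟨j, i, hx.imp (fun h => Subtype.ext h) fun h => ?_⟩
    rw [hinv]
    exact Subtype.ext h
  · rw [hinv] at h
    have h' : e ⟨j, i⟩ = (e ⟨k, i'⟩).swap := congrArg Subtype.val h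
    rw [he (.inr h')] at h'
    exact hee _ (congrArg Prod.fst h')

end ChainSystem

end

section

open Finset Set

lemma exists_times (T : Finset ℝ) (hT : ∀ t ∈ T, t ∈ Ioo (0 : ℝ) 1) :
    ∃ (k : ℕ) (τ : ℕ → ℝ), τ 0 = 0 ∧ τ (k + 1) = 1 ∧ (∀ i j, i < j → j ≤ k + 1 → τ i < τ j) ∧
      ∀ t ∈ T, ∃ i ≤ k, τ i = t := by
  classical
  have h0 : (0 : ℝ) ∉ insert 1 T := by
    simp only [Finset.mem_insert, zero_ne_one, false_or]
    exact fun h => (hT 0 h).1.false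
  have h1 : (1 : ℝ) ∉ T := fun h => (hT 1 h).2.false
  have hS : (insert 0 (insert 1 T)).card = T.card + 2 := by
    rw [card_insert_of_notMem h0, card_insert_of_notMem h1]
  set S := insert (0 : ℝ) (insert 1 T) with hSdef
  have hmem {t : ℝ} : t ∈ S ↔ t = 0 ∨ t = 1 ∨ t ∈ T := by simp [hSdef]
  have hle {t : ℝ} (ht : t ∈ S) : 0 ≤ t ∧ t ≤ 1 := by
    rcases hmem.1 ht with rfl | rfl | h
    · simp
    · simp
    · exact ⟨(hT _ h).1.le, (hT _ h).2.le⟩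
  let F := S.orderEmbOfFin hS
  let τ : ℕ → ℝ := fun i => if h : i < T.card + 2 then F ⟨i, h⟩ else 0
  have hτ (i : Fin (T.card + 2)) : τ i = F i := dif_pos i.2
  have hex {t : ℝ} (ht : t ∈ S) : ∃ i, F i = t := by
    have : t ∈ Set.range F := by rw [S.range_orderEmbOfFin hS]; exact ht
    exact this
  have t0 : τ 0 = 0 := by
    obtain ⟨i, hi⟩ := hex (hmem.2 (.inl rfl))
    have := hτ 0
    rw [Fin.val_zero] at this
    refine le_antisymm ?_ (hle (by rw [this]; exact S.orderEmbOfFin_mem hS _)).1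
    rw [this, ← hi]
    exact F.monotone (Fin.zero_le _)
  have t1 : τ (T.card + 1) = 1 := by
    obtain ⟨i, hi⟩ := hex (hmem.2 (.inr (.inl rfl)))
    have := hτ (Fin.last (T.card + 1))
    rw [Fin.val_last] at this
    refine le_antisymm (hle (by rw [this]; exact S.orderEmbOfFin_mem hS _)).2 ?_
    rw [this, ← hi]
    exact F.monotone (Fin.le_last _)
  refine ⟨T.card, τ, t0, t1, fun i j hij hj => ?_, fun t ht => ?_⟩
  · have a := hτ ⟨i, by omega⟩
    have b := hτ ⟨j, by omega⟩
    dsimp only at a b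
    rw [a, b]
    exact F.strictMono hij
  · obtain ⟨i, hi⟩ := hex (hmem.2 (.inr (.inr ht)))
    refine ⟨i, ?_, by rw [hτ, hi]⟩
    by_contra h
    have : (i : ℕ) = T.card + 1 := by have := i.2; omega
    rw [← hτ, this, t1] at hi
    exact h1 (hi ▸ ht)

namespace PlaneDrawing

variable {V : Type*} {G : SimpleGraph V} (D : PlaneDrawing G)

/-- The arc of a dart as a function of a real parameter. -/
noncomputable def curve (g : G.Dart) : ℝ → ℝ × ℝ := (D.arc g.adj).extend

variable {D}

lemma curve_zero (g : G.Dart) : D.curve g 0 = D.pos g.fst := Path.extend_zero _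

lemma curve_one (g : G.Dart) : D.curve g 1 = D.pos g.snd := Path.extend_one _

lemma curve_inj {g : G.Dart} {s t : ℝ} (hs : s ∈ Icc (0 : ℝ) 1) (ht : t ∈ Icc (0 : ℝ) 1)
    (h : D.curve g s = D.curve g t) : s = t := by
  unfold curve at h
  rw [Path.extend_apply _ hs, Path.extend_apply _ ht] at h
  exact congrArg Subtype.val (D.arc_inj g.adj h)

lemma isInteriorPoint_curve {g : G.Dart} {s : ℝ} (hs : s ∈ Ioo (0 : ℝ) 1) :
    D.IsInteriorPoint g.adj (D.curve g s) :=
  ⟨⟨s, hs.1.le, hs.2.le⟩, fun h => hs.1.ne' (congrArg Subtype.val h),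
    fun h => hs.2.ne (congrArg Subtype.val h),
    (Path.extend_apply _ ⟨hs.1.le, hs.2.le⟩).symm⟩

lemma curve_ne_pos {g : G.Dart} {s : ℝ} (hs : s ∈ Ioo (0 : ℝ) 1) (w : V) :
    D.curve g s ≠ D.pos w := fun h => by
  have hs' : s ∈ Icc (0 : ℝ) 1 := ⟨hs.1.le, hs.2.le⟩
  have h' := h
  unfold curve at h'
  rw [Path.extend_apply _ hs'] at h'
  rcases D.no_vertex_mem g.adj w _ h' with rfl | rfl
  · rw [← curve_zero] at h
    exact hs.1.ne' (curve_inj hs' (by simp) h)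
  · rw [← curve_one] at h
    exact hs.2.ne (curve_inj hs' (by simp) h)

lemma finite_edgeCrossings [Finite V] {u v : V} (h : G.Adj u v) : (D.edgeCrossings h).Finite := by
  have := Finite.of_injective (fun g : G.Dart => (g.fst, g.snd))
    fun a b hab => SimpleGraph.Dart.ext (a) (b) hab
  refine (Set.finite_iUnion fun g : {g : G.Dart // s(u, v) ≠ s(g.fst, g.snd)} =>
    D.finite_inter h g.1.adj g.2).subset ?_
  rintro p ⟨⟨t, -, -, ht⟩, x, y, h₂, hne, s, -, -, hs⟩
  exact mem_iUnion.2 ⟨⟨⟨(x, y), h₂⟩, hne⟩, ⟨t, ht⟩, ⟨s, hs⟩⟩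

/-- Polygonal approximation of a drawing. -/
theorem exists_chainSystem [Finite V] (D : PlaneDrawing G) (P : Set G.Dart)
    (hP : ∀ g ∈ P, ∀ h ∈ P, g ≠ h → g.edge ≠ h.edge) :
    ∃ (k : P → ℕ) (τ : P → ℕ → ℝ) (C : ChainSystem (Σ g : P, Fin (k g + 1))),
      (∀ g, τ g 0 = 0 ∧ τ g (k g + 1) = 1) ∧
      (∀ g i j, i < j → j ≤ k g + 1 → τ g i < τ g j) ∧
      ∀ x, C.f x 0 = D.curve x.1 (τ x.1 x.2) ∧ C.f x (C.n x) = D.curve x.1 (τ x.1 (x.2 + 1)) := by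
  classical
  have := Finite.of_injective (fun g : G.Dart => (g.fst, g.snd))
    fun a b hab => SimpleGraph.Dart.ext (a) (b) hab
  have hfin (g : G.Dart) : {t | t ∈ Ioo (0 : ℝ) 1 ∧ D.curve g t ∈ D.edgeCrossings g.adj}.Finite :=
    Set.Finite.of_finite_image ((D.finite_edgeCrossings g.adj).subset
      (image_subset_iff.2 fun t ht => ht.2)) fun s hs t ht h =>
        curve_inj ⟨hs.1.1.le, hs.1.2.le⟩ ⟨ht.1.1.le, ht.1.2.le⟩ h
  choose k τ h0 h1 hlt hτ using fun g : P => exists_times (hfin g).toFinset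
    fun t ht => ((hfin g).mem_toFinset.1 ht).1
  have hle (g : P) {i j : ℕ} (hij : i ≤ j) (hj : j ≤ k g + 1) : τ g i ≤ τ g j := by
    rcases hij.eq_or_lt with rfl | h
    · exact le_rfl
    · exact (hlt g i j h hj).le
  let γ : (Σ g : P, Fin (k g + 1)) → ℝ → ℝ × ℝ := fun x s =>
    D.curve x.1 (τ x.1 x.2 + s * (τ x.1 (x.2 + 1) - τ x.1 x.2))
  have hx (x : Σ g : P, Fin (k g + 1)) : 0 ≤ τ x.1 x.2 ∧ τ x.1 x.2 < τ x.1 (x.2 + 1) ∧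
      τ x.1 (x.2 + 1) ≤ 1 := by
    have := x.2.2
    refine ⟨?_, hlt _ _ _ (Nat.lt_succ_self _) (by omega), ?_⟩
    · rw [← h0 x.1]; exact hle _ (Nat.zero_le _) (by omega)
    · rw [← h1 x.1]; exact hle _ (by omega) le_rfl
  have γ0 (x) : γ x 0 = D.curve x.1 (τ x.1 x.2) := by simp [γ]
  have γ1 (x) : γ x 1 = D.curve x.1 (τ x.1 (x.2 + 1)) := by simp [γ]
  have hne (x) : γ x 0 ≠ γ x 1 := fun h => by
    rw [γ0, γ1] at h
    obtain ⟨a, b, c⟩ := hx x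
    exact b.ne (curve_inj ⟨a, by linarith⟩ ⟨by linarith, c⟩ h)
  obtain ⟨S, hS, hSd⟩ := exists_polygonal_sets γ (fun x => by
    have : Continuous (D.curve x.1) := Path.continuous_extend _
    fun_prop) hne (by
    rintro x y s ⟨hs0, hs1⟩ t ⟨ht0, ht1⟩ h
    obtain ⟨a, b, c⟩ := hx x
    obtain ⟨a', b', c'⟩ := hx y
    obtain ⟨g, i⟩ := x
    obtain ⟨g', j⟩ := y
    dsimp only at a b c a' b' c'
    have u1 : τ g i < τ g i + s * (τ g (i + 1) - τ g i) := by nlinarith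
    have u2 : τ g i + s * (τ g (i + 1) - τ g i) < τ g (i + 1) := by nlinarith
    have v1 : τ g' j ≤ τ g' j + t * (τ g' (j + 1) - τ g' j) := by nlinarith
    have v2 : τ g' j + t * (τ g' (j + 1) - τ g' j) ≤ τ g' (j + 1) := by nlinarith
    simp only [γ] at h
    by_cases hg : g = g'
    · subst hg
      have he := curve_inj ⟨by linarith, by linarith⟩ ⟨by linarith, by linarith⟩ h
      have hij : i = j := by
        have := i.2
        have := j.2
        rcases lt_trichotomy (i : ℕ) j with h | h | h
        · have := hle g (show (i : ℕ) + 1 ≤ j from h) (by omega)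
          linarith
        · exact Fin.ext h
        · have := hle g (show (j : ℕ) + 1 ≤ i from h) (by omega)
          linarith
      subst hij
      refine ⟨rfl, ?_⟩
      have : (t - s) * (τ g (i + 1) - τ g i) = 0 := by linarith
      rcases mul_eq_zero.1 this with h | h <;> linarith
    · exfalso
      set u := τ g i + s * (τ g (i + 1) - τ g i)
      set v := τ g' j + t * (τ g' (j + 1) - τ g' j)
      have hu : u ∈ Ioo (0 : ℝ) 1 := ⟨by linarith, by linarith⟩
      have hv : v ∈ Ioo (0 : ℝ) 1 := by
        refine ⟨lt_of_le_of_ne (by linarith) fun hv => ?_, lt_of_le_of_ne (by linarith)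
          fun hv => ?_⟩
        · rw [← hv, curve_zero] at h
          exact curve_ne_pos hu _ h
        · rw [hv, curve_one] at h
          exact curve_ne_pos hu _ h
      have hne := hP g g.2 g' g'.2 fun h => hg (Subtype.ext h)
      obtain ⟨m, hm, hmu⟩ := hτ g u ((hfin g).mem_toFinset.2 ⟨hu, isInteriorPoint_curve hu, _, _,
        g'.1.adj, hne, by rw [h]; exact isInteriorPoint_curve hv⟩)
      have := i.2
      rcases Nat.lt_or_ge (i : ℕ) m with h | h
      · have := hle g (show (i : ℕ) + 1 ≤ m from h) (by omega)
        linarith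
      · have := hle g h (by omega)
        linarith)
  choose n f f0 fn fS finj fsimp using fun x => exists_simple_chain (S x) (hS x)
  refine ⟨k, τ, ⟨n, f, fun {x a b} => finj x a b, fun {x a b} => fsimp x a b,
    fun {x y} hxy a ha b hb p hp hp' => ?_⟩, fun g => ⟨h0 g, h1 g⟩, hlt, fun x => ⟨?_, ?_⟩⟩
  · rw [f0, fn, f0, fn]
    exact hSd x y hxy p (fS x a ha hp) (fS y b hb hp')
  · exact (f0 x).trans (γ0 x)
  · exact (fn x).trans (γ1 x)

end PlaneDrawing

namespace RotMap

variable {V P D : Type*} {M : RotMap P D} {pos : V → P}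

/-- Concatenation of lists of darts with matching ends. -/
lemma exists_glue {n : ℕ} (hn : 0 < n) (L : Fin n → List D) (q : ℕ → P) (hne : ∀ i, L i ≠ [])
    (hhead : ∀ i, ∀ d ∈ (L i).head?, M.src d = q i)
    (hlast : ∀ i, ∀ d ∈ (L i).getLast?, M.src (M.inv d) = q (i + 1))
    (hchain : ∀ i, (L i).IsChain fun d d' => M.src (M.inv d) = M.src d' ∧ ∀ w, M.src d' ≠ pos w)
    (hq : ∀ i, 0 < i → i < n → ∀ w, q i ≠ pos w) (hnd : ∀ i, (L i).Nodup)
    (hdisj : ∀ i j d, d ∈ L i → d ∈ L j → i = j) :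
    ∃ l : List D, l ≠ [] ∧ (∀ d ∈ l.head?, M.src d = q 0) ∧
      (∀ d ∈ l.getLast?, M.src (M.inv d) = q n) ∧
      (l.IsChain fun d d' => M.src (M.inv d) = M.src d' ∧ ∀ w, M.src d' ≠ pos w) ∧
      (∀ d, d ∈ l ↔ ∃ i, d ∈ L i) ∧ l.Nodup := by
  induction n generalizing q with
  | zero => exact absurd hn (lt_irrefl 0)
  | succ n ih =>
    rcases Nat.eq_zero_or_pos n with rfl | hn'
    · exact ⟨L 0, hne 0, hhead 0, hlast 0, hchain 0,
        fun d => ⟨fun h => ⟨0, h⟩, fun ⟨i, h⟩ => by rwa [Fin.fin_one_eq_zero i] at h⟩, hnd 0⟩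
    · obtain ⟨l, h1, h2, h3, h4, h5, h6⟩ := ih hn' (fun i => L i.succ) (fun i => q (i + 1))
        (fun i => hne _) (fun i => hhead i.succ) (fun i => hlast i.succ) (fun i => hchain _)
        (fun i _ hi => hq (i + 1) (by omega) (by omega)) (fun i => hnd _)
        fun i j d hi hj => Fin.succ_injective _ (hdisj _ _ d hi hj)
      refine ⟨L 0 ++ l, by simp [h1], fun d hd => ?_, fun d hd => ?_, ?_, fun d => ?_, ?_⟩
      · rw [List.head?_append_of_ne_nil _ (hne 0)] at hd
        exact hhead 0 d hd
      · rw [List.getLast?_append_of_ne_nil _ h1] at hd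
        exact h3 d hd
      · refine List.isChain_append.2 ⟨hchain 0, h4, fun a ha b hb => ?_⟩
        have e1 := hlast 0 a ha
        have e2 := h2 b hb
        exact ⟨e1.trans e2.symm, by rw [e2]; exact hq 1 one_pos (by omega)⟩
      · rw [List.mem_append, h5, Fin.exists_fin_succ]
      · refine List.nodup_append.2 ⟨hnd 0, h6, fun a ha b hb hab => ?_⟩
        obtain ⟨i, hi⟩ := (h5 b).1 hb
        exact (Fin.succ_ne_zero i) (hdisj _ _ b hi (hab ▸ ha))

lemma crossNum_le_card [DecidableEq P] {l : List D} {B : Finset P} (hl : (l.map M.src).Nodup)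
    (hB : ∀ a b, [a, b] <:+: l → M.Cross a b → M.src b ∈ B) : M.crossNum l ≤ B.card := by
  suffices h : M.crossNum l ≤ (B.filter fun x => x ∈ l.tail.map M.src).card from
    h.trans (card_le_card (filter_subset _ _))
  induction l with
  | nil => simp [crossNum]
  | cons a l ih =>
    cases l with
    | nil => simp [crossNum]
    | cons b l =>
      have ih' := ih (List.nodup_cons.1 hl).2
        fun a b h => hB a b (h.trans (List.suffix_cons _ _).isInfix)
      rw [List.tail_cons] at ih' ⊢
      rw [crossNum]
      by_cases hc : M.Cross a b
      · rw [if_pos hc, add_comm]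
        refine (Nat.succ_le_succ ih').trans (Nat.succ_le_of_lt (card_lt_card ?_))
        refine (Finset.ssubset_iff_of_subset (monotone_filter_right _ fun x _ hx => ?_)).2
          ⟨M.src b, ?_, ?_⟩
        · rw [List.map_cons]
          exact List.mem_cons_of_mem _ hx
        · exact mem_filter.2 ⟨hB a b ⟨[], l, rfl⟩ hc, by simp⟩
        · intro h
          have := (mem_filter.1 h).2
          rw [List.map_cons, List.map_cons] at hl
          exact (List.nodup_cons.1 (List.nodup_cons.1 hl).2).1 this
      · rw [if_neg hc, zero_add]
        refine ih'.trans (card_le_card (monotone_filter_right _ fun x _ hx => ?_))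
        rw [List.map_cons]
        exact List.mem_cons_of_mem _ hx

end RotMap

lemma ChainSystem.ends_of_eq {J : Type*} {C : ChainSystem J} {j k : J} {a b : ℕ} (hjk : j ≠ k)
    (hj : 0 < C.n j) (hk : 0 < C.n k) (ha : a ≤ C.n j) (hb : b ≤ C.n k) (h : C.f j a = C.f k b) :
    (a = 0 ∨ a = C.n j) ∧ (b = 0 ∨ b = C.n k) := by
  have hs {j : J} {a : ℕ} (hj : 0 < C.n j) (ha : a ≤ C.n j) :
      ∃ i < C.n j, C.f j a ∈ segment ℝ (C.f j i) (C.f j (i + 1)) := by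
    rcases ha.lt_or_eq with h | h
    · exact ⟨a, h, left_mem_segment _ _ _⟩
    · refine ⟨a - 1, by omega, ?_⟩
      rw [Nat.sub_add_cancel (by omega)]
      exact right_mem_segment _ _ _
  obtain ⟨i, hi, h1⟩ := hs hj ha
  obtain ⟨i', hi', h2⟩ := hs hk hb
  rw [← h] at h2
  obtain ⟨h3, h4⟩ := C.disj hjk i hi i' hi' _ h1 h2
  rw [h] at h4
  exact ⟨h3.imp (C.inj ha (Nat.zero_le _)) (C.inj ha le_rfl),
    h4.imp (C.inj hb (Nat.zero_le _)) (C.inj hb le_rfl)⟩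

namespace PlaneDrawing

variable {V : Type*} {G : SimpleGraph V}

/-- Paths in a rotation system that represent the arcs of a drawing. -/
structure PathFamily {B : Type*} (M : RotMap (ℝ × ℝ) B) (D : PlaneDrawing G) (P : Set G.Dart) where
  path : P → List B
  isRoute : ∀ g, M.IsRoute D.pos g.1.fst g.1.snd (path g)
  nodup : ∀ g, (path g).Nodup
  src_inj : ∀ g, ∀ d ∈ path g, ∀ e ∈ path g, M.src d = M.src e → d = e
  src_inv_inj : ∀ g, ∀ d ∈ path g, ∀ e ∈ path g, M.src (M.inv d) = M.src (M.inv e) → d = e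
  exists_mem : ∀ d, ∃ g, d ∈ path g ∨ M.inv d ∈ path g
  eq_of_mem : ∀ g h d, d ∈ path g → d ∈ path h → g = h
  inv_notMem : ∀ g h d, d ∈ path g → M.inv d ∉ path h
  interior : ∀ g h, g ≠ h → ∀ d ∈ path g, ∀ e ∈ path h, ∀ p, (∀ w, p ≠ D.pos w) →
    (p = M.src d ∨ p = M.src (M.inv d)) → (p = M.src e ∨ p = M.src (M.inv e)) →
    D.IsInteriorPoint g.1.adj p

theorem exists_pathFamily [Finite V] (D : PlaneDrawing G) (P : Set G.Dart)
    (hP : ∀ g, g.symm ∈ P ↔ g ∉ P) (hG : ∀ v, ∃ w, G.Adj v w) :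
    ∃ (B : Type) (_ : Fintype B) (M : RotMap (ℝ × ℝ) B), M.IsPlanar ∧
      Nonempty (PathFamily M D P) := by
  have := Finite.of_injective (fun g : G.Dart => (g.fst, g.snd))
    fun a b hab => SimpleGraph.Dart.ext a b hab
  obtain ⟨k, τ, C, h01, hlt, hC⟩ := D.exists_chainSystem P fun g hg h hh hne he => by
    rcases SimpleGraph.dart_edge_eq_iff g h |>.1 he with rfl | rfl
    · exact hne rfl
    · exact (hP h).1 hg hh
  obtain ⟨B, hB, M, dart, hM, hsrc, hex, hinj, hninv⟩ := C.exists_rotMap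
  have hτ (g : P) {i : ℕ} (h0 : 0 < i) (hi : i < k g + 1) : τ g i ∈ Ioo (0 : ℝ) 1 := by
    have h1 := hlt g 0 i h0 hi.le
    have h2 := hlt g i _ hi le_rfl
    rw [(h01 g).1] at h1
    rw [(h01 g).2] at h2
    exact ⟨h1, h2⟩
  have hτ' (g : P) {i : ℕ} (hi : i ≤ k g + 1) : τ g i = 0 ∨ τ g i = 1 ∨ τ g i ∈ Ioo (0 : ℝ) 1 := by
    rcases Nat.eq_zero_or_pos i with rfl | h
    · exact .inl (h01 g).1
    · rcases hi.eq_or_lt with rfl | h'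
      · exact .inr (.inl (h01 g).2)
      · exact .inr (.inr (hτ g h h'))
  have hinjτ (g : P) {i j : ℕ} (hi : i ≤ k g + 1) (hj : j ≤ k g + 1)
      (h : D.curve g (τ g i) = D.curve g (τ g j)) : i = j := by
    have hI {i : ℕ} (hi : i ≤ k g + 1) : τ g i ∈ Icc (0 : ℝ) 1 := by
      rcases hτ' g hi with h | h | h
      · simp [h]
      · simp [h]
      · exact ⟨h.1.le, h.2.le⟩
    have h' := curve_inj (hI hi) (hI hj) h
    rcases lt_trichotomy i j with h | h | h
    · exact ((hlt g i j h hj).ne h').elim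
    · exact h
    · exact ((hlt g j i h hi).ne' h').elim
  have hn (x) : 0 < C.n x := by
    by_contra h
    have h0 := hC x
    rw [show C.n x = 0 by omega, h0.1] at h0
    have := x.2.2
    have := hinjτ x.1 (by omega) (by omega) h0.2
    omega
  have hvert {x} {a : ℕ} (ha : a ≤ C.n x) {w : V} (h : C.f x a = D.pos w) : a = 0 ∨ a = C.n x := by
    have : ∃ y b, b ≤ C.n y ∧ (b = 0 ∨ b = C.n y) ∧ C.f y b = D.pos w := by
      obtain ⟨u, hu⟩ := hG w
      by_cases hg : (⟨(w, u), hu⟩ : G.Dart) ∈ P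
      · refine ⟨⟨⟨_, hg⟩, 0⟩, 0, Nat.zero_le _, .inl rfl, ?_⟩
        rw [(hC _).1]
        dsimp only [Fin.val_zero]
        rw [(h01 _).1, curve_zero]
      · refine ⟨⟨⟨_, (hP _).2 hg⟩, Fin.last _⟩, _, le_rfl, .inr rfl, ?_⟩
        rw [(hC _).2]
        dsimp only [Fin.val_last]
        rw [(h01 _).2, curve_one]
        rfl
    obtain ⟨y, b, hb, hb', hy⟩ := this
    rw [← hy] at h
    by_cases hxy : x = y
    · subst hxy
      rwa [C.inj ha hb h]
    · exact (ChainSystem.ends_of_eq hxy (hn x) (hn y) ha hb h).1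
  have hpiece (x) := M.exists_glue (pos := D.pos) (hn x) (fun i => [dart x i]) (C.f x) (by simp)
    (by simp [hsrc]) (by simp [hsrc]) (by simp)
    (fun i h0 hi w h => by rcases hvert hi.le h with h | h <;> omega) (by simp)
    (fun i j d hi hj => by
      rw [List.mem_singleton] at hi hj
      have := hinj _ _ _ _ (hi.symm.trans hj)
      simpa using this)
  choose L hL1 hL2 hL3 hL4 hL5 hL6 using hpiece
  simp only [List.mem_singleton] at hL5
  have hpath (g : P) := M.exists_glue (pos := D.pos) (k g).succ_pos (fun i => L ⟨g, i⟩)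
    (fun i => D.curve g (τ g i)) (fun i => hL1 _)
    (fun i d hd => (hL2 _ d hd).trans (hC _).1) (fun i d hd => (hL3 _ d hd).trans (hC _).2)
    (fun i => hL4 _) (fun i h0 hi w => curve_ne_pos (hτ g h0 hi) w) (fun i => hL6 _)
    (fun i j d hi hj => by
      obtain ⟨a, ha⟩ := (hL5 _ _).1 hi
      obtain ⟨b, hb⟩ := (hL5 _ _).1 hj
      have := hinj _ _ _ _ (ha.symm.trans hb)
      simp only [Sigma.mk.injEq, heq_eq_eq, true_and] at this
      simpa using this.1)
  choose l hl1 hl2 hl3 hl4 hl5 hl6 using hpath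
  have hmem {g : P} {d : B} : d ∈ l g ↔ ∃ i a, d = dart ⟨g, i⟩ a := by simp only [hl5, hL5]
  have hends {g : P} {i j : Fin (k g + 1)} {a b : ℕ} (hij : i ≠ j) (ha : a ≤ C.n ⟨g, i⟩)
      (hb : b ≤ C.n ⟨g, j⟩) (h : C.f ⟨g, i⟩ a = C.f ⟨g, j⟩ b) :=
    ChainSystem.ends_of_eq (fun h => hij (by simpa using h)) (hn _) (hn _) ha hb h
  refine ⟨B, hB, M, hM, ⟨⟨l, fun g => ⟨fun d hd => ?_, fun d hd => ?_, hl1 g, hl4 g⟩, hl6,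
    fun g d hd e he h => ?_, fun g d hd e he h => ?_, fun d => ?_, fun g h d hd he => ?_,
    fun g h d hd he => ?_, fun g h hgh d hd e he p hp h1 h2 => ?_⟩⟩⟩
  · rw [hl2 g d hd, (h01 g).1, curve_zero]
  · rw [hl3 g d hd, (h01 g).2, curve_one]
  · obtain ⟨i, a, rfl⟩ := hmem.1 hd
    obtain ⟨j, b, rfl⟩ := hmem.1 he
    rw [(hsrc _ _).1, (hsrc _ _).1] at h
    by_cases hij : i = j
    · subst hij
      rw [Fin.ext (C.inj a.2.le b.2.le h)]
    · obtain ⟨h1, h2⟩ := hends hij a.2.le b.2.le h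
      rw [h1.resolve_right a.2.ne, h2.resolve_right b.2.ne, (hC _).1, (hC _).1] at h
      exact (hij (Fin.ext (hinjτ g (by omega) (by omega) h))).elim
  · obtain ⟨i, a, rfl⟩ := hmem.1 hd
    obtain ⟨j, b, rfl⟩ := hmem.1 he
    rw [(hsrc _ _).2, (hsrc _ _).2] at h
    by_cases hij : i = j
    · subst hij
      rw [Fin.ext (Nat.succ_injective (C.inj a.2 b.2 h))]
    · obtain ⟨h1, h2⟩ := hends (a := a + 1) (b := b + 1) hij a.2 b.2 h
      rw [h1.resolve_left (by omega), h2.resolve_left (by omega), (hC _).2, (hC _).2] at h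
      exact (hij (Fin.ext (Nat.succ_injective (hinjτ g i.2 j.2 h)))).elim
  · obtain ⟨⟨g, i⟩, a, rfl | rfl⟩ := hex d
    · exact ⟨g, .inl (hmem.2 ⟨i, a, rfl⟩)⟩
    · exact ⟨g, .inr (hmem.2 ⟨i, a, M.inv_inv _⟩)⟩
  · obtain ⟨i, a, rfl⟩ := hmem.1 hd
    obtain ⟨j, b, h'⟩ := hmem.1 he
    have := hinj _ _ _ _ h'
    simp only [Sigma.mk.injEq] at this
    exact this.1.1
  · obtain ⟨i, a, rfl⟩ := hmem.1 hd
    obtain ⟨j, b, h'⟩ := hmem.1 he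
    exact hninv _ _ _ _ h'.symm
  · have hpt {g : P} {d : B} (hd : d ∈ l g) (h : p = M.src d ∨ p = M.src (M.inv d)) :
        ∃ i a, a ≤ C.n ⟨g, i⟩ ∧ p = C.f ⟨g, i⟩ a := by
      obtain ⟨i, a, rfl⟩ := hmem.1 hd
      rcases h with rfl | rfl
      · exact ⟨i, a, a.2.le, (hsrc _ _).1⟩
      · exact ⟨i, a + 1, a.2, (hsrc _ _).2⟩
    obtain ⟨i, a, ha, rfl⟩ := hpt hd h1
    obtain ⟨j, b, hb, h'⟩ := hpt he h2
    obtain ⟨h3, -⟩ := ChainSystem.ends_of_eq (fun h => hgh (by simpa using congrArg Sigma.fst h))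
      (hn _) (hn _) ha hb h'
    obtain ⟨m, hm, hm'⟩ : ∃ m ≤ k g + 1, C.f ⟨g, i⟩ a = D.curve g (τ g m) := by
      have := i.2
      rcases h3 with rfl | rfl
      · exact ⟨i, by omega, (hC _).1⟩
      · exact ⟨i + 1, by omega, (hC _).2⟩
    rw [hm'] at hp ⊢
    rcases hτ' g hm with h | h | h
    · rw [h, curve_zero] at hp
      exact (hp _ rfl).elim
    · rw [h, curve_one] at hp
      exact (hp _ rfl).elim
    · exact isInteriorPoint_curve h

end PlaneDrawing

end

section

open Finset

namespace PlaneDrawing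

variable {V : Type*} {G : SimpleGraph V} {D : PlaneDrawing G}

lemma IsInteriorPoint.symm {u v : V} {h : G.Adj u v} {p : ℝ × ℝ} (hp : D.IsInteriorPoint h p) :
    D.IsInteriorPoint h.symm p := by
  obtain ⟨t, h0, h1, rfl⟩ := hp
  refine ⟨unitInterval.symm t, fun h => h1 ?_, fun h => h0 ?_, ?_⟩
  · rw [← unitInterval.symm_symm t, h, unitInterval.symm_zero]
  · rw [← unitInterval.symm_symm t, h, unitInterval.symm_one]
  · rw [D.arc_symm, Path.symm_apply, Function.comp_apply, unitInterval.symm_symm]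

namespace PathFamily

variable {B : Type*} {M : RotMap (ℝ × ℝ) B} {P : Set G.Dart} (F : PathFamily M D P)

open Classical in
/-- The routing given by a path for one orientation of every edge. -/
noncomputable def routing (hP : ∀ g, g.symm ∈ P ↔ g ∉ P) : M.Routing G D.pos where
  path g := if h : g ∈ P then F.path ⟨g, h⟩ else M.rev (F.path ⟨g.symm, (hP g).2 h⟩)
  isRoute g := by
    by_cases h : g ∈ P
    · rw [dif_pos h]
      exact F.isRoute ⟨g, h⟩
    · rw [dif_neg h]
      exact (F.isRoute ⟨g.symm, (hP g).2 h⟩).rev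
  path_symm g := by
    by_cases h : g ∈ P
    · rw [dif_neg fun h' => (hP g).1 h' h, dif_pos h]
      rfl
    · rw [dif_pos ((hP g).2 h), dif_neg h, M.rev_rev]

variable {F} {hP : ∀ g, g.symm ∈ P ↔ g ∉ P}

lemma mem_routing {g : G.Dart} {d : B} : d ∈ (F.routing hP).path g ↔
    (∃ h, d ∈ F.path ⟨g, h⟩) ∨ ∃ h, M.inv d ∈ F.path ⟨g.symm, h⟩ := by
  by_cases h : g ∈ P
  · simp [routing, h, hP]
  · have : d ∈ M.rev (F.path ⟨g.symm, (hP g).2 h⟩) ↔ M.inv d ∈ F.path ⟨g.symm, (hP g).2 h⟩ := by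
      rw [RotMap.rev, List.mem_reverse, List.mem_map]
      exact ⟨fun ⟨e, he, h⟩ => by rwa [← h, M.inv_inv], fun h => ⟨_, h, M.inv_inv d⟩⟩
    simp [routing, h, hP, this]

lemma mem_routing_symm {g : G.Dart} {d : B} :
    d ∈ (F.routing hP).path g.symm ↔ M.inv d ∈ (F.routing hP).path g := by
  rw [mem_routing, mem_routing, SimpleGraph.Dart.symm_symm, M.inv_inv, or_comm]

lemma exists_mem_routing (d : B) : ∃ g, d ∈ (F.routing hP).path g := by
  obtain ⟨g, h | h⟩ := F.exists_mem d
  · exact ⟨g, mem_routing.2 (.inl ⟨g.2, h⟩)⟩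
  · exact ⟨g.1.symm, mem_routing_symm.2 (mem_routing.2 (.inl ⟨g.2, h⟩))⟩

lemma eq_of_mem_routing {g g' : G.Dart} {d : B} (h : d ∈ (F.routing hP).path g)
    (h' : d ∈ (F.routing hP).path g') : g = g' := by
  rcases mem_routing.1 h with ⟨_, h1⟩ | ⟨_, h1⟩ <;> rcases mem_routing.1 h' with ⟨_, h2⟩ | ⟨_, h2⟩
  · exact congrArg Subtype.val (F.eq_of_mem _ _ _ h1 h2)
  · exact (F.inv_notMem _ _ _ h1 h2).elim
  · exact (F.inv_notMem _ _ _ h2 h1).elim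
  · exact SimpleGraph.Dart.symm_involutive.injective
      (congrArg Subtype.val (F.eq_of_mem _ _ _ h1 h2))

lemma routing_src_inj {g : G.Dart} {d e : B} (hd : d ∈ (F.routing hP).path g)
    (he : e ∈ (F.routing hP).path g) (h : M.src d = M.src e) : d = e := by
  rcases mem_routing.1 hd with ⟨h0, h1⟩ | ⟨h0, h1⟩ <;>
    rcases mem_routing.1 he with ⟨h0', h2⟩ | ⟨h0', h2⟩
  · exact F.src_inj _ _ h1 _ h2 h
  · exact ((hP g).1 h0' h0).elim
  · exact ((hP g).1 h0 h0').elim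
  · rw [← M.inv_inv d, ← M.inv_inv e]
    exact congrArg M.inv (F.src_inv_inj _ _ h1 _ h2 (by rwa [M.inv_inv, M.inv_inv]))

lemma routing_nodup (g : G.Dart) : ((F.routing hP).path g).Nodup := by
  by_cases h : g ∈ P
  · simpa [routing, h] using F.nodup _
  · simpa [routing, h, RotMap.rev] using
      (F.nodup ⟨g.symm, (hP g).2 h⟩).map (fun a b h => by rw [← M.inv_inv a, h, M.inv_inv])

lemma routing_interior {g g' : G.Dart} (hg : g.edge ≠ g'.edge) {d e : B}
    (hd : d ∈ (F.routing hP).path g) (he : e ∈ (F.routing hP).path g')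
    (hp : ∀ w, M.src d ≠ D.pos w) (h : M.src d = M.src e) : D.IsInteriorPoint g.adj (M.src d) := by
  rcases mem_routing.1 hd with ⟨h0, h1⟩ | ⟨h0, h1⟩ <;>
    rcases mem_routing.1 he with ⟨h0', h2⟩ | ⟨h0', h2⟩
  · exact F.interior ⟨g, h0⟩ _
      (fun h => hg (by simpa using congrArg (fun x : P => x.1.edge) h)) _ h1 _ h2 _ hp (.inl rfl)
        (.inl h)
  · exact F.interior ⟨g, h0⟩ _ (fun h => hg (by simpa using congrArg (fun x : P => x.1.edge) h))
      _ h1 _ h2 _ hp (.inl rfl) (.inr (by rw [h, M.inv_inv]))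
  · exact (F.interior _ _ (fun h => hg (by simpa using congrArg (fun x : P => x.1.edge) h))
      _ h1 _ h2 _ hp (.inr (by rw [M.inv_inv])) (.inl h)).symm
  · exact (F.interior _ _ (fun h => hg (by simpa using congrArg (fun x : P => x.1.edge) h))
      _ h1 _ h2 _ hp (.inr (by rw [M.inv_inv])) (.inr (by rw [h, M.inv_inv]))).symm

lemma isGood_routing [Finite V] [Fintype G.Dart] (hk : D.IsKPlane 2) : (F.routing hP).IsGood where
  count_eq d := by
    classical
    obtain ⟨g, hg⟩ := exists_mem_routing (F := F) (hP := hP) d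
    refine (Finset.sum_eq_single g (fun g' _ hne => List.count_eq_zero.2 fun h =>
      hne (eq_of_mem_routing h hg)) fun h => (h (mem_univ g)).elim).trans ?_
    exact List.count_eq_one_of_mem (routing_nodup g) hg
  crossNum_le g := by
    classical
    refine le_trans ?_ (hk g.adj)
    rw [Set.ncard_eq_toFinset_card _ (D.finite_edgeCrossings g.adj)]
    refine M.crossNum_le_card ((routing_nodup g).map_on fun _ ha _ hb => routing_src_inj ha hb)
      fun a b hab ⟨_, r, _, h1, h2, h3, _, _⟩ => ?_
    have hb := RotMap.Routing.mem_right_of_pair hab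
    have hp := (F.routing hP |>.isRoute g).src_ne hab
    obtain ⟨g', hr⟩ := exists_mem_routing (F := F) (hP := hP) r
    have hne : g.edge ≠ g'.edge := fun h => by
      rcases (SimpleGraph.dart_edge_eq_iff g g').1 h with rfl | rfl
      · exact h3 (routing_src_inj hr hb h1)
      · refine h2 (routing_src_inj hr ?_ (h1.trans ((F.routing hP |>.isRoute _).src_eq hab).symm))
        rw [← SimpleGraph.Dart.symm_symm g', mem_routing_symm, M.inv_inv]
        exact RotMap.Routing.mem_left_of_pair hab
    rw [Set.Finite.mem_toFinset]
    exact ⟨routing_interior hne hb hr hp h1.symm, _, _, g'.adj, hne,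
      h1 ▸ routing_interior hne.symm hr hb (h1 ▸ hp) h1⟩

open Classical in
lemma card_src_routing_le [Fintype V] [Fintype G.Dart] [Fintype B] (F : PathFamily M D P)
    (hP : ∀ g, g.symm ∈ P ↔ g ∉ P) {p : ℝ × ℝ} (hp : ∀ w, p ≠ D.pos w) :
    (univ.filter fun d => M.src d = p).card ≤ 4 := by
  have ⟨g, hg⟩ := Classical.axiomOfChoice (exists_mem_routing (F := F) (hP := hP))
  rw [← card_image_of_injOn (f := g) fun d hd e he h => routing_src_inj (hg d)
    (h ▸ hg e) ((mem_filter.1 hd).2.trans (mem_filter.1 he).2.symm)]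
  set T := (univ.filter fun d => M.src d = p).image g
  have h1 : T.card ≤ 2 * (T.image SimpleGraph.Dart.edge).card :=
    card_le_mul_card_image _ _ fun e _ => by
      by_cases h : e ∈ G.edgeSet
      · have h2 : (univ.filter fun g : G.Dart => g.edge = e).card = 2 := by
          convert G.dart_edge_fiber_card e h
        exact (card_le_card (filter_subset_filter _ (subset_univ T))).trans h2.le
      · rw [filter_eq_empty_iff.2 fun g _ (hg : g.edge = e) => h (hg ▸ g.edge_mem)]
        exact zero_le_two
  suffices h : (T.image SimpleGraph.Dart.edge).card ≤ 2 by omega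
  by_contra! h
  obtain ⟨a, b, c, ha, hb, hc, hab, hac, hbc⟩ := two_lt_card_iff.1 h
  have hT {e : Sym2 V} (he : e ∈ T.image SimpleGraph.Dart.edge) : ∃ d, M.src d = p ∧
      (g d).edge = e := by
    simpa [T] using he
  obtain ⟨a, rfl, rfl⟩ := hT ha
  obtain ⟨b, h2, rfl⟩ := hT hb
  obtain ⟨c, h3, rfl⟩ := hT hc
  obtain ⟨t₁, h4, h5, h6⟩ := routing_interior hab (hg a) (hg b) hp h2.symm
  obtain ⟨t₂, h7, h8, h9⟩ := routing_interior hbc (hg b) (hg c) (h2 ▸ hp) (h2.trans h3.symm)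
  obtain ⟨t₃, h10, h11, h12⟩ := routing_interior hac.symm (hg c) (hg a) (h3 ▸ hp) h3
  exact D.no_triple_point (g a).adj (g b).adj (g c).adj hab hac hbc t₁ t₂ t₃ h4 h5 h7 h8 h10 h11
    (by rw [h6, h9, h2]) (by rw [h9, h12, h2, h3])

end PathFamily

open Classical in
theorem exists_routing [Fintype V] [Fintype G.Dart] (D : PlaneDrawing G) (hk : D.IsKPlane 2)
    (hG : ∀ v, ∃ w, G.Adj v w) :
    ∃ (B : Type) (_ : Fintype B) (M : RotMap (ℝ × ℝ) B) (R : M.Routing G D.pos), M.IsPlanar ∧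
      R.IsGood ∧ ∀ p, (∀ w, p ≠ D.pos w) → (univ.filter fun d => M.src d = p).card ≤ 4 := by
  have hP (g : G.Dart) : g.symm ∈ {g : G.Dart | g.edge.out.1 = g.fst} ↔
      g ∉ {g : G.Dart | g.edge.out.1 = g.fst} := by
    have h := Sym2.out_fst_mem g.edge
    simp only [Set.mem_ofPred_eq, SimpleGraph.Dart.edge_symm]
    rcases Sym2.mem_iff.1 (show g.edge.out.1 ∈ s(g.fst, g.snd) from h) with h | h <;>
      simp [h, g.fst_ne_snd, g.fst_ne_snd.symm]
  obtain ⟨B, hB, M, hM, ⟨F⟩⟩ := D.exists_pathFamily _ hP hG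
  exact ⟨B, hB, M, F.routing hP, hM, PathFamily.isGood_routing hk, fun p hp =>
    F.card_src_routing_le hP hp⟩

end PlaneDrawing

lemma HasNoCycleOfLength.eq_or_eq {V : Type*} {G : SimpleGraph V} (h : HasNoCycleOfLength G 4)
    {a b c d : V} (h1 : G.Adj a b) (h2 : G.Adj b c) (h3 : G.Adj c d) (h4 : G.Adj d a) :
    a = c ∨ b = d := by
  by_contra! hne
  refine h a (.cons h1 (.cons h2 (.cons h3 (.cons h4 .nil)))) ?_ rfl
  rw [SimpleGraph.Walk.cons_isCycle_iff]
  simp [h1.ne, h1.ne', h2.ne, h3.ne, h4.ne, hne.1, hne.1.symm, hne.2]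

namespace PlaneDrawing

variable {V : Type*} {G : SimpleGraph V}

/-- The restriction of a drawing to an induced subgraph. -/
def induce (D : PlaneDrawing G) (s : Set V) : PlaneDrawing (G.induce s) where
  pos v := D.pos v
  pos_inj := D.pos_inj.comp Subtype.val_injective
  arc _ _ h := D.arc (SimpleGraph.induce_adj.1 h)
  arc_symm _ _ h := D.arc_symm (SimpleGraph.induce_adj.1 h)
  arc_inj _ _ h := D.arc_inj (SimpleGraph.induce_adj.1 h)
  no_vertex_mem _ _ h w t ht := by
    simpa only [Subtype.ext_iff] using D.no_vertex_mem (SimpleGraph.induce_adj.1 h) w t ht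
  finite_inter _ _ _ _ h₁ h₂ h := D.finite_inter (SimpleGraph.induce_adj.1 h₁)
    (SimpleGraph.induce_adj.1 h₂) fun h' => h (Sym2.map.injective Subtype.val_injective h')
  no_triple_point _ _ _ _ _ _ h₁ h₂ h₃ n₁ n₂ n₃ :=
    D.no_triple_point (SimpleGraph.induce_adj.1 h₁) (SimpleGraph.induce_adj.1 h₂)
      (SimpleGraph.induce_adj.1 h₃) (fun h' => n₁ (Sym2.map.injective Subtype.val_injective h'))
      (fun h' => n₂ (Sym2.map.injective Subtype.val_injective h'))
      fun h' => n₃ (Sym2.map.injective Subtype.val_injective h')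

lemma IsKPlane.induce [Finite V] {D : PlaneDrawing G} {k : ℕ} (hk : D.IsKPlane k) (s : Set V) :
    (D.induce s).IsKPlane k := by
  intro u v h
  refine (Set.ncard_le_ncard ?_ (D.finite_edgeCrossings (SimpleGraph.induce_adj.1 h))).trans (hk _)
  rintro p ⟨h1, x, y, h2, h3, h4⟩
  exact ⟨h1, x, y, SimpleGraph.induce_adj.1 h2,
    fun h' => h3 (Sym2.map.injective Subtype.val_injective h'), h4⟩

theorem card_dart_mul_le [Fintype V] [Nonempty V] [Fintype G.Dart] [DecidableRel G.Adj]
    {D : PlaneDrawing G} (hk : D.IsKPlane 2)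
    (hC : ∀ a b c d, G.Adj a b → G.Adj b c → G.Adj c d → G.Adj d a → a = c ∨ b = d)
    (hG : ∀ v, 2 ≤ G.degree v) : 588 * Fintype.card G.Dart ≤ 4600 * Fintype.card V := by
  classical
  have hG' (v : V) : ∃ w, G.Adj v w := (G.degree_pos_iff_exists_adj v).1 (two_pos.trans_le (hG v))
  obtain ⟨B, hB, M, R₀, hM, hR₀, hfib⟩ := D.exists_routing hk hG'
  obtain ⟨R, hR⟩ := RotMap.Routing.exists_isReduced hR₀ fun p hp => by convert hfib p hp
  obtain ⟨ρ, hρ⟩ := (RotMap.Routing.pieceMap hR.toIsGood).exists_rotation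
  let X := RotMap.Routing.crossingMap hR D.pos_inj hρ
  have : Nonempty R.Piece := by
    obtain ⟨v⟩ := ‹Nonempty V›
    obtain ⟨w, h⟩ := hG' v
    obtain ⟨x, -⟩ := X.exists_eq (g := ⟨(v, w), h⟩) (Nat.zero_le _)
    exact ⟨x⟩
  refine X.card_dart_mul_le (RotMap.Routing.isPlanar_pieceMap hR hM) hC (fun x hx h => ?_)
    fun S => RotMap.Routing.card_le_of_noncrossing hR hM D.pos_inj hρ hC S
  obtain ⟨w, hw, hne⟩ := exists_mem_ne (hG (X.arc x).fst) (X.arc x).snd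
  obtain ⟨y, hy, hy0⟩ := X.exists_eq (g := ⟨(_, w), (G.mem_neighborFinset _ _).1 hw⟩)
    (Nat.zero_le _)
  have hs : (RotMap.Routing.pieceMap hR.toIsGood).src y =
      (RotMap.Routing.pieceMap hR.toIsGood).src x := by
    rw [X.src_eq hy0, X.src_eq hx, hy]
  rw [hρ.eq_of_apply_eq h hs] at hy
  exact hne (by rw [hy])

end PlaneDrawing

theorem KPlanar.card_edgeFinset_mul_le {n : ℕ} : ∀ {V : Type} [Fintype V] (G : SimpleGraph V)
    [DecidableRel G.Adj] [DecidableEq V], Fintype.card V = n →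
    (∀ a b c d, G.Adj a b → G.Adj b c → G.Adj c d → G.Adj d a → a = c ∨ b = d) →
    KPlanar G 2 → 1176 * G.edgeFinset.card ≤ 4600 * Fintype.card V := by
  induction n with
  | zero =>
    intro V _ G _ _ hV _ _
    have := Fintype.card_eq_zero_iff.1 hV
    simp [Subsingleton.elim G ⊥]
  | succ n ih =>
    intro V _ G _ _ hV hC ⟨D, hk⟩
    by_cases hG : ∀ v, 2 ≤ G.degree v
    · have : Nonempty V := Fintype.card_pos_iff.1 (by omega)
      have := PlaneDrawing.card_dart_mul_le hk hC hG
      rw [G.dart_card_eq_twice_card_edges] at this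
      omega
    · push Not at hG
      obtain ⟨v, hv⟩ := hG
      have hcard : Fintype.card ({v}ᶜ : Set V) = n := by
        rw [Fintype.card_compl_set, hV]
        simp
      have := ih (G.induce {v}ᶜ) hcard
        (fun a b c d h1 h2 h3 h4 => by
          simpa only [Subtype.ext_iff] using hC a b c d h1 h2 h3 h4)
        ⟨D.induce _, hk.induce _⟩
      rw [G.card_edgeFinset_induce_compl_singleton, G.card_edgeFinset_deleteIncidenceSet] at this
      omega

end

theorem stmt_10 {V : Type} [Fintype V] (G : SimpleGraph V)
    (hC4 : HasNoCycleOfLength G 4) (hG : KPlanar G 2)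
    (hn : 2 ≤ Fintype.card V) :
    (G.edgeSet.ncard : ℝ) ≤
        (190125 / 3136 : ℝ) ^ ((1 : ℝ) / 3) * Fintype.card V ∧
      (G.edgeSet.ncard : ℝ) < 3.929 * Fintype.card V := by
  classical
  have h : 1176 * G.edgeSet.ncard ≤ 4600 * Fintype.card V := by
    rw [Set.ncard_eq_toFinset_card']
    exact hG.card_edgeFinset_mul_le G rfl fun a b c d h1 h2 h3 h4 => hC4.eq_or_eq h1 h2 h3 h4
  have h' : (1176 : ℝ) * G.edgeSet.ncard ≤ 4600 * Fintype.card V := by exact_mod_cast h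
  have hn' : (2 : ℝ) ≤ Fintype.card V := by exact_mod_cast hn
  have h3 : (4600 / 1176 : ℝ) ≤ (190125 / 3136 : ℝ) ^ ((1 : ℝ) / 3) := by
    rw [one_div, Real.le_rpow_inv_iff_of_pos (by norm_num) (by norm_num) (by norm_num)]
    norm_num
  constructor
  · nlinarith
  · linarith
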